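/- For every 0 < ε < 1 and every increasing unbounded function ω : ℝ⁺ → ℝ⁺ there exists p₀ = p₀(ε, ω) such that: if p > p₀ is a prime and A ⊆ F_p² satisfies |A| > ω(p)·p^{5/4}, then for at least (1 − ε)|A| many points a ∈ A one has Δ(A;a) > (1 − ε)p. -/

import Mathlib

namespace Stmt1

/-- The (algebraic) squared distance in the plane `F²`. -/
def dist2 {F : Type*} [CommRing F] (x y : F × F) : F :=
  (x.1 - y.1) ^ 2 + (x.2 - y.2) ^ 2

/-- `Δ(A;x)`, the number of distances from the pin `x` to points of `A`. -/
noncomputable def pinnedCount {F : Type*} [CommRing F] (A : Finset (F × F)) (x : F × F) : ℕ :=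
  Set.ncard ((fun a => dist2 a x) '' (A : Set (F × F)))

end Stmt1

namespace Stmt1
open MvPolynomial

/-- The space of polynomials of degree at most `k i` in the `i`-th variable. -/
noncomputable def boxSpace (K : Type*) [Field K] (k : Fin 3 → ℕ) :
    Submodule K (MvPolynomial (Fin 3) K) :=
  restrictSupport K {m | ∀ i, m i ≤ k i}

section Rays

variable {K : Type*} [Field K]

theorem mem_boxSpace {k : Fin 3 → ℕ} {f : MvPolynomial (Fin 3) K} :
    f ∈ boxSpace K k ↔ ∀ i, degreeOf i f ≤ k i := by
  rw [boxSpace, mem_restrictSupport_iff]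
  simp only [degreeOf_le_iff]
  constructor
  · intro h i m hm
    exact h hm i
  · intro h m hm i
    exact h i m hm

/-- The finite index type of the monomial basis of `boxSpace`. -/
noncomputable def boxEquiv (k : Fin 3 → ℕ) :
    {m : Fin 3 →₀ ℕ | ∀ i, m i ≤ k i} ≃ (∀ i, Fin (k i + 1)) where
  toFun m i := ⟨m.1 i, Nat.lt_succ_of_le (m.2 i)⟩
  invFun g := ⟨Finsupp.equivFunOnFinite.symm fun i => (g i : ℕ), fun i => Nat.le_of_lt_succ (g i).2⟩
  left_inv m := by ext i; simp
  right_inv g := by ext i; simp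

noncomputable instance (k : Fin 3 → ℕ) : Fintype {m : Fin 3 →₀ ℕ | ∀ i, m i ≤ k i} :=
  Fintype.ofEquiv _ (boxEquiv k).symm

instance (k : Fin 3 → ℕ) : FiniteDimensional K (boxSpace K k) :=
  Module.Finite.of_basis (basisRestrictSupport K {m : Fin 3 →₀ ℕ | ∀ i, m i ≤ k i})

theorem finrank_boxSpace (k : Fin 3 → ℕ) :
    Module.finrank K (boxSpace K k) = ∏ i, (k i + 1) := by
  have h := Module.finrank_eq_card_basis
    (basisRestrictSupport K {m : Fin 3 →₀ ℕ | ∀ i, m i ≤ k i})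
  rw [boxSpace, h, Fintype.card_congr (boxEquiv k), Fintype.card_pi]
  simp

theorem totalDegree_le_of_mem_boxSpace {k : Fin 3 → ℕ} {f : MvPolynomial (Fin 3) K}
    (hf : f ∈ boxSpace K k) : f.totalDegree ≤ ∑ i, k i := by
  rw [boxSpace, mem_restrictSupport_iff] at hf
  refine Finset.sup_le fun m hm => ?_
  rw [Finsupp.sum_fintype _ _ (fun _ => rfl)]
  exact Finset.sum_le_sum fun i _ => hf hm i

/-- Restriction of a polynomial to the light ray `s ↦ (s, a + t s, b + t² s)`, where
`x = (t, a, b)`. -/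
noncomputable def onRay (x : K × K × K) : MvPolynomial (Fin 3) K →ₐ[K] Polynomial K :=
  aeval ![Polynomial.X, Polynomial.C x.2.1 + Polynomial.C x.1 * Polynomial.X,
    Polynomial.C x.2.2 + Polynomial.C (x.1 ^ 2) * Polynomial.X]

@[simp] theorem onRay_X0 (x : K × K × K) : onRay x (X 0) = Polynomial.X := by simp [onRay]

@[simp] theorem onRay_X1 (x : K × K × K) :
    onRay x (X 1) = Polynomial.C x.2.1 + Polynomial.C x.1 * Polynomial.X := by simp [onRay]

@[simp] theorem onRay_X2 (x : K × K × K) :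
    onRay x (X 2) = Polynomial.C x.2.2 + Polynomial.C (x.1 ^ 2) * Polynomial.X := by
  simp [onRay]

@[simp] theorem onRay_C (x : K × K × K) (c : K) : onRay x (C c) = Polynomial.C c := by
  simp [onRay, Polynomial.C_eq_algebraMap]

theorem natDegree_onRay_le (x : K × K × K) {f : MvPolynomial (Fin 3) K} {d : ℕ}
    (hf : f.totalDegree ≤ d) : (onRay x f).natDegree ≤ d := by
  have := aeval_natDegree_le f hf ![Polynomial.X, Polynomial.C x.2.1 + Polynomial.C x.1 * Polynomial.X,
    Polynomial.C x.2.2 + Polynomial.C (x.1 ^ 2) * Polynomial.X] (n := 1) (by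
      intro i
      fin_cases i
      · simp
      · simp only [Fin.mk_one, Matrix.cons_val_one, Matrix.cons_val_zero]; compute_degree
      · simp only [Fin.reduceFinMk, Matrix.cons_val]; compute_degree)
  simpa [onRay] using this

theorem exists_vanishing_on_rays (S : Finset (K × K × K)) (E : ℕ)
    (h : 3 * S.card ≤ (E + 1) ^ 2) :
    ∃ f : MvPolynomial (Fin 3) K, f ≠ 0 ∧ f.totalDegree ≤ 3 * E ∧ ∀ x ∈ S, onRay x f = 0 := by
  let L : boxSpace K (fun _ => E) →ₗ[K] (S × Fin (3 * E + 1) → K) :=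
    LinearMap.pi fun q => (Polynomial.lcoeff K q.2) ∘ₗ (onRay q.1.1).toLinearMap ∘ₗ
      (boxSpace K (fun _ => E)).subtype
  have hlt : Module.finrank K (S × Fin (3 * E + 1) → K)
      < Module.finrank K (boxSpace K (fun _ => E)) := by
    rw [finrank_boxSpace, Module.finrank_fintype_fun_eq_card]
    simp only [Fintype.card_prod, Fintype.card_coe, Fintype.card_fin, Finset.prod_const,
      Finset.card_univ]
    rcases Nat.eq_zero_or_pos S.card with h0 | h0
    · simp [h0]
    · nlinarith
  have hker := LinearMap.ker_ne_bot_of_finrank_lt (f := L) hlt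
  obtain ⟨f, hf, hf0⟩ := Submodule.exists_mem_ne_zero_of_ne_bot hker
  have hdeg : f.1.totalDegree ≤ 3 * E := by
    simpa using totalDegree_le_of_mem_boxSpace f.2
  refine ⟨f.1, fun h0 => hf0 (Subtype.ext h0), hdeg, fun x hx => ?_⟩
  ext j
  by_cases hj : j < 3 * E + 1
  · have := congrFun (LinearMap.mem_ker.1 hf) (⟨x, hx⟩, ⟨j, hj⟩)
    simpa [L] using this
  · rw [Polynomial.coeff_zero]
    apply Polynomial.coeff_eq_zero_of_natDegree_lt
    have := natDegree_onRay_le x hdeg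
    omega

theorem exists_separating_ray {x y : K × K × K} (hxy : x ≠ y) :
    ∃ h : MvPolynomial (Fin 3) K, (∀ i, degreeOf i h ≤ 1) ∧ onRay y h = 0 ∧ onRay x h ≠ 0 := by
  have key : ∀ (j : Fin 3) (c c' : K) (i : Fin 3),
      degreeOf i (X j - C c - C c' * X 0 : MvPolynomial (Fin 3) K) ≤ 1 := by
    intro j c c' i
    have h1 : degreeOf i (X j : MvPolynomial (Fin 3) K) ≤ 1 := by
      rw [degreeOf_X]; split_ifs <;> simp
    have h2 : degreeOf i (C c' * X 0 : MvPolynomial (Fin 3) K) ≤ 1 := by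
      refine (degreeOf_C_mul_le _ _ _).trans ?_
      rw [degreeOf_X]; split_ifs <;> simp
    refine (degreeOf_sub_le _ _ _).trans (max_le ((degreeOf_sub_le _ _ _).trans (max_le h1 ?_)) h2)
    simp [degreeOf_C]
  by_cases h1 : x.1 = y.1 ∧ x.2.1 = y.2.1
  · refine ⟨X 2 - C y.2.2 - C (y.1 ^ 2) * X 0, key _ _ _, by simp, fun h => hxy ?_⟩
    have := congrArg (Polynomial.eval 0) h
    simp [sub_eq_zero] at this
    exact Prod.ext h1.1 (Prod.ext h1.2 this)
  · refine ⟨X 1 - C y.2.1 - C y.1 * X 0, key _ _ _, by simp, fun h => h1 ?_⟩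
    have h0 := congrArg (Polynomial.eval 0) h
    have h2 := congrArg (Polynomial.eval 1) h
    simp [sub_eq_zero] at h0 h2
    rw [h0] at h2
    exact ⟨by linear_combination h2, h0⟩

theorem exists_separating_rays (S : Finset (K × K × K)) (x : K × K × K) (hx : x ∉ S) :
    ∃ h : MvPolynomial (Fin 3) K, (∀ i, degreeOf i h ≤ S.card) ∧
      (∀ y ∈ S, onRay y h = 0) ∧ onRay x h ≠ 0 := by
  classical
  induction S using Finset.induction_on with
  | empty => exact ⟨1, by simp, by simp, by simp⟩
  | insert y S hy ih =>
    obtain ⟨h, h1, h2, h3⟩ := ih (fun h => hx (Finset.mem_insert_of_mem h))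
    obtain ⟨h', h1', h2', h3'⟩ := exists_separating_ray (x := x) (y := y)
      (fun h => hx (h ▸ Finset.mem_insert_self _ _))
    refine ⟨h * h', fun i => ?_, ?_, ?_⟩
    · rw [Finset.card_insert_of_notMem hy]
      exact (degreeOf_mul_le _ _ _).trans (add_le_add (h1 i) (h1' i))
    · intro z hz
      rw [map_mul]
      rcases Finset.mem_insert.1 hz with rfl | hz
      · rw [h2', mul_zero]
      · rw [h2 z hz, zero_mul]
    · rw [map_mul]
      exact mul_ne_zero h3 h3'

theorem common_rays_box {f g : MvPolynomial (Fin 3) K} (hf : Irreducible f) (hfg : ¬ f ∣ g)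
    (S : Finset (K × K × K)) (hS : ∀ x ∈ S, onRay x f = 0 ∧ onRay x g = 0) (M : ℕ)
    (hM : ∀ i, degreeOf i f + degreeOf i g ≤ M) (hSM : S.card ≤ M) :
    (∏ i, (M - degreeOf i f + 1)) + (∏ i, (M - degreeOf i g + 1)) +
      S.card * (M - S.card + 1) ≤
    (M + 1) ^ 3 + ∏ i, (M - (degreeOf i f + degreeOf i g) + 1) := by
  classical
  have hf0 : f ≠ 0 := hf.ne_zero
  have hg0 : g ≠ 0 := fun h => hfg (h ▸ dvd_zero f)
  choose h h1 h2 h3 using fun x : S => exists_separating_rays (S.erase x) x.1 (by simp)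
  let U := boxSpace K (fun i => M - degreeOf i f)
  let V := boxSpace K (fun i => M - degreeOf i g)
  let W := boxSpace K (fun i => M - (degreeOf i f + degreeOf i g))
  let L := M - S.card + 1
  let H : (S × Fin L → K) →ₗ[K] MvPolynomial (Fin 3) K :=
    Fintype.linearCombination K (fun q : S × Fin L => h q.1 * X 0 ^ (q.2 : ℕ))
  let Φ : (U × V) × (S × Fin L → K) →ₗ[K] MvPolynomial (Fin 3) K :=
    LinearMap.coprod (LinearMap.coprod (LinearMap.mulLeft K f ∘ₗ U.subtype)
      (LinearMap.mulLeft K g ∘ₗ V.subtype)) H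
  have hΦ : ∀ u v c, Φ ((u, v), c) = f * u.1 + g * v.1 + H c := fun u v c => by simp [Φ]
  have hrange : LinearMap.range Φ ≤ boxSpace K (fun _ => M) := by
    rintro _ ⟨⟨⟨u, v⟩, c⟩, rfl⟩
    rw [hΦ]
    have hu := mem_boxSpace.1 u.2
    have hv := mem_boxSpace.1 v.2
    refine Submodule.add_mem _ (Submodule.add_mem _ ?_ ?_) ?_
    · refine mem_boxSpace.2 fun i => (degreeOf_mul_le _ _ _).trans ?_
      have := hu i; have := hM i; omega
    · refine mem_boxSpace.2 fun i => (degreeOf_mul_le _ _ _).trans ?_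
      have := hv i; have := hM i; omega
    · simp only [H, Fintype.linearCombination_apply]
      refine Submodule.sum_mem _ fun q _ => Submodule.smul_mem _ _ ?_
      refine mem_boxSpace.2 fun i => (degreeOf_mul_le _ _ _).trans ?_
      have e1 := h1 q.1 i
      rw [Finset.card_erase_of_mem q.1.2] at e1
      have e2 : degreeOf i (X 0 ^ (q.2 : ℕ) : MvPolynomial (Fin 3) K) ≤ q.2 := by
        refine (degreeOf_pow_le _ _ _).trans ?_
        rw [degreeOf_X]; split_ifs <;> simp
      have e3 := q.2.2
      have : 0 < S.card := Finset.card_pos.2 ⟨_, q.1.2⟩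
      simp only [L] at e3
      omega
  let Θ : W →ₗ[K] (U × V) × (S × Fin L → K) :=
    LinearMap.prod (LinearMap.prod
      (LinearMap.codRestrict U (LinearMap.mulLeft K g ∘ₗ W.subtype) (by
        intro w
        refine mem_boxSpace.2 fun i => (degreeOf_mul_le _ _ _).trans ?_
        have h1 := mem_boxSpace.1 w.2 i; have h2 := hM i; simp only [Submodule.subtype_apply]; omega))
      (LinearMap.codRestrict V (-(LinearMap.mulLeft K f ∘ₗ W.subtype)) (by
        intro w
        rw [LinearMap.neg_apply]
        refine Submodule.neg_mem _ ?_
        refine mem_boxSpace.2 fun i => (degreeOf_mul_le _ _ _).trans ?_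
        have h1 := mem_boxSpace.1 w.2 i; have h2 := hM i; simp only [Submodule.subtype_apply]; omega))) 0
  have hker : LinearMap.ker Φ ≤ LinearMap.range Θ := by
    rintro ⟨⟨u, v⟩, c⟩ hk
    rw [LinearMap.mem_ker, hΦ] at hk
    have hc : c = 0 := by
      ext ⟨x, j⟩
      have e := congrArg (onRay x.1) hk
      simp only [map_add, map_mul, (hS x.1 x.2).1, (hS x.1 x.2).2, zero_mul, zero_add,
        map_zero, H, Fintype.linearCombination_apply, map_sum, map_smul] at e
      rw [Fintype.sum_prod_type, Finset.sum_eq_single x] at e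
      · simp only [map_pow, onRay_X0] at e
        have e' : onRay x.1 (h x) * ∑ j : Fin L, Polynomial.monomial j (c (x, j)) = 0 := by
          rw [← e, Finset.mul_sum]
          refine Finset.sum_congr rfl fun j _ => ?_
          rw [← Polynomial.C_mul_X_pow_eq_monomial, Polynomial.smul_eq_C_mul]; ring
        have e2 := (mul_eq_zero.1 e').resolve_left (h3 x)
        have e3 := congrArg (fun P => Polynomial.coeff P (j : ℕ)) e2
        simp only [Polynomial.finsetSum_coeff, Polynomial.coeff_monomial,
          Polynomial.coeff_zero] at e3
        simpa [Fin.val_inj] using e3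
      · intro y _ hy
        refine Finset.sum_eq_zero fun j _ => ?_
        rw [h2 y x.1 (Finset.mem_erase.2 ⟨fun hh => hy (Subtype.ext hh.symm), x.2⟩), zero_mul,
          smul_zero]
      · intro hx; exact absurd (Finset.mem_univ _) hx
    subst hc
    rw [map_zero, add_zero] at hk
    have hdv : f ∣ v.1 := by
      have : f ∣ g * v.1 := ⟨-u.1, by linear_combination hk⟩
      exact (hf.prime.dvd_or_dvd this).resolve_left hfg
    obtain ⟨w, hw⟩ := hdv
    have hu : u.1 = g * (-w) := by
      apply mul_left_cancel₀ hf0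
      rw [hw] at hk
      linear_combination hk
    have hwW : -w ∈ W := by
      refine Submodule.neg_mem _ (mem_boxSpace.2 fun i => ?_)
      by_cases hw0 : w = 0
      · simp [hw0]
      have := mem_boxSpace.1 v.2 i
      rw [hw, degreeOf_mul_eq hf0 hw0] at this
      have := hM i
      omega
    refine ⟨⟨-w, hwW⟩, ?_⟩
    refine Prod.ext (Prod.ext (Subtype.ext ?_) (Subtype.ext ?_)) ?_
    · simpa [Θ] using hu.symm
    · simpa [Θ] using hw.symm
    · simp [Θ]
  have r := (LinearMap.finrank_range_add_finrank_ker Φ).symm.le.trans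
    (add_le_add (Submodule.finrank_mono hrange)
      ((Submodule.finrank_mono hker).trans (LinearMap.finrank_range_le Θ)))
  rw [Module.finrank_prod, Module.finrank_prod, Module.finrank_fintype_fun_eq_card] at r
  simpa only [U, V, W, finrank_boxSpace, Fintype.card_prod, Fintype.card_coe, Fintype.card_fin,
    L, Finset.prod_const, Finset.card_univ] using r

theorem card_common_rays_le {f g : MvPolynomial (Fin 3) K} (hf : Irreducible f) (hfg : ¬ f ∣ g)
    (S : Finset (K × K × K)) (hS : ∀ x ∈ S, onRay x f = 0 ∧ onRay x g = 0) {d e : ℕ}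
    (hd : f.totalDegree ≤ d) (he : g.totalDegree ≤ e) :
    S.card ≤ 6 * d * e := by
  by_contra! hlt
  set n := S.card with hn
  have hdi : ∀ i, degreeOf i f ≤ d := fun i => (degreeOf_le_totalDegree f i).trans hd
  have hei : ∀ i, degreeOf i g ≤ e := fun i => (degreeOf_le_totalDegree g i).trans he
  have key := common_rays_box hf hfg S hS (d + e + n ^ 2 + n)
    (fun i => by have := hdi i; have := hei i; omega) (by rw [← hn]; omega)
  rw [← hn] at key
  simp only [Fin.prod_univ_three] at key
  have hd0 := hdi 0; have hd1 := hdi 1; have hd2 := hdi 2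
  have he0 := hei 0; have he1 := hei 1; have he2 := hei 2
  generalize degreeOf 0 f = d0 at *
  generalize degreeOf 1 f = d1 at *
  generalize degreeOf 2 f = d2 at *
  generalize degreeOf 0 g = e0 at *
  generalize degreeOf 1 g = e1 at *
  generalize degreeOf 2 g = e2 at *
  have hle : ∀ x ≤ d + e, d + e + n ^ 2 + n - x + 1 = (d + e - x) + n ^ 2 + n + 1 := by
    intro x hx; omega
  rw [show d + e + n ^ 2 + n - n + 1 = d + e + n ^ 2 + 1 by omega] at key
  obtain ⟨a, ha⟩ : ∃ a : ℤ, a = d + e + n ^ 2 + n + 1 := ⟨_, rfl⟩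
  zify at key
  rw [Nat.cast_sub (by omega), Nat.cast_sub (by omega), Nat.cast_sub (by omega),
    Nat.cast_sub (by omega), Nat.cast_sub (by omega), Nat.cast_sub (by omega),
    Nat.cast_sub (by omega), Nat.cast_sub (by omega), Nat.cast_sub (by omega)] at key
  push_cast at key
  have key2 : (n : ℤ) * (a - n) ≤ a * (d0 * e1 + d0 * e2 + d1 * e0 + d1 * e2 + d2 * e0 + d2 * e1)
      := by
    have hpos : (0 : ℤ) ≤ (d0 + e0) * (d1 + e1) * (d2 + e2) - d0 * d1 * d2 - e0 * e1 * e2 := by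
      have : (d0 + e0) * (d1 + e1) * (d2 + e2) - d0 * d1 * d2 - e0 * e1 * e2 = 
        ((d0 * d1 * e2 + d0 * e1 * d2 + d0 * e1 * e2 + e0 * d1 * d2 + e0 * d1 * e2 + e0 * e1 * d2 : ℕ) : ℤ) := by
        push_cast; ring
      rw [this]; positivity
    rw [ha]
    linarith [key, hpos]
  have hle2 : ∀ {x y : ℕ}, x ≤ d → y ≤ e → (x : ℤ) * y ≤ d * e := by
    intro x y hx hy
    exact_mod_cast Nat.mul_le_mul hx hy
  have s1 := hle2 hd0 he1
  have s2 := hle2 hd0 he2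
  have s3 := hle2 hd1 he0
  have s4 := hle2 hd1 he2
  have s5 := hle2 hd2 he0
  have s6 := hle2 hd2 he1
  have hlt' : (6 : ℤ) * d * e + 1 ≤ n := by exact_mod_cast hlt
  have ha0 : (n : ℤ) ^ 2 < a := by rw [ha]; nlinarith
  have : (n : ℤ) * (a - n) ≤ a * (n - 1) :=
    key2.trans (mul_le_mul_of_nonneg_left (by linarith) (by nlinarith))
  nlinarith

end Rays
end Stmt1

namespace Stmt1
open MvPolynomial

section Deriv

variable {K : Type*} [Field K]

theorem pderiv_comm_apply {σ : Type*} (i j : σ) (f : MvPolynomial σ K) :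
    pderiv i (pderiv j f) = pderiv j (pderiv i f) := by
  classical
  ext m
  simp only [coeff_pderiv]
  rw [add_right_comm]
  by_cases h : i = j
  · subst h; rfl
  · simp [h, Ne.symm h]
    ring

theorem totalDegree_pderiv_le {σ : Type*} (i : σ) (f : MvPolynomial σ K) :
    (pderiv i f).totalDegree ≤ f.totalDegree - 1 := by
  classical
  refine Finset.sup_le fun m hm => ?_
  rw [mem_support_iff, coeff_pderiv] at hm
  have := le_totalDegree (mem_support_iff.2 (left_ne_zero_of_mul hm))
  rw [Finsupp.sum_add_index' (fun _ => rfl) (fun _ _ _ => rfl), Finsupp.sum_single_index rfl] at this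
  omega

theorem exists_pderiv_ne_zero (p : ℕ) [CharP K p] {f : MvPolynomial (Fin 3) K}
    (hf : 0 < f.totalDegree) (hp : f.totalDegree < p) : ∃ i, pderiv i f ≠ 0 := by
  classical
  have : ∃ m ∈ f.support, m ≠ 0 := by
    by_contra! h
    refine hf.ne' (Nat.le_zero.1 (Finset.sup_le fun m hm => ?_))
    rw [h m hm]; simp
  obtain ⟨m, hm, hm0⟩ := this
  obtain ⟨i, hi⟩ : ∃ i, m i ≠ 0 := by
    by_contra! h
    exact hm0 (Finsupp.ext h)
  refine ⟨i, fun h0 => ?_⟩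
  have h1 := congrArg (coeff (m - Finsupp.single i 1)) h0
  have h2 : m - Finsupp.single i 1 + Finsupp.single i 1 = m :=
    tsub_add_cancel_of_le (Finsupp.single_le_iff.2 (Nat.one_le_iff_ne_zero.2 hi))
  rw [coeff_pderiv, h2, coeff_zero] at h1
  have h3 : (m - Finsupp.single i 1 : Fin 3 →₀ ℕ) i + 1 = m i := by
    have := DFunLike.congr_fun h2 i
    simpa using this
  have h4 : (((m - Finsupp.single i 1 : Fin 3 →₀ ℕ) i : ℕ) : K) + 1 = ((m i : ℕ) : K) := by
    rw [← h3]; push_cast; ring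
  rw [h4] at h1
  rcases mul_eq_zero.1 h1 with h | h
  · exact mem_support_iff.1 hm h
  · rw [CharP.cast_eq_zero_iff K p] at h
    have h5 : m i ≤ f.totalDegree := (monomial_le_degreeOf i hm).trans (degreeOf_le_totalDegree f i)
    exact hi (Nat.eq_zero_of_dvd_of_lt h (by omega))

/-- The derivative of a polynomial along the direction `(1, t, t²)`. -/
noncomputable def rayDeriv (t : K) (f : MvPolynomial (Fin 3) K) : MvPolynomial (Fin 3) K :=
  pderiv 0 f + C t * pderiv 1 f + C (t ^ 2) * pderiv 2 f

theorem derivative_onRay (x : K × K × K) (f : MvPolynomial (Fin 3) K) :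
    Polynomial.derivative (onRay x f) = onRay x (rayDeriv x.1 f) := by
  induction f using MvPolynomial.induction_on with
  | C a => simp [rayDeriv]
  | add f g hf hg =>
    simp only [rayDeriv, map_add, map_mul, onRay_C] at hf hg ⊢
    rw [hf, hg]; ring
  | mul_X f i hf =>
    simp only [rayDeriv, map_add, map_mul, onRay_C] at hf ⊢
    rw [Polynomial.derivative_mul, hf]
    fin_cases i <;>
      simp [Derivation.leibniz, pderiv_X, -map_pow] <;> ring

/-- The derivative of `rayDeriv t` with respect to `t`. -/
noncomputable def rayDeriv' (t : K) (f : MvPolynomial (Fin 3) K) : MvPolynomial (Fin 3) K :=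
  pderiv 1 f + C (2 * t) * pderiv 2 f

theorem rayDeriv_comm (t : K) (f : MvPolynomial (Fin 3) K) :
    rayDeriv' t (rayDeriv t f) = rayDeriv t (rayDeriv' t f) := by
  simp only [rayDeriv, rayDeriv', map_add, pderiv_C_mul]
  rw [pderiv_comm_apply 1 0, pderiv_comm_apply 2 0, pderiv_comm_apply 2 1]
  ring

theorem pderiv_two_rayDeriv (t : K) (f : MvPolynomial (Fin 3) K) :
    pderiv 2 (rayDeriv t f) = rayDeriv t (pderiv 2 f) := by
  simp only [rayDeriv, map_add, pderiv_C_mul]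
  rw [pderiv_comm_apply 2 0, pderiv_comm_apply 2 1]

/-- Quotient coefficients of the pseudo-division of the second by the first ray derivative, as
polynomials in the direction. -/
noncomputable def umbQ2 (f : MvPolynomial (Fin 3) K) : MvPolynomial (Fin 3) K :=
  pderiv 2 f ^ 2 * pderiv 2 (pderiv 2 f)

/-- The coefficient of degree one in the direction; see `umbQ2`. -/
noncomputable def umbQ1 (f : MvPolynomial (Fin 3) K) : MvPolynomial (Fin 3) K :=
  pderiv 2 f ^ 2 * (2 * pderiv 1 (pderiv 2 f)) - pderiv 1 f * pderiv 2 f * pderiv 2 (pderiv 2 f)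

/-- The constant coefficient in the direction; see `umbQ2`. -/
noncomputable def umbQ0 (f : MvPolynomial (Fin 3) K) : MvPolynomial (Fin 3) K :=
  pderiv 2 f ^ 2 * (pderiv 1 (pderiv 1 f) + 2 * pderiv 0 (pderiv 2 f))
    - pderiv 0 f * pderiv 2 f * pderiv 2 (pderiv 2 f)
    - pderiv 1 f * pderiv 2 f * (2 * pderiv 1 (pderiv 2 f))
    + pderiv 1 f ^ 2 * pderiv 2 (pderiv 2 f)

/-- Remainder coefficients of the pseudo-division of the second by the first ray derivative. -/
noncomputable def umb1 (f : MvPolynomial (Fin 3) K) : MvPolynomial (Fin 3) K :=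
  pderiv 2 f ^ 3 * (2 * pderiv 0 (pderiv 1 f)) - pderiv 0 f * umbQ1 f - pderiv 1 f * umbQ0 f

/-- The constant remainder coefficient in the direction; see `umb1`. -/
noncomputable def umb0 (f : MvPolynomial (Fin 3) K) : MvPolynomial (Fin 3) K :=
  pderiv 2 f ^ 3 * pderiv 0 (pderiv 0 f) - pderiv 0 f * umbQ0 f

theorem umb_identity (t : K) (f : MvPolynomial (Fin 3) K) :
    pderiv 2 f ^ 3 * rayDeriv t (rayDeriv t f) =
      rayDeriv t f * (umbQ0 f + C t * umbQ1 f + C t ^ 2 * umbQ2 f) + (umb0 f + C t * umb1 f) := by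
  simp only [rayDeriv, umbQ0, umbQ1, umbQ2, umb0, umb1, map_add, pderiv_C_mul]
  rw [pderiv_comm_apply 1 0, pderiv_comm_apply 2 0, pderiv_comm_apply 2 1]
  simp only [map_pow]
  ring

theorem umb_identity' (t : K) (f : MvPolynomial (Fin 3) K) :
    pderiv 2 f ^ 3 * (2 * rayDeriv t (rayDeriv' t f)) =
      rayDeriv' t f * (umbQ0 f + C t * umbQ1 f + C t ^ 2 * umbQ2 f) +
        rayDeriv t f * (umbQ1 f + 2 * C t * umbQ2 f) + umb1 f := by
  simp only [rayDeriv, rayDeriv', umbQ0, umbQ1, umbQ2, umb1, map_add, pderiv_C_mul]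
  rw [pderiv_comm_apply 2 1]
  simp only [map_pow, map_mul]
  have h2 : (C 2 : MvPolynomial (Fin 3) K) = 2 := map_ofNat C 2
  rw [h2]
  ring

theorem totalDegree_mul_le' {f g : MvPolynomial (Fin 3) K} {a b c : ℕ}
    (hf : f.totalDegree ≤ a) (hg : g.totalDegree ≤ b) (h : a + b ≤ c) :
    (f * g).totalDegree ≤ c :=
  (totalDegree_mul f g).trans ((add_le_add hf hg).trans h)

theorem totalDegree_umb_le {f : MvPolynomial (Fin 3) K} {d : ℕ} (hd : f.totalDegree ≤ d) :
    (umb0 f).totalDegree ≤ 4 * d ∧ (umb1 f).totalDegree ≤ 4 * d := by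
  have h1 : ∀ i, (pderiv i f).totalDegree ≤ d := fun i =>
    (totalDegree_pderiv_le i f).trans ((Nat.sub_le _ _).trans hd)
  have h2 : ∀ i j, (pderiv i (pderiv j f)).totalDegree ≤ d := fun i j =>
    (totalDegree_pderiv_le i _).trans ((Nat.sub_le _ _).trans (h1 j))
  have hc : (2 : MvPolynomial (Fin 3) K).totalDegree ≤ 0 := by
    rw [← map_ofNat C 2, totalDegree_C]
  have h2' : ∀ i j, (2 * pderiv i (pderiv j f)).totalDegree ≤ d := fun i j =>
    totalDegree_mul_le' hc (h2 i j) (by omega)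
  have hadd : ∀ {a b : MvPolynomial (Fin 3) K} {c : ℕ}, a.totalDegree ≤ c → b.totalDegree ≤ c →
      (a + b).totalDegree ≤ c := fun ha hb => (totalDegree_add _ _).trans (max_le ha hb)
  have hsub : ∀ {a b : MvPolynomial (Fin 3) K} {c : ℕ}, a.totalDegree ≤ c → b.totalDegree ≤ c →
      (a - b).totalDegree ≤ c := fun ha hb => (totalDegree_sub _ _).trans (max_le ha hb)
  have hpow : ∀ i n, (pderiv i f ^ n).totalDegree ≤ n * d := fun i n =>
    (totalDegree_pow _ _).trans (Nat.mul_le_mul_left _ (h1 i))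
  have hpp : ∀ i j, (pderiv i f * pderiv j f).totalDegree ≤ 2 * d := fun i j =>
    totalDegree_mul_le' (h1 i) (h1 j) (by omega)
  have q1 : (umbQ1 f).totalDegree ≤ 3 * d :=
    hsub (totalDegree_mul_le' (hpow _ _) (h2' _ _) (by omega))
      (totalDegree_mul_le' (hpp _ _) (h2 _ _) (by omega))
  have q0 : (umbQ0 f).totalDegree ≤ 3 * d :=
    hadd (hsub (hsub (totalDegree_mul_le' (hpow _ _) (hadd (h2 _ _) (h2' _ _)) (by omega))
      (totalDegree_mul_le' (hpp _ _) (h2 _ _) (by omega)))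
      (totalDegree_mul_le' (hpp _ _) (h2' _ _) (by omega)))
      (totalDegree_mul_le' (hpow _ _) (h2 _ _) (by omega))
  exact ⟨hsub (totalDegree_mul_le' (hpow _ _) (h2 _ _) (by omega))
      (totalDegree_mul_le' (h1 _) q0 (by omega)),
    hsub (hsub (totalDegree_mul_le' (hpow _ _) (h2' _ _) (by omega))
      (totalDegree_mul_le' (h1 _) q1 (by omega))) (totalDegree_mul_le' (h1 _) q0 (by omega))⟩

/-- The rays `x` and `y` have different directions and meet at parameter `s`. -/
def MeetAt (s : K) (x y : K × K × K) : Prop :=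
  x.1 ≠ y.1 ∧ x.2.1 + x.1 * s = y.2.1 + y.1 * s ∧ x.2.2 + x.1 ^ 2 * s = y.2.2 + y.1 ^ 2 * s

theorem MeetAt.eval_onRay {s : K} {x y : K × K × K} (h : MeetAt s x y)
    (f : MvPolynomial (Fin 3) K) :
    (onRay x f).eval s = (onRay y f).eval s := by
  have : ((Polynomial.aeval s).comp (onRay x) : MvPolynomial (Fin 3) K →ₐ[K] K) =
      (Polynomial.aeval s).comp (onRay y) := by
    apply MvPolynomial.algHom_ext
    intro i
    fin_cases i
    · simp
    · simpa using h.2.1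
    · simpa using h.2.2
  simpa using DFunLike.congr_fun this f

theorem eval_onRay_rayDeriv_eq_zero {s : K} {x y : K × K × K} (h : MeetAt s x y)
    {f : MvPolynomial (Fin 3) K} (hy : onRay y f = 0) :
    (onRay x (rayDeriv y.1 f)).eval s = 0 ∧
      (onRay x (rayDeriv y.1 (rayDeriv y.1 f))).eval s = 0 := by
  rw [h.eval_onRay, h.eval_onRay, ← derivative_onRay, ← derivative_onRay, ← derivative_onRay, hy]
  simp

theorem eval_onRay_umb_eq_zero {s : K} {x y : K × K × K} (h : MeetAt s x y)
    {f : MvPolynomial (Fin 3) K} (hx : onRay x f = 0) (hy : onRay y f = 0) :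
    (onRay x (umb0 f)).eval s = 0 ∧ (onRay x (umb1 f)).eval s = 0 := by
  have key : ∀ t : K, (onRay x (rayDeriv t f)).eval s = 0 →
      (onRay x (rayDeriv t (rayDeriv t f))).eval s = 0 →
      (onRay x (umb0 f)).eval s + t * (onRay x (umb1 f)).eval s = 0 := by
    intro t h1 h2
    have := congrArg (fun g => (onRay x g).eval s) (umb_identity t f)
    simp only [map_mul, map_add, Polynomial.eval_add, Polynomial.eval_mul, h1, h2, onRay_C,
      Polynomial.eval_C] at this
    linear_combination -this
  have e1 := key y.1 (eval_onRay_rayDeriv_eq_zero h hy).1 (eval_onRay_rayDeriv_eq_zero h hy).2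
  have e2 := key x.1 (by rw [← derivative_onRay, hx]; simp)
    (by rw [← derivative_onRay, ← derivative_onRay, hx]; simp)
  have e3 : (x.1 - y.1) * (onRay x (umb1 f)).eval s = 0 := by linear_combination e2 - e1
  have e4 := (mul_eq_zero.1 e3).resolve_left (sub_ne_zero.2 h.1)
  exact ⟨by rw [e4] at e1; linear_combination e1, e4⟩

theorem onRay_rayDeriv'_meet {s : K} {x y : K × K × K} (h : MeetAt s x y)
    {f : MvPolynomial (Fin 3) K} (hx : onRay x f = 0) (hy : onRay y f = 0) :
    (onRay x (rayDeriv' x.1 f)).eval s = (onRay x (pderiv 2 f)).eval s * (x.1 - y.1) ∧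
    (onRay x (pderiv 0 f)).eval s = (onRay x (pderiv 2 f)).eval s * (x.1 * y.1) ∧
    (onRay x (pderiv 1 f)).eval s = - (onRay x (pderiv 2 f)).eval s * (x.1 + y.1) := by
  have e1 := (eval_onRay_rayDeriv_eq_zero h hy).1
  have e2 : (onRay x (rayDeriv x.1 f)).eval s = 0 := by rw [← derivative_onRay, hx]; simp
  simp only [rayDeriv, rayDeriv', map_mul, map_add, Polynomial.eval_add, Polynomial.eval_mul,
    onRay_C, Polynomial.eval_C] at e1 e2 ⊢
  have hne := sub_ne_zero.2 h.1
  have e3 : (onRay x (pderiv 1 f)).eval s = - (onRay x (pderiv 2 f)).eval s * (x.1 + y.1) := by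
    apply mul_left_cancel₀ hne
    linear_combination e2 - e1
  refine ⟨by rw [e3]; ring, ?_, e3⟩
  rw [e3] at e2
  linear_combination e2

theorem umbilic_ode {x : K × K × K} {f : MvPolynomial (Fin 3) K} (hx : onRay x f = 0)
    (h0 : f ∣ umb0 f) (h1 : f ∣ umb1 f) (hz : onRay x (pderiv 2 f) ≠ 0) {e z : Polynomial K}
    (he : e = onRay x (rayDeriv' x.1 f)) (hze : z = onRay x (pderiv 2 f)) :
    e * (e * z.derivative.derivative - z * e.derivative.derivative) =
      2 * e.derivative * (e * z.derivative - z * e.derivative) := by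
  have n0 : onRay x (rayDeriv x.1 f) = 0 := by rw [← derivative_onRay, hx]; simp
  have n1 : onRay x (rayDeriv x.1 (rayDeriv x.1 f)) = 0 := by rw [← derivative_onRay, n0]; simp
  obtain ⟨c, hc⟩ : f ∣ umb0 f + C x.1 * umb1 f := dvd_add h0 (h1.mul_left _)
  obtain ⟨c1, hc1⟩ := h1
  set q := umbQ0 f + C x.1 * umbQ1 f + C x.1 ^ 2 * umbQ2 f with hq
  have hg : pderiv 2 f ^ 3 * rayDeriv x.1 (rayDeriv x.1 f) - rayDeriv x.1 f * q = f * c := by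
    rw [umb_identity, ← hc]; ring
  have d2 := congrArg (fun g => onRay x (pderiv 2 g)) hg
  have d1 := congrArg (fun g => onRay x (rayDeriv' x.1 g)) hg
  have d3 := congrArg (onRay x) (umb_identity' x.1 f)
  have leib : ∀ a b : MvPolynomial (Fin 3) K,
      rayDeriv' x.1 (a * b) = a * rayDeriv' x.1 b + b * rayDeriv' x.1 a := by
    intro a b
    simp only [rayDeriv', Derivation.leibniz, smul_eq_mul]; ring
  have subl : ∀ a b : MvPolynomial (Fin 3) K,
      rayDeriv' x.1 (a - b) = rayDeriv' x.1 a - rayDeriv' x.1 b := by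
    intro a b
    simp only [rayDeriv', map_sub]; ring
  simp only [leib, subl, map_sub, Derivation.leibniz, smul_eq_mul, map_add, map_mul, n0, n1, hx,
    map_pow, rayDeriv_comm, pderiv_two_rayDeriv] at d1 d2
  rw [← derivative_onRay, ← derivative_onRay, ← he] at d1
  rw [← derivative_onRay, ← derivative_onRay, ← hze] at d2
  rw [← hq, hc1] at d3
  simp only [map_mul, map_add, hx, n0, map_pow] at d3
  rw [← derivative_onRay, ← he] at d3
  rw [← hze] at d1 d3
  rw [← hze] at hz
  have two : onRay x (2 : MvPolynomial (Fin 3) K) = 2 := map_ofNat _ 2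
  rw [two] at d3
  apply mul_left_cancel₀ (pow_ne_zero 3 hz)
  linear_combination (e * e) * d2 - e * z * d1 - (e * z.derivative - z * e.derivative) * d3
end Deriv
end Stmt1

namespace Stmt1
open MvPolynomial

section Structure

variable {K : Type*} [Field K]

theorem eq_C_mul_of_wronskian (p : ℕ) [CharP K p] {A B : Polynomial K} (hB : B ≠ 0)
    (hA : A.natDegree < p) (hBp : B.natDegree < p)
    (h : B * A.derivative = A * B.derivative) : ∃ c : K, A = Polynomial.C c * B := by
  set n := B.natDegree with hn
  have hlc : B.coeff n ≠ 0 := by rw [hn]; simpa using hB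
  refine ⟨A.coeff n / B.coeff n, ?_⟩
  set c := A.coeff n / B.coeff n
  set D := A - Polynomial.C c * B with hD
  have hDn : D.coeff n = 0 := by
    simp only [hD, Polynomial.coeff_sub, Polynomial.coeff_C_mul, c]
    field_simp; ring
  by_contra hne
  have hD0 : D ≠ 0 := fun h0 => hne (sub_eq_zero.1 h0)
  have hDdeg : D.natDegree < p := by
    refine (Polynomial.natDegree_sub_le _ _).trans_lt (max_lt hA ?_)
    exact (Polynomial.natDegree_C_mul_le _ _).trans_lt hBp
  have hDB : B * (Polynomial.X * D.derivative) = D * (Polynomial.X * B.derivative) := by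
    have : B * D.derivative = D * B.derivative := by
      simp only [hD, Polynomial.derivative_sub, Polynomial.derivative_C_mul]
      linear_combination h
    linear_combination Polynomial.X * this
  set m := D.natDegree with hm
  have hXd : ∀ (P : Polynomial K) (k : ℕ), (Polynomial.X * P.derivative).coeff k = k * P.coeff k := by
    intro P k
    cases k with
    | zero => simp
    | succ k => rw [Polynomial.coeff_X_mul, Polynomial.coeff_derivative]; push_cast; ring
  have hXdeg : ∀ P : Polynomial K, (Polynomial.X * P.derivative).natDegree ≤ P.natDegree := by
    intro P
    refine Polynomial.natDegree_le_iff_coeff_eq_zero.2 fun k hk => ?_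
    rw [hXd, Polynomial.coeff_eq_zero_of_natDegree_lt hk, mul_zero]
  have e1 := congrArg (fun P => Polynomial.coeff P (n + m)) hDB
  rw [Polynomial.coeff_mul_add_eq_of_natDegree_le le_rfl (hXdeg D), add_comm n m,
    Polynomial.coeff_mul_add_eq_of_natDegree_le le_rfl (hXdeg B), hXd, hXd] at e1
  have hDm : D.coeff m ≠ 0 := by rw [hm]; simpa using hD0
  have e2 : ((m : K) - n) * (B.coeff n * D.coeff m) = 0 := by linear_combination e1
  have e3 : (m : K) = n :=
    sub_eq_zero.1 ((mul_eq_zero.1 e2).resolve_right (mul_ne_zero hlc hDm))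
  rw [CharP.cast_eq_iff_mod_eq K p, Nat.mod_eq_of_lt hDdeg, Nat.mod_eq_of_lt hBp] at e3
  rw [e3] at hDm
  exact hDm hDn

theorem eq_linear_mul_of_ode (p : ℕ) [CharP K p] {e z : Polynomial K} {d : ℕ} (he0 : e ≠ 0) (he : e.natDegree ≤ d)
    (hz : z.natDegree ≤ d) (hp : 2 * d + 1 < p)
    (h : e * (e * z.derivative.derivative - z * e.derivative.derivative) =
      2 * e.derivative * (e * z.derivative - z * e.derivative)) :
    ∃ u v : K, z = (Polynomial.C u + Polynomial.C v * Polynomial.X) * e := by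
  have hder : ∀ P : Polynomial K, P.natDegree ≤ d → P.derivative.natDegree ≤ d := fun P hP =>
    (Polynomial.natDegree_derivative_le P).trans ((Nat.sub_le _ _).trans hP)
  have hw : (e * z.derivative - z * e.derivative).natDegree ≤ 2 * d := by
    refine (Polynomial.natDegree_sub_le _ _).trans (max_le ?_ ?_)
    · refine Polynomial.natDegree_mul_le.trans ?_
      have := hder z hz; omega
    · refine Polynomial.natDegree_mul_le.trans ?_
      have := hder e he; omega
  have he2 : (e ^ 2).natDegree ≤ 2 * d :=
    Polynomial.natDegree_pow_le.trans (Nat.mul_le_mul_left _ he)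
  obtain ⟨v, hv⟩ := eq_C_mul_of_wronskian p (A := e * z.derivative - z * e.derivative)
    (pow_ne_zero 2 he0) (by omega) (by omega) (by
      simp only [Polynomial.derivative_sub, Polynomial.derivative_mul, Polynomial.derivative_pow]
      simp only [Nat.cast_ofNat, Polynomial.C_ofNat]
      linear_combination e * h)
  obtain ⟨u, hu⟩ := eq_C_mul_of_wronskian p (A := z - Polynomial.C v * Polynomial.X * e) he0 (by
      refine (Polynomial.natDegree_sub_le _ _).trans_lt (max_lt (by omega) ?_)
      refine Polynomial.natDegree_mul_le.trans_lt ?_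
      have : (Polynomial.C v * Polynomial.X).natDegree ≤ 1 := by compute_degree
      omega) (by omega) (by
      simp only [Polynomial.derivative_sub, Polynomial.derivative_mul, Polynomial.derivative_C,
        Polynomial.derivative_X]
      linear_combination hv)
  exact ⟨u, v, by linear_combination hu⟩

theorem eq_zero_of_many_roots {P : Polynomial K} {d : ℕ}
    (hd : P.natDegree ≤ d) (T : Finset K) (hT : d < T.card) (h : ∀ s ∈ T, P.eval s = 0) : P = 0 :=
  Polynomial.eq_zero_of_natDegree_lt_card_of_eval_eq_zero' P T h (hd.trans_lt hT)

/-- The ray `x` meets more than `d` members of `Y`, lying in the zero set of `f`. -/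
def RichRay (f : MvPolynomial (Fin 3) K) (d : ℕ) (x : K × K × K) : Prop :=
  ∃ T : Finset K, d < T.card ∧ ∀ s ∈ T, ∃ y, onRay y f = 0 ∧ MeetAt s x y

theorem card_exceptional_rays_le (p : ℕ) [CharP K p] {f : MvPolynomial (Fin 3) K} (hf : Irreducible f) {d : ℕ}
    (hd : f.totalDegree = d) (hp : 2 * d + 1 < p) (X : Finset (K × K × K))
    (hX : ∀ x ∈ X, onRay x f = 0 ∧ RichRay f (4 * d) x ∧
      ¬ (f ∣ umb0 f ∧ f ∣ umb1 f ∧ onRay x (rayDeriv' x.1 f) ≠ 0)) :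
    X.card ≤ 24 * d ^ 2 := by
  have hdpos : 0 < d := by
    rw [← hd]
    by_contra h0
    rw [not_lt, Nat.le_zero, totalDegree_eq_zero_iff_eq_C] at h0
    rw [h0] at hf
    by_cases hc : coeff 0 f = 0
    · rw [hc, C_0] at hf; exact hf.ne_zero rfl
    · exact hf.not_isUnit ((IsUnit.mk0 _ hc).map C)
  have humb : ∀ x ∈ X, onRay x (umb0 f) = 0 ∧ onRay x (umb1 f) = 0 := by
    intro x hx
    obtain ⟨hx0, ⟨T, hT, hTm⟩, -⟩ := hX x hx
    obtain ⟨d0, d1⟩ := totalDegree_umb_le hd.le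
    constructor
    · refine eq_zero_of_many_roots (natDegree_onRay_le x d0) T hT fun s hs => ?_
      obtain ⟨y, hy, hm⟩ := hTm s hs
      exact (eval_onRay_umb_eq_zero hm hx0 hy).1
    · refine eq_zero_of_many_roots (natDegree_onRay_le x d1) T hT fun s hs => ?_
      obtain ⟨y, hy, hm⟩ := hTm s hs
      exact (eval_onRay_umb_eq_zero hm hx0 hy).2
  obtain ⟨d0, d1⟩ := totalDegree_umb_le hd.le
  have hfin : ∀ g : MvPolynomial (Fin 3) K, g.totalDegree ≤ 4 * d → ¬ f ∣ g →
      (∀ x ∈ X, onRay x g = 0) → X.card ≤ 24 * d ^ 2 := by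
    intro g hg hfg h
    have := card_common_rays_le hf hfg X (fun x hx => ⟨(hX x hx).1, h x hx⟩) hd.le hg
    calc X.card ≤ 6 * d * (4 * d) := this
      _ = 24 * d ^ 2 := by ring
  by_cases h0 : f ∣ umb0 f
  swap
  · exact hfin _ d0 h0 fun x hx => (humb x hx).1
  by_cases h1 : f ∣ umb1 f
  swap
  · exact hfin _ d1 h1 fun x hx => (humb x hx).2
  obtain ⟨i, hi⟩ := exists_pderiv_ne_zero p (hd ▸ hdpos) (by omega)
  have hle := totalDegree_pderiv_le i f
  refine hfin (pderiv i f) (by omega) (fun hdvd => ?_) fun x hx => ?_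
  · have := totalDegree_le_of_dvd_of_isDomain hdvd hi
    omega
  obtain ⟨hx0, ⟨T, hT, hTm⟩, hn⟩ := hX x hx
  have he : onRay x (rayDeriv' x.1 f) = 0 := by
    by_contra hne
    exact hn ⟨h0, h1, hne⟩
  refine eq_zero_of_many_roots (natDegree_onRay_le x (hle.trans (show _ ≤ d by omega))) T
    (by omega) fun s hs => ?_
  obtain ⟨y, hy, hm⟩ := hTm s hs
  obtain ⟨e1, e2, e3⟩ := onRay_rayDeriv'_meet hm hx0 hy
  rw [he, Polynomial.eval_zero] at e1
  have ez := (mul_eq_zero.1 e1.symm).resolve_right (sub_ne_zero.2 hm.1)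
  rw [ez] at e2 e3
  fin_cases i
  · simpa using e2
  · simpa using e3
  · simpa using ez

theorem exists_linear_relation (p : ℕ) [CharP K p] {f : MvPolynomial (Fin 3) K} {d : ℕ}
    (hd : f.totalDegree ≤ d) (hp : 2 * d + 1 < p) {x : K × K × K} (hx : onRay x f = 0)
    (h0 : f ∣ umb0 f) (h1 : f ∣ umb1 f) (he : onRay x (rayDeriv' x.1 f) ≠ 0) :
    ∃ (u v : K) (T : Finset K), T.card ≤ d ∧ ∀ s y, MeetAt s x y → onRay y f = 0 → s ∉ T →
      u * (x.1 - y.1) + v * (y.2.1 - x.2.1) = 1 := by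
  classical
  have hpd : ∀ i, (pderiv i f).totalDegree ≤ d := fun i =>
    (totalDegree_pderiv_le i f).trans ((Nat.sub_le _ _).trans hd)
  have hed : (rayDeriv' x.1 f).totalDegree ≤ d := by
    refine (totalDegree_add _ _).trans (max_le (hpd 1) ?_)
    exact totalDegree_mul_le' (totalDegree_C _).le (hpd 2) (by omega)
  obtain ⟨u, v, huv⟩ : ∃ u v : K, onRay x (pderiv 2 f) =
      (Polynomial.C u + Polynomial.C v * Polynomial.X) * onRay x (rayDeriv' x.1 f) := by
    by_cases hz : onRay x (pderiv 2 f) = 0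
    · exact ⟨0, 0, by simp [hz]⟩
    · exact eq_linear_mul_of_ode p he (natDegree_onRay_le x hed) (natDegree_onRay_le x (hpd 2)) hp
        (umbilic_ode hx h0 h1 hz rfl rfl)
  refine ⟨u, v, (onRay x (rayDeriv' x.1 f)).roots.toFinset, ?_, fun s y hm hy hs => ?_⟩
  · exact (Multiset.toFinset_card_le _).trans ((Polynomial.card_roots' _).trans
      (natDegree_onRay_le x hed))
  · have hes : (onRay x (rayDeriv' x.1 f)).eval s ≠ 0 := by
      intro h
      exact hs (by simpa [he] using h)
    have e1 := (onRay_rayDeriv'_meet hm hx hy).1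
    have e2 := congrArg (Polynomial.eval s) huv
    simp only [Polynomial.eval_mul, Polynomial.eval_add, Polynomial.eval_C, Polynomial.eval_X]
      at e2
    rw [e2] at e1
    apply mul_left_cancel₀ hes
    linear_combination (-1 : K) * e1 + v * (onRay x (rayDeriv' x.1 f)).eval s * hm.2.1 * (-1)

end Structure
end Stmt1

namespace Stmt1
open MvPolynomial

section Bipartite

theorem exists_sample {α β : Type*} [DecidableEq α] [DecidableEq β] (X : Finset α) (Y : Finset β)
    (adj : α → β → Prop) [∀ a b, Decidable (adj a b)] (δ D : ℕ) (hYX : Y.card ≤ X.card) (hpos : 0 < δ)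
    (hδ : ∀ x ∈ X, δ ≤ (Y.filter (adj x)).card) (hD : 2 * D ≤ δ) (k : ℕ) :
    ∃ S ⊆ Y, S.card ≤ k ∧
      (4 * (X.filter fun x => (S.filter (adj x)).card ≤ D).card ≤ X.card ∨
        k * δ ≤ 8 * ∑ x ∈ X, min (S.filter (adj x)).card (D + 1)) := by
  induction k with
  | zero => exact ⟨∅, by simp, by simp, Or.inr (by simp)⟩
  | succ k ih =>
    obtain ⟨S, hSY, hSk, h | h⟩ := ih
    · exact ⟨S, hSY, by omega, Or.inl h⟩
    by_cases hb : 4 * (X.filter fun x => (S.filter (adj x)).card ≤ D).card ≤ X.card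
    · exact ⟨S, hSY, by omega, Or.inl hb⟩
    push Not at hb
    set B := X.filter fun x => (S.filter (adj x)).card ≤ D with hB
    have hcount : B.card * (δ - D) ≤ ∑ y ∈ Y \ S, (B.filter fun x => adj x y).card := by
      have h1 : ∑ y ∈ Y \ S, (B.filter fun x => adj x y).card =
          ∑ x ∈ B, ((Y \ S).filter (adj x)).card :=
        (Finset.sum_card_bipartiteAbove_eq_sum_card_bipartiteBelow (s := B) (t := Y \ S) adj).symm
      rw [h1, ← smul_eq_mul]
      refine Finset.card_nsmul_le_sum _ _ _ fun x hx => ?_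
      rw [hB, Finset.mem_filter] at hx
      have h2 := hδ x hx.1
      have h3 : (Y.filter (adj x)) ⊆ (S.filter (adj x)) ∪ ((Y \ S).filter (adj x)) := by
        intro y hy
        simp only [Finset.mem_union, Finset.mem_filter, Finset.mem_sdiff] at hy ⊢
        tauto
      have h4 := (Finset.card_le_card h3).trans (Finset.card_union_le _ _)
      omega
    obtain ⟨y, hy, hyc⟩ : ∃ y ∈ Y \ S, δ ≤ 8 * (B.filter fun x => adj x y).card := by
      by_contra! hlt
      have h5 : ∑ y ∈ Y \ S, 8 * (B.filter fun x => adj x y).card ≤ ∑ y ∈ Y \ S, (δ - 1) :=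
        Finset.sum_le_sum fun y hy => by have := hlt y hy; omega
      rw [← Finset.mul_sum, Finset.sum_const, smul_eq_mul] at h5
      have h6 : (Y \ S).card ≤ X.card := (Finset.card_le_card Finset.sdiff_subset).trans hYX
      have h7 : X.card * δ < 4 * B.card * δ := Nat.mul_lt_mul_of_pos_right hb hpos
      have h8 : B.card * δ ≤ 2 * (B.card * (δ - D)) := by
        rw [show 2 * (B.card * (δ - D)) = B.card * (2 * (δ - D)) by ring]
        exact Nat.mul_le_mul_left _ (by omega)
      have h9 : (Y \ S).card * (δ - 1) ≤ X.card * δ := Nat.mul_le_mul h6 (by omega)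
      nlinarith
    rw [Finset.mem_sdiff] at hy
    refine ⟨insert y S, Finset.insert_subset hy.1 hSY, (Finset.card_insert_le _ _).trans (by omega),
      Or.inr ?_⟩
    have hstep : ∑ x ∈ X, min (S.filter (adj x)).card (D + 1) + (B.filter fun x => adj x y).card ≤
        ∑ x ∈ X, min ((insert y S).filter (adj x)).card (D + 1) := by
      rw [Finset.card_filter, hB, Finset.sum_filter, ← Finset.sum_add_distrib]
      refine Finset.sum_le_sum fun x _ => ?_
      rw [Finset.filter_insert]
      by_cases ha : adj x y
      · simp only [ha, if_true]
        rw [Finset.card_insert_of_notMem (by simp [hy.2])]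
        split_ifs <;> omega
      · simp [ha]
    calc (k + 1) * δ = k * δ + δ := by ring
      _ ≤ _ := by linarith

end Bipartite
end Stmt1

namespace Stmt1
open MvPolynomial

section Core

variable {K : Type*} [Field K]

theorem MeetAt.symm {s : K} {x y : K × K × K} (h : MeetAt s x y) : MeetAt s y x :=
  ⟨h.1.symm, h.2.1.symm, h.2.2.symm⟩

theorem onRay_eq_zero_of_many_meets {f : MvPolynomial (Fin 3) K} {D : ℕ}
    (hf : f.totalDegree ≤ D) {x : K × K × K} (N : Finset (K × K × K)) (s : K × K × K → K)
    (hinj : Set.InjOn s N) (hN : ∀ y ∈ N, MeetAt (s y) x y ∧ onRay y f = 0) (hD : D < N.card) :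
    onRay x f = 0 := by
  classical
  refine eq_zero_of_many_roots (natDegree_onRay_le x hf) (N.image s)
    (by rwa [Finset.card_image_of_injOn hinj]) fun t ht => ?_
  obtain ⟨y, hy, rfl⟩ := Finset.mem_image.1 ht
  rw [(hN y hy).1.eval_onRay, (hN y hy).2, Polynomial.eval_zero]

theorem sum_totalDegree_factors_le {f : MvPolynomial (Fin 3) K} (hf : f ≠ 0) :
    ((UniqueFactorizationMonoid.factors f).map totalDegree).sum ≤ f.totalDegree := by
  have key : ∀ m : Multiset (MvPolynomial (Fin 3) K), m.prod ≠ 0 →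
      (m.map totalDegree).sum = m.prod.totalDegree := by
    intro m
    induction m using Multiset.induction_on with
    | empty => simp
    | cons a m ih =>
      intro h
      rw [Multiset.prod_cons] at h
      rw [Multiset.map_cons, Multiset.sum_cons, Multiset.prod_cons,
        totalDegree_mul_of_isDomain (left_ne_zero_of_mul h) (right_ne_zero_of_mul h),
        ih (right_ne_zero_of_mul h)]
  have ha := UniqueFactorizationMonoid.factors_prod hf
  rw [key _ (ha.ne_zero_iff.2 hf)]
  exact totalDegree_le_of_dvd_of_isDomain ha.dvd hf

/-- Outside a small exceptional set, a ray in the zero set of `f` lies in a single, non-degenerate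
component of it. -/
theorem exists_component (p : ℕ) [CharP K p] {f : MvPolynomial (Fin 3) K} (hf : f ≠ 0) {D : ℕ}
    (hD : f.totalDegree ≤ D) (hp : 2 * D + 1 < p) (X : Finset (K × K × K))
    (hX : ∀ x ∈ X, onRay x f = 0) (hcard : 30 * D ^ 2 < X.card) :
    ∃ x ∈ X, ∃ φ ψ : MvPolynomial (Fin 3) K, ψ.totalDegree ≤ D ∧ onRay x ψ ≠ 0 ∧
      φ.totalDegree ≤ D ∧ onRay x φ = 0 ∧
      (∀ y, onRay y f = 0 → onRay y φ = 0 ∨ onRay y ψ = 0) ∧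
      (RichRay φ (4 * D) x → φ ∣ umb0 φ ∧ φ ∣ umb1 φ ∧ onRay x (rayDeriv' x.1 φ) ≠ 0) := by
  classical
  by_contra! hcon
  have hfac : ∀ φ ∈ UniqueFactorizationMonoid.factors f, ∃ (ψ : MvPolynomial (Fin 3) K) (k : ℕ),
      f = φ ^ k * ψ ∧ ¬ φ ∣ ψ := by
    intro φ hφ
    have hirr := UniqueFactorizationMonoid.irreducible_of_factor φ hφ
    obtain ⟨ψ, h1, h2⟩ :=
      (FiniteMultiplicity.of_prime_left hirr.prime hf).exists_eq_pow_mul_and_not_dvd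
    exact ⟨ψ, _, h1, h2⟩
  choose! ψ k hψ1 hψ2 using hfac
  set F := (UniqueFactorizationMonoid.factors f).toFinset with hF
  have hdeg : ∀ φ ∈ F, φ.totalDegree ≤ D ∧ (ψ φ).totalDegree ≤ D := by
    intro φ hφ
    rw [hF, Multiset.mem_toFinset] at hφ
    exact ⟨(totalDegree_le_of_dvd_of_isDomain
      (UniqueFactorizationMonoid.dvd_of_mem_factors hφ) hf).trans hD,
      (totalDegree_le_of_dvd_of_isDomain (Dvd.intro_left _ (hψ1 φ hφ).symm) hf).trans hD⟩
  have hsum : ∑ φ ∈ F, φ.totalDegree ≤ D := by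
    refine le_trans ?_ ((sum_totalDegree_factors_le hf).trans hD)
    rw [hF, Finset.sum, Multiset.toFinset_val]
    obtain ⟨u, hu⟩ := Multiset.le_iff_exists_add.1
      (Multiset.dedup_le (UniqueFactorizationMonoid.factors f))
    conv_rhs => rw [hu, Multiset.map_add, Multiset.sum_add]
    exact Nat.le_add_right _ _
  let E1 : MvPolynomial (Fin 3) K → Finset (K × K × K) := fun φ =>
    X.filter fun x => onRay x φ = 0 ∧ onRay x (ψ φ) = 0
  let E2 : MvPolynomial (Fin 3) K → Finset (K × K × K) := fun φ =>
    X.filter fun x => onRay x φ = 0 ∧ RichRay φ (4 * φ.totalDegree) x ∧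
      ¬ (φ ∣ umb0 φ ∧ φ ∣ umb1 φ ∧ onRay x (rayDeriv' x.1 φ) ≠ 0)
  have hE : ∀ φ ∈ F, (E1 φ ∪ E2 φ).card ≤ 30 * D * φ.totalDegree := by
    intro φ hφ
    have hφ' := hφ
    rw [hF, Multiset.mem_toFinset] at hφ'
    have hirr := UniqueFactorizationMonoid.irreducible_of_factor φ hφ'
    obtain ⟨d1, d2⟩ := hdeg φ hφ
    have c1 : (E1 φ).card ≤ 6 * φ.totalDegree * D :=
      card_common_rays_le hirr (hψ2 φ hφ') (E1 φ) (fun x hx => (Finset.mem_filter.1 hx).2)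
        le_rfl d2
    have c2 : (E2 φ).card ≤ 24 * φ.totalDegree ^ 2 :=
      card_exceptional_rays_le p hirr rfl (by omega) (E2 φ)
        (fun x hx => (Finset.mem_filter.1 hx).2)
    refine (Finset.card_union_le _ _).trans ?_
    nlinarith
  have hcover : X ⊆ F.biUnion fun φ => E1 φ ∪ E2 φ := by
    intro x hx
    have h1 : onRay x (UniqueFactorizationMonoid.factors f).prod = 0 := by
      obtain ⟨c, hc⟩ := (UniqueFactorizationMonoid.factors_prod hf).symm.dvd
      rw [hc, map_mul, hX x hx, zero_mul]
    rw [map_multiset_prod, Multiset.prod_eq_zero_iff, Multiset.mem_map] at h1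
    obtain ⟨φ, hφ, hφx⟩ := h1
    have hφF : φ ∈ F := by rwa [hF, Multiset.mem_toFinset]
    refine Finset.mem_biUnion.2 ⟨φ, hφF, ?_⟩
    by_contra hno
    rw [Finset.mem_union, not_or] at hno
    simp only [E1, E2, Finset.mem_filter, hx, hφx, true_and] at hno
    obtain ⟨r, n1⟩ := hcon x hx φ (ψ φ) (hdeg φ hφF).2 hno.1 (hdeg φ hφF).1 hφx (by
      intro y hy
      rw [hψ1 φ hφ, map_mul, map_pow] at hy
      rcases mul_eq_zero.1 hy with h | h
      · exact Or.inl (eq_zero_of_pow_eq_zero h)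
      · exact Or.inr h)
    obtain ⟨T, hT, hTm⟩ := r
    refine hno.2 ⟨⟨T, ?_, hTm⟩, fun h => h.2.2 (n1 h.1 h.2.1)⟩
    have := (hdeg φ hφF).1
    omega
  have h1 := (Finset.card_le_card hcover).trans Finset.card_biUnion_le
  have h2 := h1.trans (Finset.sum_le_sum hE)
  rw [← Finset.mul_sum] at h2
  nlinarith

theorem no_dense_meets (p : ℕ) [CharP K p] [DecidableEq K] (X Y : Finset (K × K × K))
    (adj : K × K × K → K × K × K → Prop) [∀ a b, Decidable (adj a b)]
    (s : K × K × K → K × K × K → K)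
    (hadj : ∀ x ∈ X, ∀ y ∈ Y, adj x y → MeetAt (s x y) x y)
    (hsX : ∀ x ∈ X, ∀ y ∈ Y, ∀ y' ∈ Y, adj x y → adj x y' → s x y = s x y' → y = y')
    (hsY : ∀ y ∈ Y, ∀ x ∈ X, ∀ x' ∈ X, adj x y → adj x' y → s x y = s x' y → x = x')
    (K₀ δ : ℕ) (hYX : Y.card ≤ X.card) (hne : X.Nonempty)
    (hdeg : ∀ x ∈ X, δ ≤ (Y.filter (adj x)).card)
    (hH : ∀ x ∈ X, ∀ u v : K,
      (Y.filter fun y => adj x y ∧ u * (x.1 - y.1) + v * (y.2.1 - x.2.1) = 1).card ≤ K₀)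
    (hδ : 10 ^ 5 ≤ δ) (hK : 2 * K₀ ≤ δ) (hδX : 10 ^ 8 * X.card ≤ δ ^ 2)
    (hXp : X.card ≤ p ^ 2) : False := by
  classical
  set n := X.card with hn
  have hδn : δ ≤ n := by
    obtain ⟨x, hx⟩ := hne
    exact (hdeg x hx).trans ((Finset.card_filter_le _ _).trans hYX)
  set Q := 72 * n / δ with hQ
  have hQ1 : Q * δ ≤ 72 * n := Nat.div_mul_le_self _ _
  have hQ2 : 72 * n < (Q + 1) * δ := by
    rw [hQ, mul_comm _ δ]; exact Nat.lt_mul_div_succ _ (by omega)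
  obtain ⟨D, hDdef⟩ : ∃ D, D = 3 * (Q + 4) := ⟨_, rfl⟩
  have hQδ : 10 ^ 8 * Q ≤ 72 * δ := by
    have : (10 ^ 8 * Q) * δ ≤ (72 * δ) * δ := by nlinarith
    exact Nat.le_of_mul_le_mul_right this (by omega)
  have hDδ : 100 * D ≤ δ := by omega
  have hDn : 60 * D ^ 2 < n := by
    have h1 : (10 ^ 8 * Q ^ 2) * n ≤ (5184 * n) * n := by
      calc (10 ^ 8 * Q ^ 2) * n = Q ^ 2 * (10 ^ 8 * n) := by ring
        _ ≤ Q ^ 2 * δ ^ 2 := Nat.mul_le_mul_left _ hδX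
        _ = (Q * δ) ^ 2 := by ring
        _ ≤ (72 * n) ^ 2 := Nat.pow_le_pow_left hQ1 2
        _ = _ := by ring
    have h2 := Nat.le_of_mul_le_mul_right h1 (by omega)
    rw [hDdef]
    nlinarith [sq_nonneg ((Q : ℤ) - 4)]
  have hDp : 2 * D + 1 < p := by
    have h1 : (2 * D + 1) ^ 2 < p ^ 2 := by nlinarith
    exact lt_of_pow_lt_pow_left₀ 2 (by omega) h1
  obtain ⟨S, hSY, hSk, hS⟩ := exists_sample X Y adj δ D hYX (by omega) hdeg (by omega)
    (8 * n * (D + 1) / δ + 1)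
  have hbad : 4 * (X.filter fun x => (S.filter (adj x)).card ≤ D).card ≤ n := by
    rcases hS with h | h
    · exact h
    exfalso
    have h1 : ∑ x ∈ X, min (S.filter (adj x)).card (D + 1) ≤ n * (D + 1) := by
      rw [hn, ← smul_eq_mul]
      exact Finset.sum_le_card_nsmul _ _ _ fun x _ => min_le_right _ _
    have h2 : 8 * n * (D + 1) < (8 * n * (D + 1) / δ + 1) * δ := by
      rw [mul_comm _ δ]; exact Nat.lt_mul_div_succ _ (by omega)
    nlinarith
  have hSE : 3 * S.card ≤ (Q + 4 + 1) ^ 2 := by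
    have h1 : 8 * n * (D + 1) / δ * δ ≤ 8 * n * (D + 1) := Nat.div_mul_le_self _ _
    set k := 8 * n * (D + 1) / δ
    have h2 : (3 * k) * δ ≤ ((Q + 1) * (Q + 5)) * δ := by
      calc (3 * k) * δ = 3 * (k * δ) := by ring
        _ ≤ 3 * (8 * n * (D + 1)) := Nat.mul_le_mul_left _ h1
        _ ≤ (72 * n) * (Q + 5) := by rw [hDdef]; nlinarith
        _ ≤ ((Q + 1) * δ) * (Q + 5) := Nat.mul_le_mul_right _ hQ2.le
        _ = _ := by ring
    have h3 := Nat.le_of_mul_le_mul_right h2 (by omega)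
    nlinarith
  obtain ⟨f, hf0, hfD, hfS⟩ := exists_vanishing_on_rays S (Q + 4) hSE
  rw [← hDdef] at hfD
  set X1 := X.filter fun x => onRay x f = 0 with hX1
  set Y1 := Y.filter fun y => onRay y f = 0 with hY1
  have hX1card : 3 * n ≤ 4 * X1.card := by
    have h1 : X \ X1 ⊆ X.filter fun x => (S.filter (adj x)).card ≤ D := by
      intro x hx
      rw [hX1, Finset.mem_sdiff, Finset.mem_filter] at hx
      rw [Finset.mem_filter]
      refine ⟨hx.1, ?_⟩
      by_contra! hlt
      refine hx.2 ⟨hx.1, onRay_eq_zero_of_many_meets hfD (S.filter (adj x)) (s x) ?_ ?_ hlt⟩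
      · intro y hy y' hy' h
        rw [Finset.mem_coe, Finset.mem_filter] at hy hy'
        exact hsX x hx.1 y (hSY hy.1) y' (hSY hy'.1) hy.2 hy'.2 h
      · intro y hy
        rw [Finset.mem_filter] at hy
        exact ⟨hadj x hx.1 y (hSY hy.1) hy.2, hfS y hy.1⟩
    have h2 := Finset.card_le_card h1
    have h3 := Finset.card_sdiff_add_card_eq_card (s := X1) (t := X) (Finset.filter_subset _ _)
    omega
  have hYdeg : ∀ y ∈ Y \ Y1, (X1.filter fun x => adj x y).card ≤ D := by
    intro y hy
    rw [hY1, Finset.mem_sdiff, Finset.mem_filter] at hy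
    by_contra! hlt
    refine hy.2 ⟨hy.1, onRay_eq_zero_of_many_meets hfD _ (fun x => s x y) ?_ ?_ hlt⟩
    · intro x hx x' hx' h
      simp only [hX1, Finset.coe_filter, Set.mem_ofPred_eq, Finset.mem_filter] at hx hx'
      exact hsY y hy.1 x hx.1.1 x' hx'.1.1 hx.2 hx'.2 h
    · intro x hx
      simp only [hX1, Finset.mem_filter] at hx
      exact ⟨(hadj x hx.1.1 y hy.1 hx.2).symm, hx.1.2⟩
  set X2 := X1.filter fun x => ((Y \ Y1).filter (adj x)).card ≤ 4 * D with hX2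
  have hX2card : n ≤ 2 * X2.card := by
    have h1 : ∑ x ∈ X1, ((Y \ Y1).filter (adj x)).card ≤ n * D := by
      calc ∑ x ∈ X1, ((Y \ Y1).filter (adj x)).card
          = ∑ y ∈ Y \ Y1, (X1.filter fun x => adj x y).card :=
            Finset.sum_card_bipartiteAbove_eq_sum_card_bipartiteBelow (s := X1) (t := Y \ Y1) adj
        _ ≤ (Y \ Y1).card * D := by
            rw [← smul_eq_mul]; exact Finset.sum_le_card_nsmul _ _ _ hYdeg
        _ ≤ n * D := Nat.mul_le_mul_right _ ((Finset.card_le_card Finset.sdiff_subset).trans hYX)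
    have h2 : (X1 \ X2).card * (4 * D) ≤ ∑ x ∈ X1 \ X2, ((Y \ Y1).filter (adj x)).card := by
      rw [← smul_eq_mul]
      refine Finset.card_nsmul_le_sum _ _ _ fun x hx => ?_
      obtain ⟨g1, g2⟩ := Finset.mem_sdiff.1 hx
      by_contra! hlt
      refine g2 ?_
      rw [hX2, Finset.mem_filter]
      exact ⟨g1, hlt.le⟩
    have h3 : ∑ x ∈ X1 \ X2, ((Y \ Y1).filter (adj x)).card ≤
        ∑ x ∈ X1, ((Y \ Y1).filter (adj x)).card :=
      Finset.sum_le_sum_of_subset Finset.sdiff_subset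
    have h4 : (4 * (X1 \ X2).card) * D ≤ n * D := by linarith
    have h5 := Nat.le_of_mul_le_mul_right h4 (by omega)
    have h6 := Finset.card_sdiff_add_card_eq_card (s := X2) (t := X1) (Finset.filter_subset _ _)
    omega
  obtain ⟨x, hx, φ, ψ, hψD, hxψ, hφD, hxφ, hcov, hrich⟩ := exists_component p hf0 hfD hDp X2
    (by
      intro x hx
      rw [hX2, Finset.mem_filter, hX1, Finset.mem_filter] at hx
      exact hx.1.2) (by omega)
  rw [hX2, Finset.mem_filter, hX1, Finset.mem_filter] at hx
  obtain ⟨⟨hxX, -⟩, hxY1⟩ := hx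
  set N := Y.filter fun y => adj x y ∧ onRay y φ = 0 with hN
  set N' := Y.filter fun y => adj x y ∧ onRay y ψ = 0 with hN'
  have hinj : ∀ Z : Finset (K × K × K), (∀ y ∈ Z, y ∈ Y ∧ adj x y) → Set.InjOn (s x) Z := by
    intro Z hZ y hy y' hy' h
    exact hsX x hxX y (hZ y hy).1 y' (hZ y' hy').1 (hZ y hy).2 (hZ y' hy').2 h
  have hN'card : N'.card ≤ D := by
    by_contra! hlt
    refine hxψ (onRay_eq_zero_of_many_meets hψD N' (s x) (hinj _ ?_) ?_ hlt)
    · intro y hy; rw [hN', Finset.mem_filter] at hy; exact ⟨hy.1, hy.2.1⟩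
    · intro y hy; rw [hN', Finset.mem_filter] at hy
      exact ⟨hadj x hxX y hy.1 hy.2.1, hy.2.2⟩
  have hNmem : ∀ y ∈ N, y ∈ Y ∧ adj x y := by
    intro y hy; rw [hN, Finset.mem_filter] at hy; exact ⟨hy.1, hy.2.1⟩
  have hNcard : δ ≤ N.card + 5 * D := by
    have h1 : Y.filter (adj x) ⊆ (N ∪ N') ∪ (Y \ Y1).filter (adj x) := by
      intro y hy
      rw [Finset.mem_filter] at hy
      simp only [hN, hN', hY1, Finset.mem_union, Finset.mem_filter, Finset.mem_sdiff]
      by_cases hyf : onRay y f = 0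
      · rcases hcov y hyf with h | h
        · exact Or.inl (Or.inl ⟨hy.1, hy.2, h⟩)
        · exact Or.inl (Or.inr ⟨hy.1, hy.2, h⟩)
      · exact Or.inr ⟨⟨hy.1, fun h => hyf h.2⟩, hy.2⟩
    have h2 := Finset.card_le_card h1
    have h3 := Finset.card_union_le (N ∪ N') ((Y \ Y1).filter (adj x))
    have h4 := Finset.card_union_le N N'
    have h5 := hdeg x hxX
    omega
  obtain ⟨h0, h1, he⟩ := hrich ⟨N.image (s x), by
    rw [Finset.card_image_of_injOn (hinj N hNmem)]; omega, by
    intro t ht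
    obtain ⟨y, hy, rfl⟩ := Finset.mem_image.1 ht
    exact ⟨y, (Finset.mem_filter.1 hy).2.2, hadj x hxX y (hNmem y hy).1 (hNmem y hy).2⟩⟩
  obtain ⟨u, v, T, hT, hTs⟩ := exists_linear_relation p hφD (by omega) hxφ h0 h1 he
  have h2 : N ⊆ (N.filter fun y => s x y ∈ T) ∪
      (Y.filter fun y => adj x y ∧ u * (x.1 - y.1) + v * (y.2.1 - x.2.1) = 1) := by
    intro y hy
    rw [Finset.mem_union]
    have hyφ : onRay y φ = 0 := by rw [hN, Finset.mem_filter] at hy; exact hy.2.2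
    by_cases ht : s x y ∈ T
    · exact Or.inl (Finset.mem_filter.2 ⟨hy, ht⟩)
    · refine Or.inr (Finset.mem_filter.2 ⟨(hNmem y hy).1, (hNmem y hy).2, ?_⟩)
      exact hTs _ y (hadj x hxX y (hNmem y hy).1 (hNmem y hy).2) hyφ ht
  have h3 : (N.filter fun y => s x y ∈ T).card ≤ T.card := by
    refine Finset.card_le_card_of_injOn (s x) (fun y hy => (Finset.mem_filter.1 hy).2) ?_
    exact (hinj N hNmem).mono (fun y hy => (Finset.mem_filter.1 hy).1)
  have h4 := (Finset.card_le_card h2).trans (Finset.card_union_le _ _)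
  have h5 := hH x hxX u v
  omega

end Core
end Stmt1

namespace Stmt1
open MvPolynomial

section Incidence

theorem exists_min_degree_pair {α : Type*} [DecidableEq α] (S : Finset α) (G : α → α → Prop)
    [DecidableRel G] (δ : ℕ)
    (h : 2 * δ * S.card < ((S ×ˢ S).filter fun q => G q.1 q.2).card) :
    ∃ X Y, X ⊆ S ∧ Y ⊆ S ∧ X.Nonempty ∧ Y.Nonempty ∧
      (∀ x ∈ X, δ ≤ (Y.filter fun y => G x y).card) ∧
      ∀ y ∈ Y, δ ≤ (X.filter fun x => G x y).card := by
  let e : Finset α → Finset α → ℤ := fun X Y => ∑ x ∈ X, ((Y.filter fun y => G x y).card : ℤ)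
  have he : ∀ X Y, e X Y = ∑ y ∈ Y, ((X.filter fun x => G x y).card : ℤ) := by
    intro X Y
    have := Finset.sum_card_bipartiteAbove_eq_sum_card_bipartiteBelow (s := X) (t := Y) G
    simp only [e]
    exact_mod_cast this
  let f : Finset α × Finset α → ℤ := fun q => e q.1 q.2 - δ * (q.1.card + q.2.card)
  obtain ⟨⟨X, Y⟩, hXY, hmax⟩ := Finset.exists_max_image (S.powerset ×ˢ S.powerset) f
    ⟨(∅, ∅), by simp⟩
  rw [Finset.mem_product, Finset.mem_powerset, Finset.mem_powerset] at hXY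
  have hS : 0 < f (S, S) := by
    have h1 : (((S ×ˢ S).filter fun q => G q.1 q.2).card : ℤ) = e S S := by
      simp only [e]
      rw [Finset.card_filter, Finset.sum_product]
      push_cast
      refine Finset.sum_congr rfl fun x _ => ?_
      rw [Finset.card_filter]
      push_cast
      rfl
    simp only [f]
    rw [← h1]
    have : (2 * δ * S.card : ℤ) < ((S ×ˢ S).filter fun q => G q.1 q.2).card := by exact_mod_cast h
    linarith
  have hpos : 0 < f (X, Y) := lt_of_lt_of_le hS (hmax (S, S) (by simp))
  refine ⟨X, Y, hXY.1, hXY.2, ?_, ?_, ?_, ?_⟩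
  · rw [Finset.nonempty_iff_ne_empty]
    rintro rfl
    simp only [f, e, Finset.sum_empty, Finset.card_empty] at hpos
    have : (0 : ℤ) ≤ δ * Y.card := by positivity
    push_cast at hpos
    linarith
  · rw [Finset.nonempty_iff_ne_empty]
    rintro rfl
    simp only [f, he, Finset.sum_empty, Finset.card_empty] at hpos
    have : (0 : ℤ) ≤ δ * X.card := by positivity
    push_cast at hpos
    linarith
  · intro x hx
    have h1 := hmax (X.erase x, Y) (by
      rw [Finset.mem_product, Finset.mem_powerset, Finset.mem_powerset]
      exact ⟨(Finset.erase_subset _ _).trans hXY.1, hXY.2⟩)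
    simp only [f, e] at h1
    rw [← Finset.add_sum_erase X _ hx] at h1
    have h2 := Finset.card_erase_add_one hx
    have h3 : (X.card : ℤ) = (X.erase x).card + 1 := by exact_mod_cast h2.symm
    rw [h3] at h1
    have : (δ : ℤ) ≤ ((Y.filter fun y => G x y).card : ℤ) := by linarith
    exact_mod_cast this
  · intro y hy
    have h1 := hmax (X, Y.erase y) (by
      rw [Finset.mem_product, Finset.mem_powerset, Finset.mem_powerset]
      exact ⟨hXY.1, (Finset.erase_subset _ _).trans hXY.2⟩)
    simp only [f, he] at h1
    rw [← Finset.add_sum_erase Y _ hy] at h1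
    have h2 := Finset.card_erase_add_one hy
    have h3 : (Y.card : ℤ) = (Y.erase y).card + 1 := by exact_mod_cast h2.symm
    rw [h3] at h1
    have : (δ : ℤ) ≤ ((X.filter fun x => G x y).card : ℤ) := by linarith
    exact_mod_cast this

variable {K : Type*} [Field K]

/-- The ray attached to `(t, u, W)`, translated by `(μ, ν)`. -/
def twistX (μ ν : K) : K × K × K ≃ K × K × K where
  toFun x := (x.1 + μ, x.2.1 + ν, (x.1 + μ) * (x.2.1 + ν) - x.2.2)
  invFun x := (x.1 - μ, x.2.1 - ν, x.1 * x.2.1 - x.2.2)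
  left_inv x := by ext <;> simp
  right_inv x := by ext <;> simp

/-- The ray attached to `(t, u, W)`, sheared by `(μ, ν)`. -/
def twistY (μ ν : K) : K × K × K ≃ K × K × K where
  toFun x := (x.1, x.2.1, x.1 * x.2.1 - (x.2.2 - μ * x.2.1 + ν * x.1))
  invFun x := (x.1, x.2.1, x.1 * x.2.1 - x.2.2 + μ * x.2.1 - ν * x.1)
  left_inv x := by
    ext
    · simp
    · simp
    · simp only; ring
  right_inv x := by
    ext
    · simp
    · simp
    · simp only; ring

/-- The alternating form deciding whether the rays of `x` and `y` meet. -/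
def pairing (x y : K × K × K) : K := y.2.2 - x.2.2 + x.1 * y.2.1 - y.1 * x.2.1

theorem exists_generic_param [Infinite K] (S : Finset (K × K × K)) :
    ∃ μ : K, ∀ x ∈ S, ∀ y ∈ S, x.1 + μ ≠ y.1 ∧
      (x ≠ y → pairing x y + (y.2.1 - x.2.1) * μ - (y.1 - x.1) * μ ^ 2 ≠ 0 ∧
        pairing x y - (y.2.1 - x.2.1) * μ + (y.1 - x.1) * μ ^ 2 ≠ 0) := by
  classical
  have key : ∀ x y : K × K × K, x ≠ y → ∀ c : K, c ≠ 0 → (Polynomial.C (pairing x y) +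
      Polynomial.C (c * (y.2.1 - x.2.1)) * Polynomial.X -
      Polynomial.C (c * (y.1 - x.1)) * Polynomial.X ^ 2 : Polynomial K) ≠ 0 := by
    intro x y hxy c hc h
    have h0 := congrArg (fun f => Polynomial.coeff f 0) h
    have h1 := congrArg (fun f => Polynomial.coeff f 1) h
    have h2 := congrArg (fun f => Polynomial.coeff f 2) h
    simp [Polynomial.coeff_X, Polynomial.coeff_C, -map_mul, -map_sub, Polynomial.coeff_X_pow,
      hc] at h0 h1 h2
    rw [sub_eq_zero] at h1 h2
    apply hxy
    rw [pairing, h1, h2] at h0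
    have h3 : y.2.2 - x.2.2 = 0 := by linear_combination h0
    rw [sub_eq_zero] at h3
    ext
    · exact h2.symm
    · exact h1.symm
    · exact h3.symm
  let P : K × K × K → K × K × K → Polynomial K := fun x y => Polynomial.X - Polynomial.C (y.1 - x.1)
  let P1 : K → K × K × K → K × K × K → Polynomial K := fun c x y => if x = y then 1 else
      (Polynomial.C (pairing x y) + Polynomial.C (c * (y.2.1 - x.2.1)) * Polynomial.X -
        Polynomial.C (c * (y.1 - x.1)) * Polynomial.X ^ 2)
  have hP1 : ∀ c ≠ 0, ∀ x y, P1 c x y ≠ 0 := by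
    intro c hc x y
    by_cases h : x = y
    · simp [P1, h]
    · simp only [P1, h, if_false]; exact key x y h c hc
  let Q : Polynomial K := ∏ q ∈ S ×ˢ S, P q.1 q.2 * P1 1 q.1 q.2 * P1 (-1) q.1 q.2
  have hQ : Q ≠ 0 := by
    refine Finset.prod_ne_zero_iff.2 fun q _ => ?_
    exact mul_ne_zero (mul_ne_zero (Polynomial.X_sub_C_ne_zero _) (hP1 _ one_ne_zero _ _))
      (hP1 _ (neg_ne_zero.2 one_ne_zero) _ _)
  obtain ⟨μ, hμ⟩ := Infinite.exists_notMem_finset Q.roots.toFinset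
  rw [Multiset.mem_toFinset, Polynomial.mem_roots hQ, Polynomial.IsRoot,
    Polynomial.eval_prod, Finset.prod_eq_zero_iff] at hμ
  push Not at hμ
  refine ⟨μ, fun x hx y hy => ?_⟩
  have h := hμ (x, y) (Finset.mk_mem_product hx hy)
  rw [Polynomial.eval_mul, Polynomial.eval_mul] at h
  have h1 := left_ne_zero_of_mul (left_ne_zero_of_mul h)
  have h2 := right_ne_zero_of_mul (left_ne_zero_of_mul h)
  have h3 := right_ne_zero_of_mul h
  constructor
  · intro h4
    apply h1
    simp only [P, Polynomial.eval_sub, Polynomial.eval_X, Polynomial.eval_C]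
    linear_combination h4
  · intro hxy
    simp only [P1, hxy, if_false, Polynomial.eval_sub, Polynomial.eval_add, Polynomial.eval_mul,
      Polynomial.eval_C, Polynomial.eval_X, Polynomial.eval_pow] at h2 h3
    constructor
    · convert h2 using 1; ring
    · convert h3 using 1; ring

theorem no_dense_pair (p : ℕ) [CharP K p] [DecidableEq K] [Infinite K] (S : Finset (K × K × K))
    (G : K × K × K → K × K × K → Prop) [DecidableRel G]
    (hω : ∀ x ∈ S, ∀ y ∈ S, G x y → pairing x y = 0) (K₀ δ : ℕ)
    (hH : ∀ x ∈ S, ∀ c₀ c₁ c₂ : K, ¬ (c₁ = 0 ∧ c₂ = 0) →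
      (S.filter fun y => G x y ∧ c₀ + c₁ * y.1 + c₂ * y.2.1 = 0).card ≤ K₀)
    (X Y : Finset (K × K × K)) (hX : X ⊆ S) (hY : Y ⊆ S) (hYX : Y.card ≤ X.card)
    (hne : X.Nonempty) (hdeg : ∀ x ∈ X, δ ≤ (Y.filter fun y => G x y).card)
    (hδ : 10 ^ 5 ≤ δ) (hK : 2 * K₀ ≤ δ) (hδX : 10 ^ 8 * S.card ≤ δ ^ 2)
    (hXp : S.card ≤ p ^ 2) : False := by
  classical
  obtain ⟨μ, hμ⟩ := exists_generic_param S
  have hXS := Finset.card_le_card hX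
  let eX := twistX μ (μ ^ 2)
  let eY := twistY μ (μ ^ 2)
  let adj : K × K × K → K × K × K → Prop := fun x y => G (eX.symm x) (eY.symm y)
  have hadj : ∀ x y, adj (eX x) (eY y) ↔ G x y := fun x y => by simp [adj]
  have hmX : ∀ x ∈ X.map eX.toEmbedding, ∃ z ∈ X, eX z = x := fun x hx => by
    obtain ⟨z, hz, h⟩ := Finset.mem_map.1 hx
    exact ⟨z, hz, h⟩
  have hmY : ∀ x ∈ Y.map eY.toEmbedding, ∃ z ∈ Y, eY z = x := fun x hx => by
    obtain ⟨z, hz, h⟩ := Finset.mem_map.1 hx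
    exact ⟨z, hz, h⟩
  have hmeet : ∀ x ∈ X.map eX.toEmbedding, ∀ y ∈ Y.map eY.toEmbedding, adj x y →
      MeetAt ((y.2.1 - x.2.1) / (x.1 - y.1)) x y := by
    intro x' hx' y' hy' h
    obtain ⟨x, hx, rfl⟩ := hmX x' hx'
    obtain ⟨y, hy, rfl⟩ := hmY y' hy'
    have hp := hω x (hX hx) y (hY hy) ((hadj _ _).1 h)
    have ht : x.1 + μ - y.1 ≠ 0 := sub_ne_zero.2 (hμ x (hX hx) y (hY hy)).1
    rw [pairing] at hp
    simp only [MeetAt, eX, eY, twistX, twistY, Equiv.coe_fn_mk]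
    refine ⟨(hμ x (hX hx) y (hY hy)).1, ?_, ?_⟩
    · field_simp
      ring
    · field_simp
      linear_combination (x.1 + μ - y.1) * hp
  refine no_dense_meets p (X.map eX.toEmbedding) (Y.map eY.toEmbedding) adj
    (fun x y => (y.2.1 - x.2.1) / (x.1 - y.1)) ?_ ?_ ?_ K₀ δ (by simpa using hYX) (by simpa using hne)
    ?_ ?_ hδ hK (by rw [Finset.card_map]; omega) (by rw [Finset.card_map]; omega)
  · exact hmeet
  · intro x hx y' hy' z' hz' h1 h2 h3
    have m1 := hmeet x hx y' hy' h1
    have m2 := hmeet x hx z' hz' h2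
    rw [← h3] at m2
    obtain ⟨y, hy, rfl⟩ := hmY y' hy'
    obtain ⟨z, hz, rfl⟩ := hmY z' hz'
    by_contra hne
    have hyz : y ≠ z := fun h => hne (h ▸ rfl)
    apply ((hμ y (hY hy) z (hY hz)).2 hyz).2
    have e1 := m1.2.1.symm.trans m2.2.1
    have e2 := m1.2.2.symm.trans m2.2.2
    generalize ((eY y).2.1 - x.2.1) / (x.1 - (eY y).1) = s at e1 e2
    simp only [eY, twistY, Equiv.coe_fn_mk] at e1 e2
    rw [pairing]
    linear_combination e2 - (y.1 + z.1) * e1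
  · intro y hy x' hx' z' hz' h1 h2 h3
    have m1 := hmeet x' hx' y hy h1
    have m2 := hmeet z' hz' y hy h2
    rw [← h3] at m2
    obtain ⟨x, hx, rfl⟩ := hmX x' hx'
    obtain ⟨z, hz, rfl⟩ := hmX z' hz'
    by_contra hne
    have hyz : x ≠ z := fun h => hne (h ▸ rfl)
    apply ((hμ x (hX hx) z (hX hz)).2 hyz).1
    have e1 := m1.2.1.trans m2.2.1.symm
    have e2 := m1.2.2.trans m2.2.2.symm
    generalize (y.2.1 - (eX x).2.1) / ((eX x).1 - y.1) = s at e1 e2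
    simp only [eX, twistX, Equiv.coe_fn_mk] at e1 e2
    rw [pairing]
    linear_combination e2 - (x.1 + z.1 + 2 * μ) * e1
  · intro x' hx'
    obtain ⟨x, hx, rfl⟩ := hmX x' hx'
    rw [Finset.filter_map, Finset.card_map]
    refine (hdeg x hx).trans (Finset.card_le_card fun y hy => ?_)
    rw [Finset.mem_filter] at hy ⊢
    exact ⟨hy.1, (hadj _ _).2 hy.2⟩
  · intro x' hx' u v
    obtain ⟨x, hx, rfl⟩ := hmX x' hx'
    rw [Finset.filter_map, Finset.card_map]
    by_cases huv : u = 0 ∧ v = 0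
    · rw [huv.1, huv.2]; simp
    · refine le_trans (Finset.card_le_card fun y hy => ?_)
        (hH x (hX hx) (u * (x.1 + μ) - v * (x.2.1 + μ ^ 2) - 1) (-u) v
          (by rwa [neg_eq_zero]))
      rw [Finset.mem_filter] at hy ⊢
      refine ⟨hY hy.1, (hadj _ _).1 hy.2.1, ?_⟩
      have h2 : u * (x.1 + μ - y.1) + v * (y.2.1 - (x.2.1 + μ ^ 2)) = 1 := hy.2.2
      linear_combination h2

/-- A symmetric relation on points of `K³` contained in the zero set of the alternating pairing
has few edges, if no point has many neighbours on a plane parallel to the third axis. -/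
theorem card_edges_le (p : ℕ) [CharP K p] [DecidableEq K] [Infinite K] (S : Finset (K × K × K))
    (G : K × K × K → K × K × K → Prop) [DecidableRel G] (hsymm : ∀ x y, G x y → G y x)
    (hω : ∀ x ∈ S, ∀ y ∈ S, G x y → pairing x y = 0) (K₀ δ : ℕ)
    (hH : ∀ x ∈ S, ∀ c₀ c₁ c₂ : K, ¬ (c₁ = 0 ∧ c₂ = 0) →
      (S.filter fun y => G x y ∧ c₀ + c₁ * y.1 + c₂ * y.2.1 = 0).card ≤ K₀)
    (hδ : 10 ^ 5 ≤ δ) (hK : 2 * K₀ ≤ δ) (hδX : 10 ^ 8 * S.card ≤ δ ^ 2)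
    (hXp : S.card ≤ p ^ 2) :
    ((S ×ˢ S).filter fun q => G q.1 q.2).card ≤ 2 * δ * S.card := by
  by_contra! hlt
  obtain ⟨X, Y, hX, hY, hXne, hYne, hdX, hdY⟩ := exists_min_degree_pair S G δ hlt
  rcases le_total Y.card X.card with h | h
  · exact no_dense_pair p S G hω K₀ δ hH X Y hX hY h hXne hdX hδ hK hδX hXp
  · refine no_dense_pair p S G hω K₀ δ hH Y X hY hX h hYne (fun y hy => ?_) hδ hK hδX hXp
    refine (hdY y hy).trans (Finset.card_le_card fun x hx => ?_)
    rw [Finset.mem_filter] at hx ⊢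
    exact ⟨hx.1, hsymm _ _ hx.2⟩

end Incidence
end Stmt1

namespace Stmt1

theorem coeffs_eq_zero_of_three_roots {K : Type*} [Field K] {P Q R t₁ t₂ t₃ : K}
    (h₁₂ : t₁ - t₂ ≠ 0) (h₁₃ : t₁ - t₃ ≠ 0) (h₂₃ : t₂ - t₃ ≠ 0)
    (e₁ : P * t₁ ^ 2 + Q * t₁ + R = 0) (e₂ : P * t₂ ^ 2 + Q * t₂ + R = 0)
    (e₃ : P * t₃ ^ 2 + Q * t₃ + R = 0) : P = 0 ∧ Q = 0 ∧ R = 0 := by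
  have hP : P = 0 := by
    have : (t₁ - t₂) * (t₁ - t₃) * (t₂ - t₃) * P = 0 := by
      linear_combination (t₂ - t₃) * e₁ - (t₁ - t₃) * e₂ + (t₁ - t₂) * e₃
    simpa [h₁₂, h₁₃, h₂₃] using this
  subst hP
  have hQ : Q = 0 := by
    have : (t₁ - t₂) * Q = 0 := by linear_combination e₁ - e₂
    simpa [h₁₂] using this
  subst hQ
  exact ⟨rfl, rfl, by simpa using e₁⟩

theorem sum_card_filter_comm {ι κ : Type*} (s : Finset ι) (t : Finset κ) (r : ι → κ → Prop)
    [∀ a b, Decidable (r a b)] :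
    ∑ a ∈ s, (t.filter fun b => r a b).card = ∑ b ∈ t, (s.filter fun a => r a b).card :=
  Finset.sum_card_bipartiteAbove_eq_sum_card_bipartiteBelow r

theorem sum_sq_card_filter_mem {V : Type*} [DecidableEq V] (A : Finset V)
    (R : Finset (Finset V)) (hinter : ∀ T ∈ R, ∀ T' ∈ R, T ≠ T' → (T ∩ T').card ≤ 2) :
    ∑ a ∈ A, (R.filter fun T => a ∈ T).card ^ 2 ≤ ∑ T ∈ R, T.card + 2 * R.card ^ 2 := by
  calc ∑ a ∈ A, (R.filter fun T => a ∈ T).card ^ 2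
      = ∑ a ∈ A, ((R ×ˢ R).filter fun q => a ∈ q.1 ∩ q.2).card := by
        refine Finset.sum_congr rfl fun a _ => ?_
        rw [sq, ← Finset.card_product]
        congr 1
        ext q
        simp only [Finset.mem_product, Finset.mem_filter, Finset.mem_inter]
        tauto
    _ = ∑ q ∈ R ×ˢ R, (A.filter fun a => a ∈ q.1 ∩ q.2).card :=
        sum_card_filter_comm A (R ×ˢ R) fun a q => a ∈ q.1 ∩ q.2
    _ ≤ ∑ q ∈ R ×ˢ R, ((if q.1 = q.2 then q.1.card else 0) + 2) := by
        refine Finset.sum_le_sum fun q hq => ?_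
        rw [Finset.mem_product] at hq
        have h4 : (A.filter fun a => a ∈ q.1 ∩ q.2).card ≤ (q.1 ∩ q.2).card :=
          Finset.card_le_card fun a ha => (Finset.mem_filter.1 ha).2
        by_cases h : q.1 = q.2
        · rw [if_pos h]
          have := Finset.card_le_card (Finset.inter_subset_left (s₁ := q.1) (s₂ := q.2))
          omega
        · rw [if_neg h]
          have := hinter _ hq.1 _ hq.2 h
          omega
    _ = ∑ T ∈ R, T.card + 2 * R.card ^ 2 := by
        rw [Finset.sum_add_distrib, Finset.sum_product]
        congr 1
        · refine Finset.sum_congr rfl fun T hT => ?_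
          rw [Finset.sum_ite_eq, if_pos hT]
        · rw [Finset.sum_const, Finset.card_product, smul_eq_mul]; ring

theorem sum_card_le_of_pairwise_inter {V : Type*} [DecidableEq V] (A : Finset V)
    (R : Finset (Finset V)) (K₀ : ℕ) (hsub : ∀ T ∈ R, T ⊆ A) (hcard : ∀ T ∈ R, K₀ < T.card)
    (hinter : ∀ T ∈ R, ∀ T' ∈ R, T ≠ T' → (T ∩ T').card ≤ 2) (hK : 4 * A.card ≤ K₀ ^ 2) :
    ∑ T ∈ R, T.card ≤ 2 * A.card := by
  have h1 : ∑ T ∈ R, T.card = ∑ a ∈ A, (R.filter fun T => a ∈ T).card := by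
    rw [← sum_card_filter_comm R A fun T a => a ∈ T]
    refine Finset.sum_congr rfl fun T hT => ?_
    congr 1
    ext a
    rw [Finset.mem_filter]
    exact ⟨fun h => ⟨hsub T hT h, h⟩, fun h => h.2⟩
  have h2 : (∑ T ∈ R, T.card) ^ 2 ≤ A.card * ∑ a ∈ A, (R.filter fun T => a ∈ T).card ^ 2 := by
    rw [h1]; exact sq_sum_le_card_mul_sum_sq
  have h3 := sum_sq_card_filter_mem A R hinter
  have h4 : R.card * K₀ ≤ ∑ T ∈ R, T.card := by
    rw [← smul_eq_mul]
    exact Finset.card_nsmul_le_sum _ _ _ fun T hT => (hcard T hT).le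
  have h5 := h2.trans (Nat.mul_le_mul_left _ h3)
  clear h1 h2 h3
  generalize ∑ T ∈ R, T.card = s at *
  generalize R.card = k at *
  generalize A.card = n at *
  by_contra! hlt
  have h6 : K₀ ^ 2 * s ^ 2 ≤ n * (K₀ ^ 2 * s + 2 * s ^ 2) := by
    calc K₀ ^ 2 * s ^ 2 ≤ K₀ ^ 2 * (n * (s + 2 * k ^ 2)) := Nat.mul_le_mul_left _ h5
      _ = n * (K₀ ^ 2 * s + 2 * (k * K₀) ^ 2) := by ring
      _ ≤ _ := by gcongr
  rcases Nat.eq_zero_or_pos n with rfl | hn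
  · rw [zero_mul] at h5
    have : s = 0 := by simpa using h5
    omega
  · have hs : 0 < s := by omega
    have h7 : (4 * n) * s ^ 2 ≤ K₀ ^ 2 * s ^ 2 := Nat.mul_le_mul_right _ hK
    have h8 : (K₀ ^ 2 * s) * s ≤ (K₀ ^ 2 * s) * (2 * n) := by linarith
    have hpos : 0 < K₀ ^ 2 * s := Nat.mul_pos (by omega) hs
    have := Nat.le_of_mul_le_mul_left h8 hpos
    omega

section Curves

variable {V K : Type*} [Field K] (α β : V → K)

/-- The points of the curve `xαβ + yα + zβ + w = 0`. -/
def OnCurve (x y z w : K) (a : V) : Prop := x * (α a * β a) + y * α a + z * β a + w = 0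

/-- The distance in isotropic coordinates. -/
def isoDist (a b : V) : K := (α a - α b) * (β a - β b)

variable {α β}

theorem isoDist_comm (a b : V) : isoDist α β a b = isoDist α β b a := by
  unfold isoDist; ring

theorem OnCurve.denom_ne_zero {x y z w : K} (h : x * w - y * z ≠ 0) {a : V}
    (ha : OnCurve α β x y z w a) : x * α a + z ≠ 0 := by
  intro h0
  apply h
  unfold OnCurve at ha
  linear_combination x * ha - (x * β a + y) * h0

theorem OnCurve.eq_of_fst_eq (hinj : ∀ a b, α a = α b → β a = β b → a = b) {x y z w : K}
    (h : x * w - y * z ≠ 0) {a b : V} (ha : OnCurve α β x y z w a) (hb : OnCurve α β x y z w b)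
    (hab : α a = α b) : a = b := by
  have hd := ha.denom_ne_zero h
  refine hinj a b hab ?_
  unfold OnCurve at ha hb
  rw [← hab] at hb
  exact mul_left_cancel₀ hd (by linear_combination ha - hb)

theorem OnCurve.coeffs_of_three (hinj : ∀ a b, α a = α b → β a = β b → a = b)
    {x y z w x' y' z' w' : K} (h : x * w - y * z ≠ 0) {a b c : V} (hab : a ≠ b)
    (hac : a ≠ c) (hbc : b ≠ c) (ha : OnCurve α β x y z w a) (hb : OnCurve α β x y z w b)
    (hc : OnCurve α β x y z w c) (ha' : OnCurve α β x' y' z' w' a)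
    (hb' : OnCurve α β x' y' z' w' b) (hc' : OnCurve α β x' y' z' w' c) :
    y * x' - y' * x = 0 ∧ y * z' + w * x' - y' * z - w' * x = 0 ∧ w * z' - w' * z = 0 := by
  have key : ∀ e : V, OnCurve α β x y z w e → OnCurve α β x' y' z' w' e →
      (y * x' - y' * x) * α e ^ 2 + (y * z' + w * x' - y' * z - w' * x) * α e +
        (w * z' - w' * z) = 0 := by
    intro e he he'
    unfold OnCurve at he he'
    linear_combination (x' * α e + z') * he - (x * α e + z) * he'
  exact coeffs_eq_zero_of_three_roots
    (sub_ne_zero.2 fun e => hab (ha.eq_of_fst_eq hinj h hb e))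
    (sub_ne_zero.2 fun e => hac (ha.eq_of_fst_eq hinj h hc e))
    (sub_ne_zero.2 fun e => hbc (hb.eq_of_fst_eq hinj h hc e))
    (key a ha ha') (key b hb hb') (key c hc hc')

theorem OnCurve.transfer {x y z w x' y' z' w' : K} (h : x * w - y * z ≠ 0)
    (h1 : y * x' - y' * x = 0) (h2 : y * z' + w * x' - y' * z - w' * x = 0)
    (h3 : w * z' - w' * z = 0) {e : V} (he : OnCurve α β x y z w e) :
    OnCurve α β x' y' z' w' e := by
  have hd := he.denom_ne_zero h
  unfold OnCurve at he ⊢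
  have h0 : (x * α e + z) * (x' * (α e * β e) + y' * α e + z' * β e + w') = 0 := by
    linear_combination (x' * α e + z') * he - α e ^ 2 * h1 - α e * h2 - h3
  exact (mul_eq_zero.1 h0).resolve_left hd

/-- Two circles with nonzero radii and three common points have the same centre. -/
theorem circle_center_unique (hinj : ∀ a b, α a = α b → β a = β b → a = b) {e e' : V} {r r' : K}
    (hr : r ≠ 0) {a b c : V} (hab : a ≠ b)
    (hac : a ≠ c) (hbc : b ≠ c) (ha : isoDist α β e a = r) (hb : isoDist α β e b = r)
    (hc : isoDist α β e c = r) (ha' : isoDist α β e' a = r') (hb' : isoDist α β e' b = r')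
    (hc' : isoDist α β e' c = r') : e = e' := by
  have conv : ∀ (f q : V) (s : K), isoDist α β f q = s →
      OnCurve α β 1 (-β f) (-α f) (α f * β f - s) q := by
    intro f q s h
    unfold isoDist at h
    unfold OnCurve
    linear_combination h
  obtain ⟨h1, h2, h3⟩ := OnCurve.coeffs_of_three hinj (x := 1) (y := -β e) (z := -α e)
    (w := α e * β e - r) (x' := 1) (y' := -β e') (z' := -α e') (w' := α e' * β e' - r')
    (fun h => hr (by linear_combination -h)) hab hac hbc (conv _ _ _ ha) (conv _ _ _ hb)
    (conv _ _ _ hc) (conv _ _ _ ha') (conv _ _ _ hb') (conv _ _ _ hc')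
  have hβ : β e = β e' := by linear_combination -h1
  refine hinj e e' ?_ hβ
  rw [← hβ] at h2 h3
  have h0 : r * (α e - α e') = 0 := by linear_combination -h3 - α e * h2
  exact sub_eq_zero.1 ((mul_eq_zero.1 h0).resolve_left hr)

variable (α β)

/-- A subset of `A` with more than `K₀` points, cut out by a nondegenerate curve. -/
def IsRich (A : Finset V) (K₀ : ℕ) (T : Finset V) : Prop :=
  ∃ x y z w : K, x * w - y * z ≠ 0 ∧ (∀ a, a ∈ T ↔ a ∈ A ∧ OnCurve α β x y z w a) ∧ K₀ < T.card

variable {α β}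

theorem IsRich.inter_card_le [DecidableEq V] (hinj : ∀ a b, α a = α b → β a = β b → a = b)
    {A : Finset V} {K₀ : ℕ} {T T' : Finset V} (hT : IsRich α β A K₀ T) (hT' : IsRich α β A K₀ T')
    (hne : T ≠ T') : (T ∩ T').card ≤ 2 := by
  by_contra! hlt
  obtain ⟨a, ha, b, hb, c, hc, hab, hac, hbc⟩ := Finset.two_lt_card.1 hlt
  obtain ⟨x, y, z, w, h, hm, -⟩ := hT
  obtain ⟨x', y', z', w', h', hm', -⟩ := hT'
  rw [Finset.mem_inter, hm, hm'] at ha hb hc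
  obtain ⟨h1, h2, h3⟩ := OnCurve.coeffs_of_three hinj h hab hac hbc ha.1.2 hb.1.2 hc.1.2
    ha.2.2 hb.2.2 hc.2.2
  apply hne
  ext e
  rw [hm, hm']
  refine and_congr_right fun _ => ⟨fun he => he.transfer h h1 h2 h3, fun he => ?_⟩
  exact he.transfer h' (by linear_combination -h1) (by linear_combination -h2)
    (by linear_combination -h3)

open Classical in
theorem sum_card_rich_le (hinj : ∀ a b, α a = α b → β a = β b → a = b)
    (A : Finset V) (K₀ : ℕ) (hK : 4 * A.card ≤ K₀ ^ 2) :
    ∑ T ∈ A.powerset.filter (IsRich α β A K₀), T.card ≤ 2 * A.card := by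
  refine sum_card_le_of_pairwise_inter A _ K₀ (fun T hT => ?_) (fun T hT => ?_)
    (fun T hT T' hT' hne => ?_) hK
  · exact Finset.mem_powerset.1 (Finset.mem_filter.1 hT).1
  · obtain ⟨_, _, _, _, _, _, h⟩ := (Finset.mem_filter.1 hT).2
    exact h
  · exact (Finset.mem_filter.1 hT).2.inter_card_le hinj (Finset.mem_filter.1 hT').2 hne

end Curves
end Stmt1

namespace Stmt1

section Apex

variable {V K : Type*} [Field K] (α β : V → K)

open Classical in
/-- The isosceles triangles with apex in `B`, base in `A` and nonzero leg length. -/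
noncomputable def apexTriples (B A : Finset V) : Finset (V × V × V) :=
  (B ×ˢ A ×ˢ A).filter fun q =>
    isoDist α β q.1 q.2.1 = isoDist α β q.1 q.2.2 ∧ isoDist α β q.1 q.2.1 ≠ 0

open Classical in
/-- Pairs of `A` in general position: neither isotropic nor lying on a common rich curve. -/
noncomputable def goodPairs (A : Finset V) (K₀ : ℕ) : Finset (V × V) :=
  (A ×ˢ A).filter fun q => α q.1 ≠ α q.2 ∧ β q.1 ≠ β q.2 ∧
    ¬ ∃ T, IsRich α β A K₀ T ∧ q.1 ∈ T ∧ q.2 ∈ T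

variable {α β}

theorem mem_apexTriples {B A : Finset V} {q : V × V × V} : q ∈ apexTriples α β B A ↔
    (q.1 ∈ B ∧ q.2.1 ∈ A ∧ q.2.2 ∈ A) ∧
      isoDist α β q.1 q.2.1 = isoDist α β q.1 q.2.2 ∧ isoDist α β q.1 q.2.1 ≠ 0 := by
  classical
  rw [apexTriples, Finset.mem_filter, Finset.mem_product, Finset.mem_product]

theorem mem_goodPairs {A : Finset V} {K₀ : ℕ} {q : V × V} : q ∈ goodPairs α β A K₀ ↔
    (q.1 ∈ A ∧ q.2 ∈ A) ∧ α q.1 ≠ α q.2 ∧ β q.1 ≠ β q.2 ∧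
      ¬ ∃ T, IsRich α β A K₀ T ∧ q.1 ∈ T ∧ q.2 ∈ T := by
  classical
  rw [goodPairs, Finset.mem_filter, Finset.mem_product]

open Classical in
theorem card_apexTriples_eq (B A : Finset V) : (apexTriples α β B A).card =
    ∑ e ∈ B, ∑ a ∈ A, (A.filter fun b => isoDist α β e a = isoDist α β e b ∧
      isoDist α β e a ≠ 0).card := by
  rw [apexTriples, Finset.card_filter, Finset.sum_product]
  refine Finset.sum_congr rfl fun e _ => ?_
  rw [Finset.sum_product]
  refine Finset.sum_congr rfl fun a _ => ?_
  rw [Finset.card_filter]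

theorem card_apexTriples_curve_le (hinj : ∀ a b, α a = α b → β a = β b → a = b)
    (B T : Finset V) {x y z w : K} (h : x * w - y * z ≠ 0) (hT : ∀ a ∈ T, OnCurve α β x y z w a) :
    (apexTriples α β B T).card ≤ T.card ^ 2 + 2 * B.card * T.card := by
  classical
  rw [card_apexTriples_eq]
  let E := B.filter fun e => 2 < T.card ∧ ∃ r : K, r ≠ 0 ∧ ∀ b ∈ T, isoDist α β e b = r
  have hE : E.card ≤ 1 := by
    refine Finset.card_le_one.2 fun e he e' he' => ?_
    obtain ⟨-, h3, r, hr, her⟩ := Finset.mem_filter.1 he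
    obtain ⟨-, -, r', hr', her'⟩ := Finset.mem_filter.1 he'
    obtain ⟨a, ha, b, hb, c, hc, hab, hac, hbc⟩ := Finset.two_lt_card.1 h3
    exact circle_center_unique hinj hr hab hac hbc (her a ha) (her b hb) (her c hc)
      (her' a ha) (her' b hb) (her' c hc)
  have hc : ∀ e ∈ B, ∀ a ∈ T, (T.filter fun b => isoDist α β e a = isoDist α β e b ∧
      isoDist α β e a ≠ 0).card ≤ 2 + if e ∈ E then T.card else 0 := by
    intro e he a ha
    by_cases heE : e ∈ E
    · rw [if_pos heE]
      exact (Finset.card_filter_le _ _).trans (Nat.le_add_left _ _)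
    · rw [if_neg heE]
      by_contra! hlt
      obtain ⟨b1, h1, b2, h2, b3, h3, h12, h13, h23⟩ := Finset.two_lt_card.1 hlt
      rw [Finset.mem_filter] at h1 h2 h3
      have conv : ∀ q : V, isoDist α β e a = isoDist α β e q ↔
          OnCurve α β 1 (-β e) (-α e) (α e * β e - isoDist α β e a) q := by
        intro q
        unfold OnCurve isoDist
        constructor
        · intro hq; linear_combination -hq
        · intro hq; linear_combination -hq
      obtain ⟨k1, k2, k3⟩ := OnCurve.coeffs_of_three hinj h h12 h13 h23 (hT _ h1.1) (hT _ h2.1)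
        (hT _ h3.1) ((conv _).1 h1.2.1) ((conv _).1 h2.2.1) ((conv _).1 h3.2.1)
      refine heE (Finset.mem_filter.2 ⟨he, ?_, _, h1.2.2, fun b hb => ?_⟩)
      · exact (Finset.two_lt_card.2 ⟨b1, h1.1, b2, h2.1, b3, h3.1, h12, h13, h23⟩)
      · exact ((conv b).2 ((hT b hb).transfer h k1 k2 k3)).symm
  calc _ ≤ ∑ e ∈ B, ∑ _a ∈ T, (2 + if e ∈ E then T.card else 0) :=
        Finset.sum_le_sum fun e he => Finset.sum_le_sum fun a ha => hc e he a ha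
    _ = 2 * B.card * T.card + E.card * T.card ^ 2 := by
        simp only [Finset.sum_const, smul_eq_mul, mul_add, Finset.sum_add_distrib, mul_ite,
          mul_zero]
        rw [← Finset.sum_filter, Finset.sum_const, smul_eq_mul]
        have : B.filter (fun e => e ∈ E) = E := by
          ext e
          rw [Finset.mem_filter]
          exact ⟨fun h => h.2, fun h => ⟨(Finset.mem_filter.1 h).1, h⟩⟩
        rw [this]
        ring
    _ ≤ _ := by nlinarith [Nat.mul_le_mul_right (T.card ^ 2) hE]

open Classical in
theorem card_apexTriples_le (hinj : ∀ a b, α a = α b → β a = β b → a = b)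
    (B A : Finset V) (K₀ : ℕ) (hK : 4 * A.card ≤ K₀ ^ 2) :
    (apexTriples α β B A).card ≤ B.card * A.card + 2 * A.card * (A.card + 2 * B.card) +
      ∑ q ∈ goodPairs α β A K₀,
        (B.filter fun e => isoDist α β e q.1 = isoDist α β e q.2).card := by
  set R := A.powerset.filter (IsRich α β A K₀) with hR
  have hcover : apexTriples α β B A ⊆ (B ×ˢ A).image (fun q => (q.1, q.2, q.2)) ∪
      R.biUnion (fun T => apexTriples α β B T) ∪
      (B ×ˢ goodPairs α β A K₀).filter
        fun q => isoDist α β q.1 q.2.1 = isoDist α β q.1 q.2.2 := by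
    rintro ⟨e, a, b⟩ hq
    rw [mem_apexTriples] at hq
    obtain ⟨⟨he, ha, hb⟩, h1, h2⟩ := hq
    simp only at he ha hb h1 h2
    rw [Finset.mem_union, Finset.mem_union]
    by_cases hab : a = b
    · exact Or.inl (Or.inl (Finset.mem_image.2 ⟨(e, a), Finset.mk_mem_product he ha, by rw [hab]⟩))
    by_cases hT : ∃ T, IsRich α β A K₀ T ∧ a ∈ T ∧ b ∈ T
    · obtain ⟨T, hT, haT, hbT⟩ := hT
      refine Or.inl (Or.inr (Finset.mem_biUnion.2 ⟨T, ?_, ?_⟩))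
      · rw [hR, Finset.mem_filter, Finset.mem_powerset]
        refine ⟨fun c hc => ?_, hT⟩
        obtain ⟨_, _, _, _, _, hm, _⟩ := hT
        exact ((hm c).1 hc).1
      · rw [mem_apexTriples]
        exact ⟨⟨he, haT, hbT⟩, h1, h2⟩
    refine Or.inr (Finset.mem_filter.2 ⟨Finset.mk_mem_product he
      (mem_goodPairs.2 ⟨⟨ha, hb⟩, ?_, ?_, hT⟩), h1⟩)
    · intro hα
      simp only at hα
      refine hab (hinj a b hα ?_)
      unfold isoDist at h1 h2
      rw [← hα] at h1
      have := mul_left_cancel₀ (left_ne_zero_of_mul h2) h1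
      linear_combination -this
    · intro hβ
      simp only at hβ
      refine hab (hinj a b ?_ hβ)
      unfold isoDist at h1 h2
      rw [← hβ] at h1
      have := mul_right_cancel₀ (right_ne_zero_of_mul h2) h1
      linear_combination -this
  have h1 := (Finset.card_le_card hcover).trans ((Finset.card_union_le _ _).trans
    (Nat.add_le_add_right (Finset.card_union_le _ _) _))
  have h2 : ((B ×ˢ A).image (fun q : V × V => (q.1, q.2, q.2))).card ≤ B.card * A.card :=
    Finset.card_image_le.trans (Finset.card_product _ _).le
  have h3 : (R.biUnion fun T => apexTriples α β B T).card ≤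
      2 * A.card * (A.card + 2 * B.card) := by
    calc _ ≤ ∑ T ∈ R, (apexTriples α β B T).card := Finset.card_biUnion_le
      _ ≤ ∑ T ∈ R, T.card * (A.card + 2 * B.card) := by
          refine Finset.sum_le_sum fun T hT => ?_
          rw [hR, Finset.mem_filter, Finset.mem_powerset] at hT
          obtain ⟨hTA, x, y, z, w, h, hm, -⟩ := hT
          have := card_apexTriples_curve_le hinj B T h fun a ha => ((hm a).1 ha).2
          have h4 := Finset.card_le_card hTA
          nlinarith
      _ ≤ _ := by
          rw [← Finset.sum_mul]
          exact Nat.mul_le_mul_right _ (sum_card_rich_le hinj A K₀ hK)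
  have h4 : ((B ×ˢ goodPairs α β A K₀).filter
        fun q => isoDist α β q.1 q.2.1 = isoDist α β q.1 q.2.2).card =
      ∑ q ∈ goodPairs α β A K₀,
        (B.filter fun e => isoDist α β e q.1 = isoDist α β e q.2).card := by
    rw [Finset.card_filter, Finset.sum_product_right]
    refine Finset.sum_congr rfl fun q _ => ?_
    rw [Finset.card_filter]
  omega

end Apex
end Stmt1

namespace Stmt1

section Bisectors

variable {V K : Type*} [Field K] (α β : V → K)

/-- Some reflection `e ↦ (κ e_β + τ, (e_α - τ) / κ)` swaps `a, b` and swaps `c, d`. -/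
def SameBisector (a b c d : V) : Prop :=
  ∃ κ τ : K, α a = κ * β b + τ ∧ α b = κ * β a + τ ∧ α c = κ * β d + τ ∧ α d = κ * β c + τ

open Classical in
/-- The pairs of `A` at distance `r`. -/
noncomputable def distPairs (A : Finset V) (r : K) : Finset (V × V) :=
  (A ×ˢ A).filter fun q => isoDist α β q.1 q.2 = r

/-- Two pairs `(a, c)`, `(b, d)` such that `(a, b)` and `(c, d)` are good pairs with the same
bisector. -/
def Reflected (A : Finset V) (K₀ : ℕ) (q w : V × V) : Prop :=
  (q.1, w.1) ∈ goodPairs α β A K₀ ∧ (q.2, w.2) ∈ goodPairs α β A K₀ ∧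
    SameBisector α β q.1 w.1 q.2 w.2

/-- Either all columns or all rows of `A` have at most `K₀` points. -/
def IsThin (A : Finset V) (K₀ : ℕ) : Prop :=
  (∀ T ⊆ A, (∀ a ∈ T, ∀ b ∈ T, α a = α b) → T.card ≤ K₀) ∨
    (∀ T ⊆ A, (∀ a ∈ T, ∀ b ∈ T, β a = β b) → T.card ≤ K₀)

variable {α β}

theorem mem_distPairs {A : Finset V} {r : K} {q : V × V} :
    q ∈ distPairs α β A r ↔ (q.1 ∈ A ∧ q.2 ∈ A) ∧ isoDist α β q.1 q.2 = r := by
  classical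
  rw [distPairs, Finset.mem_filter, Finset.mem_product]

theorem SameBisector.swap {a b c d : V} (h : SameBisector α β a b c d) :
    SameBisector α β b a d c := by
  obtain ⟨κ, τ, h1, h2, h3, h4⟩ := h
  exact ⟨κ, τ, h2, h1, h4, h3⟩

theorem SameBisector.comm {a b c d : V} (h : SameBisector α β a b c d) :
    SameBisector α β c d a b := by
  obtain ⟨κ, τ, h1, h2, h3, h4⟩ := h
  exact ⟨κ, τ, h3, h4, h1, h2⟩

theorem SameBisector.flip {a b c d : V} (h : SameBisector α β a b c d) :
    SameBisector α β a b d c := by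
  obtain ⟨κ, τ, h1, h2, h3, h4⟩ := h
  exact ⟨κ, τ, h1, h2, h4, h3⟩

theorem SameBisector.isoDist_eq {a b c d : V} (h : SameBisector α β a b c d) :
    isoDist α β a c = isoDist α β b d := by
  obtain ⟨κ, τ, h1, h2, h3, h4⟩ := h
  unfold isoDist
  rw [h1, h2, h3, h4]; ring

theorem SameBisector.unique (hinj : ∀ a b, α a = α b → β a = β b → a = b) {a b c d d' : V}
    (hα : α a ≠ α b) (hβ : β a ≠ β b) (h : SameBisector α β a b c d)
    (h' : SameBisector α β a b c d') : d = d' := by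
  obtain ⟨κ, τ, h1, h2, h3, h4⟩ := h
  obtain ⟨κ', τ', h1', h2', h3', h4'⟩ := h'
  have hκ : κ = κ' := by
    refine mul_right_cancel₀ (sub_ne_zero.2 hβ) ?_
    linear_combination -h2 + h1 + h2' - h1'
  subst hκ
  have hτ : τ = τ' := by linear_combination h1' - h1
  subst hτ
  have hκ0 : κ ≠ 0 := by
    rintro rfl
    exact hα (by rw [h1, h2]; ring)
  refine hinj _ _ (h4.trans h4'.symm) (mul_left_cancel₀ hκ0 ?_)
  linear_combination h3' - h3

theorem goodPairs_swap {A : Finset V} {K₀ : ℕ} {a b : V} (h : (a, b) ∈ goodPairs α β A K₀) :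
    (b, a) ∈ goodPairs α β A K₀ := by
  rw [mem_goodPairs] at h ⊢
  obtain ⟨⟨h1, h2⟩, h3, h4, h5⟩ := h
  exact ⟨⟨h2, h1⟩, h3.symm, h4.symm, fun ⟨T, hT, hb, ha⟩ => h5 ⟨T, hT, ha, hb⟩⟩

theorem Reflected.symm {A : Finset V} {K₀ : ℕ} {q q' : V × V} (h : Reflected α β A K₀ q q') :
    Reflected α β A K₀ q' q :=
  ⟨goodPairs_swap h.1, goodPairs_swap h.2.1, h.2.2.swap⟩

theorem goodPairs_not_many_on_curve {A N : Finset V} {K₀ : ℕ} {a : V} {x y z w : K}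
    (h : x * w - y * z ≠ 0) (ha : OnCurve α β x y z w a)
    (hN : ∀ b ∈ N, (a, b) ∈ goodPairs α β A K₀ ∧ OnCurve α β x y z w b) : N.card ≤ K₀ := by
  classical
  by_contra! hlt
  obtain ⟨b, hb⟩ : N.Nonempty := Finset.card_pos.1 (by omega)
  obtain ⟨⟨haA, hbA⟩, -, -, hno⟩ := mem_goodPairs.1 (hN b hb).1
  refine hno ⟨A.filter (OnCurve α β x y z w), ⟨x, y, z, w, h, fun c => Finset.mem_filter, ?_⟩,
    Finset.mem_filter.2 ⟨haA, ha⟩, Finset.mem_filter.2 ⟨hbA, (hN b hb).2⟩⟩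
  refine hlt.trans_le (Finset.card_le_card fun c hc => Finset.mem_filter.2 ⟨?_, (hN c hc).2⟩)
  exact (mem_goodPairs.1 (hN c hc).1).1.2

/-- The core geometric step: a point in the incidence picture has few neighbours on a vertical
plane. -/
theorem card_reflected_plane_le (hinj : ∀ a b, α a = α b → β a = β b → a = b) {A : Finset V}
    {K₀ : ℕ} (hthin : IsThin α β A K₀) {r : K} (hr : r ≠ 0) {q : V × V}
    (hq : q ∈ distPairs α β A r) (N : Finset (V × V))
    (hN : ∀ q' ∈ N, q' ∈ distPairs α β A r ∧ Reflected α β A K₀ q q') {c₀ c₁ c₂ : K}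
    (hc : ¬ (c₁ = 0 ∧ c₂ = 0))
    (hplane : ∀ q' ∈ N, c₀ + c₁ * (α q'.2 - α q'.1) + c₂ * ((α q'.2 - α q'.1) * β q'.1) = 0) :
    N.card ≤ K₀ := by
  classical
  by_contra! hlt
  obtain ⟨a, c⟩ := q
  have hac := (mem_distPairs.1 hq).2
  simp only [isoDist] at hac
  have hfst : (N.image Prod.fst).card = N.card := by
    refine Finset.card_image_of_injOn ?_
    rintro ⟨b, d⟩ hbd ⟨b', d'⟩ hbd' h
    simp only at h
    subst h
    have h1 := (hN _ hbd).2
    have h2 := (hN _ hbd').2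
    obtain ⟨-, g1, g2, -⟩ := mem_goodPairs.1 h1.1
    exact Prod.ext rfl (SameBisector.unique hinj g1 g2 h1.2.2 h2.2.2)
  have hsnd : (N.image Prod.snd).card = N.card := by
    refine Finset.card_image_of_injOn ?_
    rintro ⟨b, d⟩ hbd ⟨b', d'⟩ hbd' h
    simp only at h
    subst h
    have h1 := (hN _ hbd).2
    have h2 := (hN _ hbd').2
    obtain ⟨-, g1, g2, -⟩ := mem_goodPairs.1 h1.2.1
    exact Prod.ext (SameBisector.unique hinj g1 g2 h1.2.2.comm h2.2.2.comm) rfl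
  have fact : ∀ q' ∈ N, (α q'.2 - α q'.1) ≠ 0 ∧ (α q'.2 - α q'.1) * (β q'.2 - β q'.1) = r ∧
      r * (α q'.1 - α a) + (α c - α a) * (α q'.2 - α q'.1) * (β q'.1 - β a) = 0 := by
    intro q' hq'
    have h1 := (mem_distPairs.1 (hN _ hq').1).2
    obtain ⟨κ, τ, h2, h3, h4, h5⟩ := (hN _ hq').2.2.2
    simp only [isoDist] at h1
    simp only at h2 h3 h4 h5
    have h6 : (α q'.2 - α q'.1) * (β q'.2 - β q'.1) = r := by rw [← h1]; ring
    refine ⟨fun h0 => hr (by rw [← h6, h0, zero_mul]), h6, ?_⟩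
    have h7 : α c - α a = κ * (β q'.2 - β q'.1) := by linear_combination h4 - h2
    have h8 : (α c - α a) * (α q'.2 - α q'.1) = κ * r := by rw [h7, ← h6]; ring
    rw [h8]
    linear_combination r * h3 - r * h2
  have hA1 : N.image Prod.fst ⊆ A := by
    intro b hb
    obtain ⟨q', hq', rfl⟩ := Finset.mem_image.1 hb
    exact (mem_distPairs.1 (hN _ hq').1).1.1
  have hA2 : N.image Prod.snd ⊆ A := by
    intro b hb
    obtain ⟨q', hq', rfl⟩ := Finset.mem_image.1 hb
    exact (mem_distPairs.1 (hN _ hq').1).1.2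
  have hρ0 : α c - α a ≠ 0 := by
    intro h0
    apply hr
    rw [← hac]
    linear_combination -(β a - β c) * h0
  by_cases hc2 : c₂ = 0
  · have hc1 : c₁ ≠ 0 := fun h => hc ⟨h, hc2⟩
    have hρ' : ∀ q' ∈ N, α q'.2 - α q'.1 = -c₀ / c₁ := by
      intro q' hq'
      have := hplane q' hq'
      rw [hc2] at this
      field_simp
      linear_combination this
    have hne : -c₀ / c₁ ≠ 0 := by
      obtain ⟨q', hq'⟩ : N.Nonempty := Finset.card_pos.1 (by omega)
      rw [← hρ' q' hq']
      exact (fact q' hq').1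
    generalize -c₀ / c₁ = σ at hρ' hne
    have := goodPairs_not_many_on_curve (α := α) (β := β) (A := A) (N := N.image Prod.fst)
      (K₀ := K₀) (a := a) (x := 0) (y := r)
      (z := (α c - α a) * σ) (w := -(r * α a + (α c - α a) * σ * β a))
      (fun h => (mul_ne_zero hr (mul_ne_zero hρ0 hne)) (by linear_combination -h))
      (by unfold OnCurve; ring) (by
        intro b hb
        obtain ⟨q', hq', rfl⟩ := Finset.mem_image.1 hb
        refine ⟨(hN _ hq').2.1, ?_⟩
        have h1 := (fact q' hq').2.2
        rw [hρ' q' hq'] at h1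
        unfold OnCurve
        linear_combination h1)
    omega
  · obtain ⟨C, hC⟩ : ∃ C, C = -c₀ / c₂ := ⟨_, rfl⟩
    obtain ⟨D, hD⟩ : ∃ D, D = -c₁ / c₂ := ⟨_, rfl⟩
    obtain ⟨A', hA'⟩ : ∃ A', A' = α a - (α c - α a) * C / r := ⟨_, rfl⟩
    obtain ⟨B', hB'⟩ : ∃ B', B' = (α c - α a) * (β a - D) / r := ⟨_, rfl⟩
    have hA'' : r * A' = r * α a - (α c - α a) * C := by rw [hA']; field_simp
    have hB'' : r * B' = (α c - α a) * (β a - D) := by rw [hB']; field_simp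
    have hCD : ∀ q' ∈ N, (α q'.2 - α q'.1) * (β q'.1 - D) = C := by
      intro q' hq'
      have := hplane q' hq'
      rw [hC, hD]
      field_simp
      linear_combination this
    have hb1 : ∀ q' ∈ N, α q'.1 - A' = B' * (α q'.2 - α q'.1) := by
      intro q' hq'
      refine mul_left_cancel₀ hr ?_
      linear_combination (fact q' hq').2.2 - hA'' - (α q'.2 - α q'.1) * hB'' -
        (α c - α a) * hCD q' hq'
    have hd2 : ∀ q' ∈ N, (α q'.2 - α q'.1) * (β q'.2 - D) = C + r := by
      intro q' hq'
      linear_combination hCD q' hq' + (fact q' hq').2.1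
    have hd1 : ∀ q' ∈ N, α q'.2 - A' = (B' + 1) * (α q'.2 - α q'.1) := by
      intro q' hq'
      linear_combination hb1 q' hq'
    have ha1 : (α a - A') * (β a - D) = B' * C := by
      refine mul_left_cancel₀ hr ?_
      linear_combination -(β a - D) * hA'' - C * hB''
    have hc1 : (α c - A') * (β c - D) = (B' + 1) * (C + r) := by
      refine mul_left_cancel₀ hr ?_
      linear_combination -(β c - D) * hA'' - (C + r) * hB'' + (C + r) * hac
    have n1 : B' * C = 0 := by
      by_contra h0
      have := goodPairs_not_many_on_curve (α := α) (β := β) (A := A) (N := N.image Prod.fst)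
        (K₀ := K₀) (a := a) (x := 1) (y := -D) (z := -A') (w := A' * D - B' * C)
        (fun h => h0 (by linear_combination -h))
        (by unfold OnCurve; linear_combination ha1) (by
          intro b hb
          obtain ⟨q', hq', rfl⟩ := Finset.mem_image.1 hb
          refine ⟨(hN _ hq').2.1, ?_⟩
          unfold OnCurve
          linear_combination (β q'.1 - D) * hb1 q' hq' + B' * hCD q' hq')
      omega
    have n2 : (B' + 1) * (C + r) = 0 := by
      by_contra h0
      have := goodPairs_not_many_on_curve (α := α) (β := β) (A := A) (N := N.image Prod.snd)
        (K₀ := K₀) (a := c) (x := 1) (y := -D) (z := -A') (w := A' * D - (B' + 1) * (C + r))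
        (fun h => h0 (by linear_combination -h))
        (by unfold OnCurve; linear_combination hc1) (by
          intro b hb
          obtain ⟨q', hq', rfl⟩ := Finset.mem_image.1 hb
          refine ⟨(hN _ hq').2.2.1, ?_⟩
          unfold OnCurve
          linear_combination (β q'.2 - D) * hd1 q' hq' + (B' + 1) * hd2 q' hq')
      omega
    have hcol : ∀ f : V × V → V, ∀ g : V → K, ∀ s : K, (∀ q' ∈ N, g (f q') = s) →
        ∀ u ∈ N.image f, ∀ v ∈ N.image f, g u = g v := by
      intro f g s h u hu v hv
      obtain ⟨q1, hq1, rfl⟩ := Finset.mem_image.1 hu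
      obtain ⟨q2, hq2, rfl⟩ := Finset.mem_image.1 hv
      rw [h q1 hq1, h q2 hq2]
    rcases mul_eq_zero.1 n1 with hB0 | hC0
    · have hCr : C + r = 0 := by
        rw [hB0, zero_add, one_mul] at n2; exact n2
      rcases hthin with h | h
      · have := h _ hA1 (hcol _ α A' fun q' hq' => by
          have := hb1 q' hq'
          rw [hB0] at this
          linear_combination this)
        omega
      · have := h _ hA2 (hcol _ β D fun q' hq' => by
          have h1 := hd2 q' hq'
          rw [hCr] at h1
          exact sub_eq_zero.1 ((mul_eq_zero.1 h1).resolve_left (fact q' hq').1))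
        omega
    · have hB1 : B' + 1 = 0 := by
        rw [hC0, zero_add] at n2
        exact (mul_eq_zero.1 n2).resolve_right hr
      rcases hthin with h | h
      · have := h _ hA2 (hcol _ α A' fun q' hq' => by
          have := hd1 q' hq'
          rw [hB1] at this
          linear_combination this)
        omega
      · have := h _ hA1 (hcol _ β D fun q' hq' => by
          have h1 := hCD q' hq'
          rw [hC0] at h1
          exact sub_eq_zero.1 ((mul_eq_zero.1 h1).resolve_left (fact q' hq').1))
        omega

open Classical in
theorem card_reflected_le (p : ℕ) [CharP K p] [Infinite K]
    (hinj : ∀ a b, α a = α b → β a = β b → a = b) {A : Finset V}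
    {K₀ : ℕ} (hthin : IsThin α β A K₀) {r : K} (hr : r ≠ 0)
    (hp : (distPairs α β A r).card ≤ p ^ 2) {δ : ℕ} (hδ : 10 ^ 5 ≤ δ) (hK : 2 * K₀ ≤ δ)
    (hδN : 10 ^ 8 * (distPairs α β A r).card ≤ δ ^ 2) :
    ((distPairs α β A r ×ˢ distPairs α β A r).filter fun t =>
      Reflected α β A K₀ t.1 t.2).card ≤ 2 * δ * (distPairs α β A r).card := by
  set S := distPairs α β A r with hS
  let θ : V × V → K × K × K := fun q => (α q.2 - α q.1, (α q.2 - α q.1) * β q.1, r * α q.1)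
  have hθ : Set.InjOn θ S := by
    rintro ⟨a, c⟩ h1 ⟨a', c'⟩ h2 h
    rw [Finset.mem_coe, hS, mem_distPairs] at h1 h2
    have e1 := h1.2
    have e2 := h2.2
    simp only [isoDist] at e1 e2
    simp only [θ, Prod.mk.injEq] at h
    obtain ⟨g1, g2, g3⟩ := h
    have hne : α c - α a ≠ 0 := fun h0 => hr (by
      rw [← e1]; linear_combination -(β a - β c) * h0)
    have q1 : α a = α a' := mul_left_cancel₀ hr g3
    have q2 : β a = β a' := by
      rw [← g1] at g2
      exact mul_left_cancel₀ hne g2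
    have q3 : α c = α c' := by linear_combination g1 + q1
    have q4 : β c = β c' := by
      refine mul_left_cancel₀ hne ?_
      rw [← q1, ← q2, ← q3] at e2
      linear_combination e1 - e2
    rw [hinj a a' q1 q2, hinj c c' q3 q4]
  let G : K × K × K → K × K × K → Prop := fun x y => ∃ q ∈ S, ∃ q' ∈ S, θ q = x ∧ θ q' = y ∧
    Reflected α β A K₀ q q'
  have hcard : (S.image θ).card = S.card := Finset.card_image_of_injOn hθ
  have main := card_edges_le p (S.image θ) G
    (by rintro x y ⟨q, hq, q', hq', h1, h2, h⟩; exact ⟨q', hq', q, hq, h2, h1, h.symm⟩)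
    (by
      rintro x - y - ⟨q, hq, q', hq', rfl, rfl, h⟩
      have h1 := (mem_distPairs.1 hq').2
      obtain ⟨κ, τ, h2, h3, h4, h5⟩ := h.2.2
      simp only [isoDist] at h1
      have h7 : α q.2 - α q.1 = κ * (β q'.2 - β q'.1) := by linear_combination h4 - h2
      have h8 : (α q.2 - α q.1) * (α q'.2 - α q'.1) = κ * r := by rw [h7, ← h1]; ring
      simp only [pairing, θ]
      linear_combination r * h3 - r * h2 + (β q'.1 - β q.1) * h8)
    K₀ δ
    (by
      intro x hx c₀ c₁ c₂ hc
      obtain ⟨q, hq, rfl⟩ := Finset.mem_image.1 hx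
      refine le_trans ?_ (card_reflected_plane_le hinj hthin hr hq
        (S.filter fun q' => Reflected α β A K₀ q q' ∧
          c₀ + c₁ * (α q'.2 - α q'.1) + c₂ * ((α q'.2 - α q'.1) * β q'.1) = 0)
        (fun q' hq' => ⟨(Finset.mem_filter.1 hq').1, (Finset.mem_filter.1 hq').2.1⟩) hc
        (fun q' hq' => (Finset.mem_filter.1 hq').2.2))
      refine le_trans (Finset.card_le_card fun y hy => ?_) (Finset.card_image_le (f := θ))
      obtain ⟨-, ⟨q1, hq1, q', hq', h1, rfl, h⟩, h2⟩ := Finset.mem_filter.1 hy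
      obtain rfl := hθ hq1 hq h1
      exact Finset.mem_image.2 ⟨q', Finset.mem_filter.2 ⟨hq', h, h2⟩, rfl⟩)
    hδ hK (by rwa [hcard]) (by rwa [hcard])
  rw [hcard] at main
  refine le_trans (Finset.card_le_card_of_injOn (fun t => (θ t.1, θ t.2)) ?_ ?_) main
  · intro t ht
    obtain ⟨h1, h2⟩ := Finset.mem_filter.1 ht
    rw [Finset.mem_product] at h1
    exact Finset.mem_filter.2 ⟨Finset.mk_mem_product (Finset.mem_image_of_mem _ h1.1)
      (Finset.mem_image_of_mem _ h1.2), t.1, h1.1, t.2, h1.2, rfl, rfl, h2⟩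
  · intro t ht t' ht' h
    obtain ⟨h1, -⟩ := Finset.mem_filter.1 ht
    obtain ⟨h1', -⟩ := Finset.mem_filter.1 ht'
    rw [Finset.mem_product] at h1 h1'
    simp only [Prod.mk.injEq] at h
    exact Prod.ext (hθ h1.1 h1'.1 h.1) (hθ h1.2 h1'.2 h.2)

end Bisectors
end Stmt1

namespace Stmt1

section BisectorQuadruples

variable {V K : Type*} [Field K] (α β : V → K)

open Classical in
/-- Two good pairs with the same bisector. -/
noncomputable def bisectorQuads (A : Finset V) (K₀ : ℕ) : Finset ((V × V) × (V × V)) :=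
  (goodPairs α β A K₀ ×ˢ goodPairs α β A K₀).filter fun t =>
    SameBisector α β t.1.1 t.1.2 t.2.1 t.2.2

variable {α β}

theorem mem_bisectorQuads {A : Finset V} {K₀ : ℕ} {t : (V × V) × (V × V)} :
    t ∈ bisectorQuads α β A K₀ ↔ (t.1 ∈ goodPairs α β A K₀ ∧ t.2 ∈ goodPairs α β A K₀) ∧
      SameBisector α β t.1.1 t.1.2 t.2.1 t.2.2 := by
  classical
  rw [bisectorQuads, Finset.mem_filter, Finset.mem_product]

theorem SameBisector.snd_eq_of_fst_eq {a b c d : V} (h : SameBisector α β a b c d)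
    (hab : α a ≠ α b) (hac : α a = α c) : β b = β d := by
  obtain ⟨κ, τ, h1, h2, h3, h4⟩ := h
  have hκ0 : κ ≠ 0 := by
    rintro rfl
    exact hab (by rw [h1, h2]; ring)
  exact mul_left_cancel₀ hκ0 (by linear_combination hac - h1 + h3)

theorem SameBisector.fst_eq_of_snd_eq {a b c d : V} (h : SameBisector α β a b c d)
    (hac : β a = β c) : α b = α d := by
  obtain ⟨κ, τ, h1, h2, h3, h4⟩ := h
  rw [h2, h4, hac]

open Classical in
theorem card_bisectorQuads_fst_eq_le (hinj : ∀ a b, α a = α b → β a = β b → a = b)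
    {A : Finset V} {K₀ : ℕ} (hthin : IsThin α β A K₀) :
    ((bisectorQuads α β A K₀).filter fun t => α t.1.1 = α t.2.1).card ≤ K₀ * A.card ^ 2 := by
  rw [sq, ← Finset.card_product]
  refine (Finset.card_le_mul_card_image_of_maps_to (f := Prod.fst) (t := A ×ˢ A) ?_ K₀ ?_)
  · intro t ht
    have h1 := (mem_goodPairs.1 (mem_bisectorQuads.1 (Finset.mem_filter.1 ht).1).1.1).1
    exact Finset.mem_product.2 h1
  rintro ⟨a, b⟩ -
  set S := ((bisectorQuads α β A K₀).filter fun t => α t.1.1 = α t.2.1).filter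
    fun t => t.1 = (a, b) with hS
  have fact : ∀ t ∈ S, t.1 = (a, b) ∧ t.2.1 ∈ A ∧ t.2.2 ∈ A ∧ α t.2.1 = α a ∧ β t.2.2 = β b ∧
      α a ≠ α b ∧ β a ≠ β b ∧ SameBisector α β a b t.2.1 t.2.2 := by
    rintro ⟨⟨a', b'⟩, c, d⟩ ht
    obtain ⟨h1, h2⟩ := Finset.mem_filter.1 ht
    obtain ⟨h3, h4⟩ := Finset.mem_filter.1 h1
    obtain ⟨⟨g1, g2⟩, h5⟩ := mem_bisectorQuads.1 h3
    obtain ⟨-, h6, h7, -⟩ := mem_goodPairs.1 g1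
    obtain ⟨⟨h8, h9⟩, -⟩ := mem_goodPairs.1 g2
    simp only [Prod.mk.injEq] at h2
    obtain ⟨rfl, rfl⟩ := h2
    exact ⟨rfl, h8, h9, h4.symm, (h5.snd_eq_of_fst_eq h6 h4).symm, h6, h7, h5⟩
  rcases hthin with hthin | hthin
  · have hinjS : Set.InjOn (fun t : (V × V) × (V × V) => t.2.1) S := by
      intro t ht t' ht' h
      obtain ⟨e, -, -, -, -, h6, h7, h5⟩ := fact t ht
      obtain ⟨e', -, -, -, -, -, -, h5'⟩ := fact t' ht'
      simp only at h
      rw [← h] at h5'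
      exact Prod.ext (e.trans e'.symm) (Prod.ext h (SameBisector.unique hinj h6 h7 h5 h5'))
    rw [← Finset.card_image_of_injOn hinjS]
    refine hthin _ ?_ ?_
    · intro c hc
      obtain ⟨t, ht, rfl⟩ := Finset.mem_image.1 hc
      exact (fact t ht).2.1
    · intro c hc c' hc'
      obtain ⟨t, ht, rfl⟩ := Finset.mem_image.1 hc
      obtain ⟨t', ht', rfl⟩ := Finset.mem_image.1 hc'
      exact (fact t ht).2.2.2.1.trans (fact t' ht').2.2.2.1.symm
  · have hinjS : Set.InjOn (fun t : (V × V) × (V × V) => t.2.2) S := by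
      intro t ht t' ht' h
      obtain ⟨e, -, -, -, -, h6, h7, h5⟩ := fact t ht
      obtain ⟨e', -, -, -, -, -, -, h5'⟩ := fact t' ht'
      simp only at h
      rw [← h] at h5'
      exact Prod.ext (e.trans e'.symm)
        (Prod.ext (SameBisector.unique hinj h6 h7 h5.flip h5'.flip) h)
    rw [← Finset.card_image_of_injOn hinjS]
    refine hthin _ ?_ ?_
    · intro c hc
      obtain ⟨t, ht, rfl⟩ := Finset.mem_image.1 hc
      exact (fact t ht).2.2.1
    · intro c hc c' hc'
      obtain ⟨t, ht, rfl⟩ := Finset.mem_image.1 hc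
      obtain ⟨t', ht', rfl⟩ := Finset.mem_image.1 hc'
      exact (fact t ht).2.2.2.2.1.trans (fact t' ht').2.2.2.2.1.symm

open Classical in
theorem card_bisectorQuads_isotropic_le (hinj : ∀ a b, α a = α b → β a = β b → a = b)
    {A : Finset V} {K₀ : ℕ} (hthin : IsThin α β A K₀) :
    ((bisectorQuads α β A K₀).filter fun t => isoDist α β t.1.1 t.2.1 = 0).card ≤
      2 * (K₀ * A.card ^ 2) := by
  have h1 := card_bisectorQuads_fst_eq_le hinj hthin
  have h2 : ((bisectorQuads α β A K₀).filter fun t => β t.1.1 = β t.2.1).card ≤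
      ((bisectorQuads α β A K₀).filter fun t => α t.1.1 = α t.2.1).card := by
    refine Finset.card_le_card_of_injOn (fun t => (t.1.swap, t.2.swap)) ?_ ?_
    · rintro ⟨⟨a, b⟩, c, d⟩ ht
      obtain ⟨h3, h4⟩ := Finset.mem_filter.1 ht
      obtain ⟨⟨g1, g2⟩, h5⟩ := mem_bisectorQuads.1 h3
      exact Finset.mem_filter.2 ⟨mem_bisectorQuads.2 ⟨⟨goodPairs_swap g1, goodPairs_swap g2⟩,
        h5.swap⟩, h5.fst_eq_of_snd_eq h4⟩
    · rintro ⟨⟨a, b⟩, c, d⟩ - ⟨⟨a', b'⟩, c', d'⟩ - h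
      simp only [Prod.swap_prod_mk, Prod.mk.injEq] at h ⊢
      tauto
  have h3 : (bisectorQuads α β A K₀).filter (fun t => isoDist α β t.1.1 t.2.1 = 0) ⊆
      ((bisectorQuads α β A K₀).filter fun t => α t.1.1 = α t.2.1) ∪
        ((bisectorQuads α β A K₀).filter fun t => β t.1.1 = β t.2.1) := by
    intro t ht
    obtain ⟨h3, h4⟩ := Finset.mem_filter.1 ht
    rw [Finset.mem_union, Finset.mem_filter, Finset.mem_filter]
    rcases mul_eq_zero.1 h4 with h | h
    · exact Or.inl ⟨h3, sub_eq_zero.1 h⟩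
    · exact Or.inr ⟨h3, sub_eq_zero.1 h⟩
  have h4 := (Finset.card_le_card h3).trans (Finset.card_union_le _ _)
  omega

open Classical in
theorem card_bisectorQuads_dist_eq_le (A : Finset V) (K₀ : ℕ) (r : K) :
    ((bisectorQuads α β A K₀).filter fun t => isoDist α β t.1.1 t.2.1 = r).card ≤
      ((distPairs α β A r ×ˢ distPairs α β A r).filter fun t =>
        Reflected α β A K₀ t.1 t.2).card := by
  refine Finset.card_le_card_of_injOn (fun t => ((t.1.1, t.2.1), (t.1.2, t.2.2))) ?_ ?_
  · rintro ⟨⟨a, b⟩, c, d⟩ ht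
    obtain ⟨h3, h4⟩ := Finset.mem_filter.1 ht
    obtain ⟨⟨g1, g2⟩, h5⟩ := mem_bisectorQuads.1 h3
    have k1 := (mem_goodPairs.1 g1).1
    have k2 := (mem_goodPairs.1 g2).1
    exact Finset.mem_filter.2 ⟨Finset.mk_mem_product (mem_distPairs.2 ⟨⟨k1.1, k2.1⟩, h4⟩)
      (mem_distPairs.2 ⟨⟨k1.2, k2.2⟩, h5.isoDist_eq.symm.trans h4⟩), g1, g2, h5⟩
  · rintro ⟨⟨a, b⟩, c, d⟩ - ⟨⟨a', b'⟩, c', d'⟩ - h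
    simp only [Prod.mk.injEq] at h ⊢
    tauto

open Classical in
/-- The nonzero distances between points of `A`. -/
noncomputable def nonzeroDists (α β : V → K) (A : Finset V) : Finset K :=
  ((A ×ˢ A).image fun q => isoDist α β q.1 q.2).erase 0

theorem sum_card_distPairs_le (A : Finset V) :
    ∑ r ∈ nonzeroDists α β A, (distPairs α β A r).card ≤ A.card ^ 2 := by
  classical
  rw [sq, ← Finset.card_product,
    Finset.card_eq_sum_card_image (fun q => isoDist α β q.1 q.2) (A ×ˢ A)]
  exact Finset.sum_le_sum_of_subset (Finset.erase_subset _ _)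

open Classical in
theorem card_distPairs_sq_le (A : Finset V) (r : K) : (distPairs α β A r).card ^ 2 ≤
    A.card * ∑ a ∈ A, (A.filter fun c => isoDist α β a c = r).card ^ 2 := by
  have h : (distPairs α β A r).card = ∑ a ∈ A, (A.filter fun c => isoDist α β a c = r).card := by
    rw [distPairs, Finset.card_filter, Finset.sum_product]
    simp only [Finset.card_filter]
  rw [h]
  exact sq_sum_le_card_mul_sum_sq

theorem card_distPairs_sq_le_cube (hinj : ∀ a b, α a = α b → β a = β b → a = b)
    (A : Finset V) {r : K} (hr : r ≠ 0) : (distPairs α β A r).card ^ 2 ≤ 3 * A.card ^ 3 := by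
  classical
  refine (card_distPairs_sq_le A r).trans ?_
  have h1 : ∑ a ∈ A, (A.filter fun c => isoDist α β a c = r).card ^ 2 =
      ∑ q ∈ A ×ˢ A, (A.filter fun a => isoDist α β a q.1 = r ∧ isoDist α β a q.2 = r).card := by
    rw [← sum_card_filter_comm A (A ×ˢ A) fun a q => isoDist α β a q.1 = r ∧ isoDist α β a q.2 = r]
    refine Finset.sum_congr rfl fun a _ => ?_
    rw [sq, ← Finset.card_product, ← Finset.filter_product]
  have h2 : ∀ q ∈ A ×ˢ A,
      (A.filter fun a => isoDist α β a q.1 = r ∧ isoDist α β a q.2 = r).card ≤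
        2 + if q.1 = q.2 then A.card else 0 := by
    intro q _
    split_ifs with h
    · exact (Finset.card_filter_le _ _).trans (by omega)
    · by_contra! hlt
      obtain ⟨a, ha, b, hb, c, hc, hab, hac, hbc⟩ := Finset.two_lt_card.1 (by simpa using hlt)
      rw [Finset.mem_filter, isoDist_comm (b := q.1), isoDist_comm (b := q.2)] at ha hb hc
      exact h (circle_center_unique hinj hr hab hac hbc ha.2.1 hb.2.1 hc.2.1 ha.2.2 hb.2.2 hc.2.2)
  have h3 := Finset.sum_le_sum h2
  have h4 : ∑ q ∈ A ×ˢ A, (2 + if q.1 = q.2 then A.card else 0) = 3 * A.card ^ 2 := by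
    rw [Finset.sum_add_distrib, Finset.sum_product (f := fun q => if q.1 = q.2 then A.card else 0)]
    simp only [Finset.sum_const, Finset.card_product, smul_eq_mul, Finset.sum_ite_eq,
      Finset.sum_ite_mem, Finset.inter_self]
    ring
  rw [h1]
  calc _ ≤ A.card * (3 * A.card ^ 2) := Nat.mul_le_mul_left _ (h3.trans h4.le)
    _ = _ := by ring

theorem sum_card_distPairs_sq_le (A : Finset V) :
    ∑ r ∈ nonzeroDists α β A, (distPairs α β A r).card ^ 2 ≤
      A.card * (apexTriples α β A A).card := by
  classical
  refine (Finset.sum_le_sum fun r _ => card_distPairs_sq_le A r).trans ?_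
  rw [← Finset.mul_sum, Finset.sum_comm, card_apexTriples_eq]
  refine Nat.mul_le_mul_left _ (Finset.sum_le_sum fun e _ => ?_)
  have h1 : ∀ r ∈ nonzeroDists α β A, (A.filter fun c => isoDist α β e c = r).card ^ 2 =
      ∑ a ∈ A, if isoDist α β e a = r then (A.filter fun b => isoDist α β e a = isoDist α β e b ∧
        isoDist α β e a ≠ 0).card else 0 := by
    intro r hr
    have hr0 := (Finset.mem_erase.1 hr).1
    rw [← Finset.sum_filter, sq, ← smul_eq_mul, ← Finset.sum_const]
    refine Finset.sum_congr rfl fun a ha => ?_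
    have h2 := (Finset.mem_filter.1 ha).2
    congr 1
    refine Finset.filter_congr fun b _ => ?_
    rw [h2]
    exact ⟨fun h => ⟨h.symm, hr0⟩, fun h => h.1.symm⟩
  rw [Finset.sum_congr rfl h1, Finset.sum_comm]
  refine Finset.sum_le_sum fun a _ => ?_
  rw [Finset.sum_ite_eq]
  split_ifs
  · exact le_rfl
  · exact Nat.zero_le _

open Classical in
theorem card_bisectorQuads_le_sum (p : ℕ) [CharP K p] [Infinite K]
    (hinj : ∀ a b, α a = α b → β a = β b → a = b) {A : Finset V} {K₀ : ℕ}
    (hthin : IsThin α β A K₀) (hp : 3 * A.card ^ 3 ≤ p ^ 4) :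
    (bisectorQuads α β A K₀).card ≤ 2 * (K₀ * A.card ^ 2) +
      ∑ r ∈ nonzeroDists α β A, 2 * (110000 + 2 * K₀ +
        10000 * Nat.sqrt (distPairs α β A r).card) * (distPairs α β A r).card := by
  have h1 : (bisectorQuads α β A K₀).card ≤
      ((bisectorQuads α β A K₀).filter fun t => isoDist α β t.1.1 t.2.1 = 0).card +
        ∑ r ∈ nonzeroDists α β A,
          ((bisectorQuads α β A K₀).filter fun t => isoDist α β t.1.1 t.2.1 = r).card := by
    rw [← Finset.card_filter_add_card_filter_not (s := bisectorQuads α β A K₀)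
      fun t => isoDist α β t.1.1 t.2.1 = 0]
    refine Nat.add_le_add_left ?_ _
    rw [Finset.card_eq_sum_card_fiberwise (f := fun t => isoDist α β t.1.1 t.2.1)
      (t := nonzeroDists α β A)]
    · refine Finset.sum_le_sum fun r _ => Finset.card_le_card fun t ht => ?_
      obtain ⟨h2, h3⟩ := Finset.mem_filter.1 ht
      exact Finset.mem_filter.2 ⟨(Finset.mem_filter.1 h2).1, h3⟩
    · intro t ht
      obtain ⟨h2, h3⟩ := Finset.mem_filter.1 ht
      obtain ⟨⟨g1, g2⟩, h5⟩ := mem_bisectorQuads.1 h2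
      have k1 := (mem_goodPairs.1 g1).1
      have k2 := (mem_goodPairs.1 g2).1
      exact Finset.mem_erase.2 ⟨h3, Finset.mem_image.2 ⟨(t.1.1, t.2.1),
        Finset.mk_mem_product k1.1 k2.1, rfl⟩⟩
  refine h1.trans (Nat.add_le_add (card_bisectorQuads_isotropic_le hinj hthin)
    (Finset.sum_le_sum fun r hr => ?_))
  have hr0 := (Finset.mem_erase.1 hr).1
  refine (card_bisectorQuads_dist_eq_le A K₀ r).trans
    (card_reflected_le p hinj hthin hr0 ?_ (by omega) (by omega) ?_)
  · have h2 := (card_distPairs_sq_le_cube hinj A hr0).trans hp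
    refine (Nat.pow_le_pow_iff_left two_ne_zero).1 ?_
    rwa [← pow_mul]
  · have h2 := Nat.lt_succ_sqrt (distPairs α β A r).card
    calc 10 ^ 8 * (distPairs α β A r).card
        ≤ (10 ^ 4 * (Nat.sqrt (distPairs α β A r).card + 1)) ^ 2 := by
          rw [Nat.succ_eq_add_one] at h2; nlinarith
      _ ≤ _ := Nat.pow_le_pow_left (by omega) 2

/-- The number of pairs of good pairs with a common bisector. -/
theorem card_bisectorQuads_le (p : ℕ) [CharP K p] [Infinite K]
    (hinj : ∀ a b, α a = α b → β a = β b → a = b) {A : Finset V} {K₀ : ℕ}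
    (hthin : IsThin α β A K₀) (hp : 3 * A.card ^ 3 ≤ p ^ 4) :
    ((bisectorQuads α β A K₀).card : ℝ) ≤ (6 * K₀ + 220000) * (A.card : ℝ) ^ 2 +
      20000 * (A.card * √(A.card * (apexTriples α β A A).card)) := by
  have h := card_bisectorQuads_le_sum p hinj hthin hp
  have h' : ((bisectorQuads α β A K₀).card : ℝ) ≤ 2 * (K₀ * (A.card : ℝ) ^ 2) +
      ∑ r ∈ nonzeroDists α β A, 2 * (110000 + 2 * K₀ +
        10000 * (Nat.sqrt (distPairs α β A r).card : ℝ)) * (distPairs α β A r).card := by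
    exact_mod_cast h
  have h1 : (∑ r ∈ nonzeroDists α β A, ((distPairs α β A r).card : ℝ)) ≤ (A.card : ℝ) ^ 2 := by
    exact_mod_cast sum_card_distPairs_le (α := α) (β := β) A
  have h2 : (∑ r ∈ nonzeroDists α β A, ((distPairs α β A r).card : ℝ) ^ 2) ≤
      A.card * (apexTriples α β A A).card := by
    exact_mod_cast sum_card_distPairs_sq_le (α := α) (β := β) A
  have h3 : ∑ r ∈ nonzeroDists α β A,
      √((distPairs α β A r).card : ℝ) * ((distPairs α β A r).card : ℝ) ≤
        A.card * √(A.card * (apexTriples α β A A).card) := by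
    have h4 := Real.sum_sqrt_mul_sqrt_le (nonzeroDists α β A)
      (f := fun r => ((distPairs α β A r).card : ℝ))
      (g := fun r => ((distPairs α β A r).card : ℝ) ^ 2)
      (fun _ => Nat.cast_nonneg _) (fun _ => sq_nonneg _)
    simp only [Real.sqrt_sq (Nat.cast_nonneg (α := ℝ) _)] at h4
    refine h4.trans (mul_le_mul ?_ (Real.sqrt_le_sqrt h2) (Real.sqrt_nonneg _)
      (Nat.cast_nonneg _))
    exact Real.sqrt_le_iff.2 ⟨Nat.cast_nonneg _, h1⟩
  have h5 : ∑ r ∈ nonzeroDists α β A, 2 * (110000 + 2 * K₀ +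
        10000 * (Nat.sqrt (distPairs α β A r).card : ℝ)) * (distPairs α β A r).card ≤
      (4 * K₀ + 220000) * (∑ r ∈ nonzeroDists α β A, ((distPairs α β A r).card : ℝ)) +
        20000 * ∑ r ∈ nonzeroDists α β A,
          √((distPairs α β A r).card : ℝ) * ((distPairs α β A r).card : ℝ) := by
    rw [Finset.mul_sum, Finset.mul_sum, ← Finset.sum_add_distrib]
    refine Finset.sum_le_sum fun r _ => ?_
    have h6 : ((Nat.sqrt (distPairs α β A r).card : ℝ)) ≤ √((distPairs α β A r).card : ℝ) :=
      Real.nat_sqrt_le_real_sqrt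
    have h7 := mul_le_mul_of_nonneg_right h6 (Nat.cast_nonneg (α := ℝ) (distPairs α β A r).card)
    linarith
  have h8 : (4 * K₀ + 220000) * (∑ r ∈ nonzeroDists α β A, ((distPairs α β A r).card : ℝ)) ≤
      (4 * K₀ + 220000) * (A.card : ℝ) ^ 2 := mul_le_mul_of_nonneg_left h1 (by positivity)
  linarith

end BisectorQuadruples
end Stmt1

namespace Stmt1

section Thin

theorem mul_card_image_rich_le {V W : Type*} [DecidableEq W] (S : Finset V) (f : V → W) (k : ℕ) :
    k * ((S.filter fun a => k < (S.filter fun b => f b = f a).card).image f).card ≤ S.card := by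
  classical
  set X := S.filter fun a => k < (S.filter fun b => f b = f a).card with hX
  refine le_trans (Finset.mul_card_image_le_card_of_maps_to
    (s := S.filter fun a => f a ∈ X.image f) (f := f) (t := X.image f)
    (fun a ha => (Finset.mem_filter.1 ha).2) k ?_) (Finset.card_filter_le _ _)
  intro w hw
  obtain ⟨a, ha, rfl⟩ := Finset.mem_image.1 hw
  refine (Finset.mem_filter.1 ha).2.le.trans (Finset.card_le_card fun b hb => ?_)
  obtain ⟨h1, h2⟩ := Finset.mem_filter.1 hb
  exact Finset.mem_filter.2 ⟨Finset.mem_filter.2 ⟨h1, h2 ▸ hw⟩, h2⟩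

theorem card_le_of_subset_sdiff_rich {V W : Type*} [DecidableEq W] [DecidableEq V] {S T : Finset V}
    (f : V → W) {k : ℕ}
    (hT : T ⊆ S \ S.filter fun a => k < (S.filter fun b => f b = f a).card)
    (h : ∀ a ∈ T, ∀ b ∈ T, f a = f b) : T.card ≤ k := by
  rcases T.eq_empty_or_nonempty with rfl | ⟨a, ha⟩
  · exact Nat.zero_le _
  obtain ⟨h1, h2⟩ := Finset.mem_sdiff.1 (hT ha)
  rw [Finset.mem_filter] at h2
  push Not at h2
  refine le_trans (Finset.card_le_card fun b hb => ?_) (h2 h1)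
  exact Finset.mem_filter.2 ⟨(Finset.mem_sdiff.1 (hT hb)).1, h b hb a ha⟩

theorem exists_isThin_subset {V K : Type*} [Field K] {α β : V → K}
    (hinj : ∀ a b, α a = α b → β a = β b → a = b) (A : Finset V) (K₀ : ℕ)
    (hK : 4 * A.card ≤ K₀ ^ 2) :
    ∃ A₀ ⊆ A, A.card ≤ 4 * A₀.card ∧ IsThin α β A₀ K₀ := by
  classical
  set X := A.filter fun a => K₀ < (A.filter fun b => α b = α a).card with hX
  have hXA : X ⊆ A := Finset.filter_subset _ _
  by_cases h1 : 2 * X.card ≤ A.card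
  · refine ⟨A \ X, Finset.sdiff_subset, ?_, Or.inl fun T hT h =>
      card_le_of_subset_sdiff_rich α hT h⟩
    rw [Finset.card_sdiff_of_subset hXA]; omega
  set Y := X.filter fun a => K₀ < (X.filter fun b => β b = β a).card with hY
  have hYX : Y ⊆ X := Finset.filter_subset _ _
  by_cases h2 : 2 * Y.card ≤ X.card
  · refine ⟨X \ Y, Finset.sdiff_subset.trans hXA, ?_,
      Or.inr fun T hT h => card_le_of_subset_sdiff_rich β hT h⟩
    rw [Finset.card_sdiff_of_subset hYX]; omega
  exfalso
  have h3 : K₀ * (X.image α).card ≤ A.card := mul_card_image_rich_le A α K₀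
  have h4 : K₀ * (Y.image β).card ≤ A.card :=
    (mul_card_image_rich_le X β K₀).trans (Finset.card_le_card hXA)
  have h5 : Y.card ≤ (X.image α).card * (Y.image β).card := by
    rw [← Finset.card_product]
    refine Finset.card_le_card_of_injOn (fun a => (α a, β a)) (fun a ha => ?_) ?_
    · exact Finset.mk_mem_product (Finset.mem_image_of_mem _ (hYX ha))
        (Finset.mem_image_of_mem _ ha)
    · intro a _ b _ h
      simp only [Prod.mk.injEq] at h
      exact hinj a b h.1 h.2
  have h6 : A.card * (4 * Y.card) ≤ A.card * A.card := by
    calc A.card * (4 * Y.card) = 4 * A.card * Y.card := by ring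
      _ ≤ K₀ ^ 2 * ((X.image α).card * (Y.image β).card) := Nat.mul_le_mul hK h5
      _ = (K₀ * (X.image α).card) * (K₀ * (Y.image β).card) := by ring
      _ ≤ _ := Nat.mul_le_mul h3 h4
  have h7 := Finset.card_le_card hXA
  have h8 := Nat.le_of_mul_le_mul_left h6 (by omega)
  omega

end Thin
end Stmt1

namespace Stmt1

section Lines

variable {F : Type*} [Field F]

/-- Incidence with the line `y = j x + k` or `x = k`. -/
def OnLine : Option F × F → F × F → Prop
  | (some j, k), e => e.2 = j * e.1 + k
  | (none, k), e => e.1 = k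

theorem OnLine.unique {e e' : F × F} (hne : e ≠ e') {l l' : Option F × F} (h1 : OnLine l e)
    (h2 : OnLine l e') (h3 : OnLine l' e) (h4 : OnLine l' e') : l = l' := by
  obtain ⟨_ | j, k⟩ := l <;> obtain ⟨_ | j', k'⟩ := l' <;> simp only [OnLine] at h1 h2 h3 h4
  · rw [← h1, ← h3]
  · exact absurd (Prod.ext (h1.trans h2.symm) (by rw [h3, h4, h1, h2])) hne
  · exact absurd (Prod.ext (h3.trans h4.symm) (by rw [h1, h2, h3, h4])) hne
  · have hx : e.1 - e'.1 ≠ 0 := by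
      intro h0
      have h5 := sub_eq_zero.1 h0
      exact hne (Prod.ext h5 (by rw [h1, h2, h5]))
    have hj : j = j' := mul_right_cancel₀ hx (by linear_combination h3 - h1 + h2 - h4)
    subst hj
    have hk : k = k' := by linear_combination h3 - h1
    rw [hk]

variable [Fintype F]

open Classical in
theorem card_lines_through (e : F × F) :
    (Finset.univ.filter fun l => OnLine l e).card = Fintype.card F + 1 := by
  rw [← Fintype.card_option, ← Finset.card_univ]
  refine Finset.card_bij' (fun l _ => l.1) (fun o _ => match o with
    | some j => (some j, e.2 - j * e.1)
    | none => (none, e.1)) (fun _ _ => Finset.mem_univ _) ?_ ?_ (fun o _ => by cases o <;> rfl)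
  · rintro (_ | j) -
    · exact Finset.mem_filter.2 ⟨Finset.mem_univ _, rfl⟩
    · exact Finset.mem_filter.2 ⟨Finset.mem_univ _, (add_sub_cancel _ _).symm⟩
  · rintro ⟨_ | j, k⟩ h
    · have h1 : e.1 = k := (Finset.mem_filter.1 h).2
      simp [h1]
    · have h1 : e.2 = j * e.1 + k := (Finset.mem_filter.1 h).2
      simp [h1]

open Classical in
theorem sum_sq_lines_sub_le (B : Finset (F × F)) :
    ∑ l, (((B.filter (OnLine l)).card : ℝ) - B.card / Fintype.card F) ^ 2 ≤
      Fintype.card F * B.card := by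
  have hq : (0 : ℝ) < Fintype.card F := by exact_mod_cast Fintype.card_pos
  have h1 : ∑ l, (B.filter (OnLine l)).card = B.card * (Fintype.card F + 1) := by
    rw [sum_card_filter_comm Finset.univ B OnLine, Finset.sum_congr rfl fun e _ =>
      card_lines_through e, Finset.sum_const, smul_eq_mul]
  have h2 : ∑ l, (B.filter (OnLine l)).card ^ 2 ≤
      B.card * Fintype.card F + B.card ^ 2 := by
    have h3 : ∑ l, (B.filter (OnLine l)).card ^ 2 =
        ∑ t ∈ B ×ˢ B, (Finset.univ.filter fun l => OnLine l t.1 ∧ OnLine l t.2).card := by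
      rw [← sum_card_filter_comm Finset.univ (B ×ˢ B) fun l t => OnLine l t.1 ∧ OnLine l t.2]
      refine Finset.sum_congr rfl fun l _ => ?_
      rw [sq, ← Finset.card_product, ← Finset.filter_product]
    have h4 : ∀ t ∈ B ×ˢ B, (Finset.univ.filter fun l => OnLine l t.1 ∧ OnLine l t.2).card ≤
        1 + if t.1 = t.2 then Fintype.card F else 0 := by
      intro t _
      split_ifs with h
      · rw [h, add_comm, ← card_lines_through t.2]
        exact Finset.card_le_card fun l hl => by simpa using hl
      · refine Finset.card_le_one.2 fun l hl l' hl' => ?_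
        rw [Finset.mem_filter] at hl hl'
        exact OnLine.unique h hl.2.1 hl.2.2 hl'.2.1 hl'.2.2
    rw [h3]
    refine (Finset.sum_le_sum h4).trans (le_of_eq ?_)
    rw [Finset.sum_add_distrib,
      Finset.sum_product (f := fun t => if t.1 = t.2 then Fintype.card F else 0)]
    simp only [Finset.sum_const, Finset.card_product, smul_eq_mul, Finset.sum_ite_eq,
      Finset.sum_ite_mem, Finset.inter_self]
    ring
  have h1' : ∑ l, ((B.filter (OnLine l)).card : ℝ) = B.card * (Fintype.card F + 1) := by
    exact_mod_cast h1
  have h2' : ∑ l, ((B.filter (OnLine l)).card : ℝ) ^ 2 ≤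
      B.card * Fintype.card F + (B.card : ℝ) ^ 2 := by
    exact_mod_cast h2
  have h3 : ∑ l, (((B.filter (OnLine l)).card : ℝ) - B.card / Fintype.card F) ^ 2 =
      ∑ l, ((B.filter (OnLine l)).card : ℝ) ^ 2 -
        2 * (B.card / Fintype.card F) * ∑ l, ((B.filter (OnLine l)).card : ℝ) +
        (Fintype.card F + 1) * Fintype.card F * (B.card / Fintype.card F : ℝ) ^ 2 := by
    have h4 : ((Fintype.card F + 1) * Fintype.card F * (B.card / Fintype.card F : ℝ) ^ 2 : ℝ) =
        ∑ _l : Option F × F, (B.card / Fintype.card F : ℝ) ^ 2 := by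
      rw [Finset.sum_const, Finset.card_univ, Fintype.card_prod, Fintype.card_option, nsmul_eq_mul]
      push_cast; ring
    rw [h4, Finset.mul_sum, ← Finset.sum_sub_distrib, ← Finset.sum_add_distrib]
    exact Finset.sum_congr rfl fun l _ => by ring
  rw [h3, h1']
  have h5 : (0 : ℝ) ≤ (B.card : ℝ) ^ 2 / Fintype.card F := by positivity
  have h6 : 2 * ((B.card : ℝ) / Fintype.card F) * (B.card * (Fintype.card F + 1)) =
      2 * (B.card : ℝ) ^ 2 + 2 * ((B.card : ℝ) ^ 2 / Fintype.card F) := by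
    field_simp
  have h7 : ((Fintype.card F + 1) * Fintype.card F * (B.card / Fintype.card F : ℝ) ^ 2 : ℝ) =
      (B.card : ℝ) ^ 2 + (B.card : ℝ) ^ 2 / Fintype.card F := by
    field_simp
  rw [h6, h7]
  linarith

open Classical in
/-- A weighted incidence bound for lines. -/
theorem sum_card_onLine_le {ι : Type*} (B : Finset (F × F)) (P : Finset ι) (key : ι → Option F × F) :
    ∑ q ∈ P, ((B.filter (OnLine (key q))).card : ℝ) ≤ P.card * B.card / Fintype.card F +
      √(Fintype.card F * B.card * ((P ×ˢ P).filter fun t => key t.1 = key t.2).card) := by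
  set N : Option F × F → ℝ := fun l => ((P.filter fun q => key q = l).card : ℝ) with hN
  have h1 : ∑ q ∈ P, (((B.filter (OnLine (key q))).card : ℝ) - B.card / Fintype.card F) =
      ∑ l, (((B.filter (OnLine l)).card : ℝ) - B.card / Fintype.card F) * N l := by
    rw [← Finset.sum_fiberwise P key]
    refine Finset.sum_congr rfl fun l _ => ?_
    rw [Finset.sum_congr rfl fun q hq => by rw [(Finset.mem_filter.1 hq).2], Finset.sum_const,
      nsmul_eq_mul, mul_comm]
  have h2 : ∑ l, N l ^ 2 = (((P ×ˢ P).filter fun t => key t.1 = key t.2).card : ℝ) := by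
    have h3 : ∑ l, (P.filter fun q => key q = l).card ^ 2 =
        ((P ×ˢ P).filter fun t => key t.1 = key t.2).card := by
      rw [Finset.card_eq_sum_card_fiberwise (f := fun t => key t.1) (t := Finset.univ)
        (fun _ _ => Finset.mem_univ _)]
      refine Finset.sum_congr rfl fun l _ => ?_
      rw [sq, ← Finset.card_product]
      congr 1
      ext t
      simp only [Finset.mem_filter, Finset.mem_product]
      constructor
      · rintro ⟨⟨h1, h2⟩, h3, h4⟩
        exact ⟨⟨⟨h1, h3⟩, h2.trans h4.symm⟩, h2⟩
      · rintro ⟨⟨⟨h1, h3⟩, h4⟩, h2⟩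
        exact ⟨⟨h1, h2⟩, h3, h4.symm.trans h2⟩
    simp only [hN]
    exact_mod_cast h3
  have h4 : ∑ l, (((B.filter (OnLine l)).card : ℝ) - B.card / Fintype.card F) * N l ≤
      √(Fintype.card F * B.card * ((P ×ˢ P).filter fun t => key t.1 = key t.2).card) := by
    refine Real.le_sqrt_of_sq_le ((Finset.sum_mul_sq_le_sq_mul_sq _ _ _).trans ?_)
    rw [h2]
    exact mul_le_mul_of_nonneg_right (sum_sq_lines_sub_le B) (Nat.cast_nonneg _)
  rw [← h1, Finset.sum_sub_distrib, Finset.sum_const, nsmul_eq_mul] at h4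
  rw [mul_div_assoc]
  linarith

end Lines
end Stmt1

namespace Stmt1

section Isotropic

variable {F K : Type*} [Field F] [Field K] [Algebra F K]

/-- The isotropic coordinate `x + i y`. -/
def isoCoord (i : K) (x : F × F) : K := algebraMap F K x.1 + i * algebraMap F K x.2

theorem isoDist_isoCoord {i : K} (hi : i ^ 2 = -1) (x y : F × F) :
    isoDist (isoCoord i) (isoCoord (-i)) x y = algebraMap F K (dist2 x y) := by
  simp only [isoDist, isoCoord, dist2, map_add, map_sub, map_pow]
  linear_combination -(algebraMap F K x.2 - algebraMap F K y.2) ^ 2 * hi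

theorem isoCoord_injective {i : K} (hi : i ^ 2 = -1) (h2 : (2 : F) ≠ 0) (a b : F × F)
    (h : isoCoord i a = isoCoord i b) (h' : isoCoord (-i) a = isoCoord (-i) b) : a = b := by
  have h2' : (2 : K) ≠ 0 := by
    have := (map_ne_zero (algebraMap F K)).2 h2
    rwa [map_ofNat] at this
  have hi0 : i ≠ 0 := by
    rintro rfl
    simp at hi
  unfold isoCoord at h h'
  refine Prod.ext ((algebraMap F K).injective (mul_left_cancel₀ h2' ?_))
    ((algebraMap F K).injective (mul_left_cancel₀ (mul_ne_zero h2' hi0) ?_))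
  · linear_combination h + h'
  · linear_combination h - h'

open Classical in
/-- The perpendicular bisector of `a` and `b`. -/
noncomputable def bisectorLine (q : (F × F) × (F × F)) : Option F × F :=
  if q.2.2 - q.1.2 = 0 then (none, (dist2 q.2 0 - dist2 q.1 0) / 2 / (q.2.1 - q.1.1))
  else (some (-(q.2.1 - q.1.1) / (q.2.2 - q.1.2)),
    (dist2 q.2 0 - dist2 q.1 0) / 2 / (q.2.2 - q.1.2))

theorem onLine_bisectorLine (h2 : (2 : F) ≠ 0) {a b e : F × F} (hab : a ≠ b)
    (h : dist2 e a = dist2 e b) : OnLine (bisectorLine (a, b)) e := by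
  unfold dist2 at h
  by_cases h0 : b.2 - a.2 = 0
  · have h1 : b.1 - a.1 ≠ 0 := by
      intro h1
      exact hab (Prod.ext (sub_eq_zero.1 h1).symm (sub_eq_zero.1 h0).symm)
    simp only [bisectorLine, h0, if_true, OnLine, dist2, Prod.fst_zero, Prod.snd_zero]
    field_simp
    linear_combination h - 2 * e.2 * h0
  · simp only [bisectorLine, h0, if_false, OnLine, dist2, Prod.fst_zero, Prod.snd_zero]
    field_simp
    linear_combination h

theorem sameBisector_of_cross {V : Type*} {α β : V → K} {a b c d : V} (hab : β b - β a ≠ 0)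
    (hcd : β d - β c ≠ 0) (h1 : (α b - α a) * (β d - β c) = (α d - α c) * (β b - β a))
    (h2 : (α b * β b - α a * β a) * (β d - β c) = (α d * β d - α c * β c) * (β b - β a)) :
    SameBisector α β a b c d := by
  have hκ : -(α b - α a) / (β b - β a) = -(α d - α c) / (β d - β c) := by
    rw [div_eq_div_iff hab hcd]; linear_combination -h1
  have hτ : (α b * β b - α a * β a) / (β b - β a) = (α d * β d - α c * β c) / (β d - β c) := by
    rw [div_eq_div_iff hab hcd]; exact h2
  refine ⟨-(α b - α a) / (β b - β a), (α b * β b - α a * β a) / (β b - β a), ?_, ?_, ?_, ?_⟩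
  · field_simp; ring
  · field_simp; ring
  · rw [hκ, hτ]; field_simp; ring
  · rw [hκ, hτ]; field_simp; ring

theorem cross_of_bisectorLine_eq (h2 : (2 : F) ≠ 0) {q q' : (F × F) × (F × F)} (hq : q.1 ≠ q.2)
    (hq' : q'.1 ≠ q'.2) (h : bisectorLine q = bisectorLine q') :
    (q.2.1 - q.1.1) * (q'.2.2 - q'.1.2) = (q'.2.1 - q'.1.1) * (q.2.2 - q.1.2) ∧
    (dist2 q.2 0 - dist2 q.1 0) * (q'.2.2 - q'.1.2) =
      (dist2 q'.2 0 - dist2 q'.1 0) * (q.2.2 - q.1.2) ∧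
    (dist2 q.2 0 - dist2 q.1 0) * (q'.2.1 - q'.1.1) =
      (dist2 q'.2 0 - dist2 q'.1 0) * (q.2.1 - q.1.1) := by
  have key : ∀ t : (F × F) × (F × F), t.1 ≠ t.2 → t.2.2 - t.1.2 = 0 → t.2.1 - t.1.1 ≠ 0 := by
    intro t ht h0 h1
    exact ht (Prod.ext (sub_eq_zero.1 h1).symm (sub_eq_zero.1 h0).symm)
  unfold bisectorLine at h
  generalize dist2 q.2 0 = D₂ at *
  generalize dist2 q.1 0 = D₁ at *
  generalize dist2 q'.2 0 = D₂' at *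
  generalize dist2 q'.1 0 = D₁' at *
  have k1 := key q hq
  have k2 := key q' hq'
  generalize q.2.2 - q.1.2 = n₂ at *
  generalize q.2.1 - q.1.1 = n₁ at *
  generalize q'.2.2 - q'.1.2 = n₂' at *
  generalize q'.2.1 - q'.1.1 = n₁' at *
  split_ifs at h with g1 g2 g2
  · have k1 := k1 g1
    have k2 := k2 g2
    subst g1 g2
    simp only [Prod.mk.injEq, true_and] at h
    field_simp at h
    refine ⟨by ring, by ring, ?_⟩
    linear_combination h
  · simp at h
  · simp at h
  · simp only [Prod.mk.injEq, Option.some.injEq] at h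
    obtain ⟨h, h'⟩ := h
    field_simp at h h'
    refine ⟨by linear_combination -h, by linear_combination h', ?_⟩
    refine mul_left_cancel₀ g1 ?_
    linear_combination (D₂ - D₁) * h + n₁ * h'

open Classical in
theorem sum_goodPairs_le [Fintype F] {i : K} (hi : i ^ 2 = -1) (h2 : (2 : F) ≠ 0)
    (B A : Finset (F × F)) (K₀ : ℕ) :
    ((∑ q ∈ goodPairs (isoCoord i) (isoCoord (-i)) A K₀, (B.filter fun e =>
      isoDist (isoCoord i) (isoCoord (-i)) e q.1 = isoDist (isoCoord i) (isoCoord (-i)) e q.2).card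
        : ℕ) : ℝ) ≤ (A.card : ℝ) ^ 2 * B.card / Fintype.card F +
      √(Fintype.card F * B.card * (bisectorQuads (isoCoord i) (isoCoord (-i)) A K₀).card) := by
  set P := goodPairs (isoCoord i) (isoCoord (-i)) A K₀ with hP
  have hne : ∀ q ∈ P, q.1 ≠ q.2 := by
    intro q hq h
    obtain ⟨-, h3, -⟩ := mem_goodPairs.1 hq
    exact h3 (by rw [h])
  have h1 : ((∑ q ∈ P, (B.filter fun e => isoDist (isoCoord i) (isoCoord (-i)) e q.1 =
      isoDist (isoCoord i) (isoCoord (-i)) e q.2).card : ℕ) : ℝ) ≤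
      ∑ q ∈ P, ((B.filter (OnLine (bisectorLine q))).card : ℝ) := by
    push_cast
    refine Finset.sum_le_sum fun q hq => Nat.cast_le.2 (Finset.card_le_card fun e he => ?_)
    obtain ⟨h3, h4⟩ := Finset.mem_filter.1 he
    rw [isoDist_isoCoord hi, isoDist_isoCoord hi] at h4
    exact Finset.mem_filter.2 ⟨h3,
      onLine_bisectorLine h2 (hne q hq) ((algebraMap F K).injective h4)⟩
  refine h1.trans ((sum_card_onLine_le B P bisectorLine).trans ?_)
  have h3 : P.card ≤ A.card ^ 2 := by
    rw [sq, ← Finset.card_product]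
    exact Finset.card_le_card fun t ht => Finset.mem_product.2 (mem_goodPairs.1 ht).1
  have h4 : ((P ×ˢ P).filter fun t => bisectorLine t.1 = bisectorLine t.2).card ≤
      (bisectorQuads (isoCoord i) (isoCoord (-i)) A K₀).card := by
    refine Finset.card_le_card fun t ht => ?_
    obtain ⟨h5, h6⟩ := Finset.mem_filter.1 ht
    rw [Finset.mem_product] at h5
    refine mem_bisectorQuads.2 ⟨h5, ?_⟩
    obtain ⟨c1, c2, c3⟩ := cross_of_bisectorLine_eq h2 (hne _ h5.1) (hne _ h5.2) h6
    obtain ⟨-, -, g1, -⟩ := mem_goodPairs.1 h5.1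
    obtain ⟨-, -, g2, -⟩ := mem_goodPairs.1 h5.2
    have c1 := congrArg (algebraMap F K) c1
    have c2 := congrArg (algebraMap F K) c2
    have c3 := congrArg (algebraMap F K) c3
    simp only [dist2, map_mul, map_sub, map_add, map_pow, Prod.fst_zero, Prod.snd_zero,
      sub_zero] at c1 c2 c3
    refine sameBisector_of_cross (sub_ne_zero.2 g1.symm) (sub_ne_zero.2 g2.symm) ?_ ?_
    · simp only [isoCoord]
      linear_combination -2 * i * c1
    · have hm : ∀ x : F × F, isoCoord i x * isoCoord (-i) x =
          algebraMap F K x.1 ^ 2 + algebraMap F K x.2 ^ 2 := by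
        intro x
        simp only [isoCoord]
        linear_combination -(algebraMap F K x.2) ^ 2 * hi
      rw [hm, hm, hm, hm]
      simp only [isoCoord]
      linear_combination c3 - i * c2
  gcongr
  exact_mod_cast h3

end Isotropic
end Stmt1

namespace Stmt1

section PinnedLowerBound

variable {F K : Type*} [Field F] [Field K] [Algebra F K]

theorem card_isoCoord_eq_le [Fintype F] {i : K} (hi : i ^ 2 = -1) (A : Finset (F × F))
    (h : ∀ a ∈ A, ∀ b ∈ A, isoCoord i a = isoCoord i b) : A.card ≤ Fintype.card F := by
  have hi0 : i ≠ 0 := by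
    rintro rfl
    simp at hi
  refine Finset.card_le_card_of_injOn (t := Finset.univ) Prod.fst (fun _ _ => Finset.mem_univ _) ?_
  intro a ha b hb hab
  have h1 := h a ha b hb
  simp only [isoCoord, hab, add_right_inj] at h1
  exact Prod.ext hab ((algebraMap F K).injective (mul_left_cancel₀ hi0 h1))

open Classical in
theorem card_isotropic_le [Fintype F] {i : K} (hi : i ^ 2 = -1) (A : Finset (F × F)) (e : F × F) :
    (A.filter fun a => isoDist (isoCoord i) (isoCoord (-i)) e a = 0).card ≤
      2 * Fintype.card F := by
  have h1 : (A.filter fun a => isoCoord i a = isoCoord i e).card ≤ Fintype.card F :=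
    card_isoCoord_eq_le hi _ fun a ha b hb =>
      (Finset.mem_filter.1 ha).2.trans (Finset.mem_filter.1 hb).2.symm
  have h2 : (A.filter fun a => isoCoord (-i) a = isoCoord (-i) e).card ≤ Fintype.card F :=
    card_isoCoord_eq_le (by rw [neg_sq, hi]) _ fun a ha b hb =>
      (Finset.mem_filter.1 ha).2.trans (Finset.mem_filter.1 hb).2.symm
  have h3 : (A.filter fun a => isoDist (isoCoord i) (isoCoord (-i)) e a = 0) ⊆
      (A.filter fun a => isoCoord i a = isoCoord i e) ∪
        A.filter fun a => isoCoord (-i) a = isoCoord (-i) e := by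
    intro a ha
    obtain ⟨h3, h4⟩ := Finset.mem_filter.1 ha
    rw [Finset.mem_union, Finset.mem_filter, Finset.mem_filter]
    rcases mul_eq_zero.1 h4 with h | h
    · exact Or.inl ⟨h3, (sub_eq_zero.1 h).symm⟩
    · exact Or.inr ⟨h3, (sub_eq_zero.1 h).symm⟩
  have h4 := (Finset.card_le_card h3).trans (Finset.card_union_le _ _)
  omega

theorem card_sq_le_card_image_mul {V W : Type*} [DecidableEq W] (S : Finset V) (f : V → W) :
    S.card ^ 2 ≤ (S.image f).card * ∑ a ∈ S, (S.filter fun b => f a = f b).card := by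
  have h1 : ∑ a ∈ S, (S.filter fun b => f a = f b).card =
      ∑ w ∈ S.image f, (S.filter fun b => f b = w).card ^ 2 := by
    rw [← Finset.sum_fiberwise_of_maps_to (t := S.image f) (g := f)
      fun a ha => Finset.mem_image_of_mem f ha]
    refine Finset.sum_congr rfl fun w _ => ?_
    rw [sq, ← smul_eq_mul, ← Finset.sum_const]
    refine Finset.sum_congr rfl fun a ha => ?_
    rw [(Finset.mem_filter.1 ha).2]
    simp only [eq_comm]
  rw [h1, Finset.card_eq_sum_card_image f S]
  exact sq_sum_le_card_mul_sum_sq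

theorem card_image_dist2_le_pinnedCount [DecidableEq F] {A S : Finset (F × F)} (h : S ⊆ A)
    (e : F × F) : (S.image fun a => dist2 a e).card ≤ pinnedCount A e := by
  rw [pinnedCount, ← Set.ncard_coe_finset, Finset.coe_image]
  exact Set.ncard_le_ncard (Set.image_mono h) (A.finite_toSet.image _)

open Classical in
theorem exists_card_sq_le_pinnedCount [Fintype F] {i : K} (hi : i ^ 2 = -1) {A A₀ : Finset (F × F)}
    (hA : A₀ ⊆ A) (e : F × F) : ∃ k, A₀.card ≤ k + 2 * Fintype.card F ∧
      k ^ 2 ≤ pinnedCount A e * ∑ a ∈ A₀, (A₀.filter fun b =>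
        isoDist (isoCoord i) (isoCoord (-i)) e a = isoDist (isoCoord i) (isoCoord (-i)) e b ∧
          isoDist (isoCoord i) (isoCoord (-i)) e a ≠ 0).card := by
  set d : F × F → K := isoDist (isoCoord i) (isoCoord (-i)) e with hd
  have hdist : ∀ a, d a = algebraMap F K (dist2 a e) := by
    intro a
    rw [hd, isoDist_comm, isoDist_isoCoord hi]
  set S := A₀.filter fun a => ¬ d a = 0 with hS
  refine ⟨S.card, ?_, ?_⟩
  · rw [← Finset.card_filter_add_card_filter_not (s := A₀) fun a => d a = 0, add_comm]
    exact Nat.add_le_add_left (card_isotropic_le hi A₀ e) _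
  · have hSA : S ⊆ A₀ := Finset.filter_subset _ _
    refine (card_sq_le_card_image_mul S fun a => dist2 a e).trans (Nat.mul_le_mul
      (card_image_dist2_le_pinnedCount (hSA.trans hA) e) ?_)
    refine le_trans (Finset.sum_le_sum fun a ha => Finset.card_le_card fun b hb => ?_)
      (Finset.sum_le_sum_of_subset hSA)
    obtain ⟨h1, h2⟩ := Finset.mem_filter.1 hb
    exact Finset.mem_filter.2 ⟨hSA h1, by rw [hdist, hdist, h2], (Finset.mem_filter.1 ha).2⟩

/-- Few pinned distances force many isosceles triangles. -/
theorem card_apexTriples_ge [Fintype F] {i : K} (hi : i ^ 2 = -1) {A A₀ B : Finset (F × F)}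
    (hA : A₀ ⊆ A) {D : ℝ} (hB : ∀ e ∈ B, (pinnedCount A e : ℝ) ≤ D)
    (hcard : 2 * (Fintype.card F : ℝ) ≤ A₀.card) :
    B.card * ((A₀.card : ℝ) - 2 * Fintype.card F) ^ 2 ≤
      D * (apexTriples (isoCoord i) (isoCoord (-i)) B A₀).card := by
  classical
  rw [card_apexTriples_eq, Nat.cast_sum, Finset.mul_sum, ← nsmul_eq_mul, ← Finset.sum_const]
  refine Finset.sum_le_sum fun e he => ?_
  obtain ⟨k, h1, h2⟩ := exists_card_sq_le_pinnedCount hi hA e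
  have h1' : (A₀.card : ℝ) ≤ k + 2 * Fintype.card F := by exact_mod_cast h1
  have h2' := Nat.cast_le (α := ℝ).2 h2
  rw [Nat.cast_mul, Nat.cast_pow] at h2'
  calc ((A₀.card : ℝ) - 2 * Fintype.card F) ^ 2 ≤ (k : ℝ) ^ 2 :=
        pow_le_pow_left₀ (by linarith) (by linarith) 2
    _ ≤ _ := h2'
    _ ≤ _ := mul_le_mul_of_nonneg_right (hB e he) (Nat.cast_nonneg _)

end PinnedLowerBound

section RealInequalities

theorem apex_bootstrap {s n Q T C : ℝ} (hs : 1 ≤ s) (hC : 1000 ≤ C) (hn : C * s ^ 5 ≤ n)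
    (hT : 0 ≤ T) (hQ : Q ≤ 13 * s ^ 3 * n ^ 2 + 20000 * (n * √(n * T)))
    (hTQ : T ≤ 7 * n ^ 2 + n ^ 3 / s ^ 4 + √(s ^ 4 * n * Q)) :
    Q ≤ 13 * s ^ 3 * n ^ 2 + 60000 * (n ^ 3 / s ^ 2) := by
  have hs0 : 0 < s := by linarith
  have hn0 : 0 < n := lt_of_lt_of_le (by positivity) hn
  have hCs : 1000 * s ^ 5 ≤ n := le_trans (by gcongr) hn
  set u := √(T * s ^ 4 / n ^ 3) with hu
  have hu0 : 0 ≤ u := Real.sqrt_nonneg _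
  have hTu : T = u ^ 2 * (n ^ 3 / s ^ 4) := by
    rw [hu, Real.sq_sqrt (by positivity)]; field_simp
  have h1 : √(n * T) = u * (n ^ 2 / s ^ 2) := by
    rw [hTu, Real.sqrt_eq_iff_mul_self_eq (by positivity) (by positivity)]
    field_simp
  rw [h1] at hQ
  have hQu : Q ≤ 13 * s ^ 3 * n ^ 2 + 20000 * u * (n ^ 3 / s ^ 2) := by
    refine hQ.trans (le_of_eq ?_)
    ring
  suffices hu3 : u ≤ 3 by
    refine hQu.trans ?_
    have : u * (n ^ 3 / s ^ 2) ≤ 3 * (n ^ 3 / s ^ 2) := by gcongr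
    linarith
  have h2 : √(s ^ 4 * n * Q) ≤ (1 + u) * (n ^ 3 / s ^ 4) := by
    refine Real.sqrt_le_iff.2 ⟨by positivity, ?_⟩
    have h3 : s ^ 4 * n * Q ≤ 13 * s ^ 7 * n ^ 3 + 20000 * u * (s ^ 2 * n ^ 4) := by
      calc s ^ 4 * n * Q ≤ s ^ 4 * n * (13 * s ^ 3 * n ^ 2 + 20000 * u * (n ^ 3 / s ^ 2)) := by
            gcongr
        _ = _ := by field_simp
    have h4 : 1000000 * (s ^ 2 * n ^ 4) ≤ (n ^ 3 / s ^ 4) ^ 2 := by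
      rw [div_pow, le_div_iff₀ (by positivity)]
      calc 1000000 * (s ^ 2 * n ^ 4) * (s ^ 4) ^ 2 = (1000 * s ^ 5) ^ 2 * n ^ 4 := by ring
        _ ≤ n ^ 2 * n ^ 4 := by gcongr
        _ = _ := by ring
    have h5 : 1000000000 * (s ^ 7 * n ^ 3) ≤ (n ^ 3 / s ^ 4) ^ 2 := by
      rw [div_pow, le_div_iff₀ (by positivity)]
      calc 1000000000 * (s ^ 7 * n ^ 3) * (s ^ 4) ^ 2 = (1000 * s ^ 5) ^ 3 * n ^ 3 := by ring
        _ ≤ n ^ 3 * n ^ 3 := by gcongr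
        _ = _ := by ring
    have h6 := mul_le_mul_of_nonneg_left h4 hu0
    have h7 : 0 ≤ (n ^ 3 / s ^ 4) ^ 2 := by positivity
    have h8 : 0 ≤ u * (n ^ 3 / s ^ 4) ^ 2 := by positivity
    have h9 : 0 ≤ u ^ 2 * (n ^ 3 / s ^ 4) ^ 2 := by positivity
    rw [mul_pow]
    nlinarith
  have h3 : 7 * n ^ 2 ≤ n ^ 3 / s ^ 4 := by
    rw [le_div_iff₀ (by positivity)]
    have h4 : s ^ 4 ≤ s ^ 5 := pow_le_pow_right₀ hs (by norm_num)
    calc 7 * n ^ 2 * s ^ 4 ≤ n ^ 2 * (1000 * s ^ 5) := by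
            have h5 := mul_le_mul_of_nonneg_left h4 (sq_nonneg n)
            have h6 : 0 ≤ n ^ 2 * s ^ 4 := by positivity
            linarith
      _ ≤ n ^ 2 * n := by gcongr
      _ = _ := by ring
  have h4 : u ^ 2 * (n ^ 3 / s ^ 4) ≤ (3 + u) * (n ^ 3 / s ^ 4) := by
    rw [← hTu]; linarith
  have h5 := le_of_mul_le_mul_right h4 (by positivity)
  nlinarith

theorem apex_contradiction {s n m Q T ε : ℝ} (hε : 0 < ε) (hε1 : ε < 1) (hs : 1 ≤ s)
    (hn : 1000 / ε ^ 2 * s ^ 5 ≤ n) (hm : ε * n < m)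
    (hQ : Q ≤ 13 * s ^ 3 * n ^ 2 + 60000 * (n ^ 3 / s ^ 2))
    (hT : T ≤ m * n + 2 * n * (n + 2 * m) + n ^ 2 * m / s ^ 4 + √(s ^ 4 * m * Q))
    (hlow : m * (n - 2 * s ^ 4) ^ 2 ≤ (1 - ε) * s ^ 4 * T) : False := by
  have hs0 : 0 < s := by linarith
  have hn0 : 0 < n := lt_of_lt_of_le (by positivity) hn
  have hm0 : 0 < m := lt_trans (by positivity) hm
  have hn' : 1000 * s ^ 5 ≤ ε ^ 2 * n := by
    have := mul_le_mul_of_nonneg_left hn (sq_nonneg ε)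
    refine le_trans (le_of_eq ?_) this
    field_simp
  have hs45 : s ^ 4 ≤ s ^ 5 := pow_le_pow_right₀ hs (by norm_num)
  have hsn : 1000 * s ^ 4 ≤ ε ^ 2 * n := by linarith
  have hεn : ε ^ 2 * n ≤ ε * n := by
    have : ε ^ 2 ≤ ε := by nlinarith
    gcongr
  have hsn1 : 1000 * s ^ 4 ≤ ε * n := hsn.trans hεn
  have hsm : 1000 * s ^ 4 ≤ ε * m := by nlinarith
  -- the main term is `W`, all other terms are small multiples of it
  have h1 : √(s ^ 4 * m * Q) ≤ ε / 4 * (n ^ 2 * m / s ^ 4) := by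
    refine Real.sqrt_le_iff.2 ⟨by positivity, ?_⟩
    have h2 : s ^ 4 * m * Q ≤ 13 * (s ^ 7 * n ^ 2 * m) + 60000 * (s ^ 2 * n ^ 3 * m) := by
      calc s ^ 4 * m * Q ≤ s ^ 4 * m * (13 * s ^ 3 * n ^ 2 + 60000 * (n ^ 3 / s ^ 2)) := by gcongr
        _ = _ := by field_simp
    have h3 : 62500 * (s ^ 2 * n ^ 3 * m) ≤ (ε / 4 * (n ^ 2 * m / s ^ 4)) ^ 2 := by
      rw [mul_pow, div_pow (n ^ 2 * m), ← mul_div_assoc, le_div_iff₀ (by positivity)]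
      have h4 : (1000 * s ^ 5) ^ 2 ≤ (ε ^ 2 * n) * (ε * n) := by
        rw [sq]
        exact mul_le_mul hn' (hn'.trans hεn) (by positivity) (by positivity)
      have h5 : (ε ^ 2 * n) * (ε * n) ≤ ε ^ 2 * n * m := by gcongr
      have h6 := mul_le_mul_of_nonneg_right (h4.trans h5) (by positivity : 0 ≤ n ^ 3 * m / 16)
      calc 62500 * (s ^ 2 * n ^ 3 * m) * (s ^ 4) ^ 2 = (1000 * s ^ 5) ^ 2 * (n ^ 3 * m / 16) := by
            ring
        _ ≤ _ := h6
        _ = _ := by ring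
    have h4 : 1000 * (s ^ 7 * n ^ 2 * m) ≤ s ^ 2 * n ^ 3 * m := by
      have h5 : 1000 * s ^ 5 ≤ n := by nlinarith
      have h6 := mul_le_mul_of_nonneg_left h5 (by positivity : 0 ≤ s ^ 2 * n ^ 2 * m)
      calc 1000 * (s ^ 7 * n ^ 2 * m) = s ^ 2 * n ^ 2 * m * (1000 * s ^ 5) := by ring
        _ ≤ _ := h6
        _ = _ := by ring
    have h5 : 0 ≤ s ^ 2 * n ^ 3 * m := by positivity
    linarith
  have h2 : s ^ 4 * T ≤ (1 + ε / 4) * (n ^ 2 * m) + s ^ 4 * (5 * m * n + 2 * n ^ 2) := by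
    calc s ^ 4 * T ≤ s ^ 4 * (m * n + 2 * n * (n + 2 * m) + n ^ 2 * m / s ^ 4 +
          ε / 4 * (n ^ 2 * m / s ^ 4)) := by gcongr; linarith
      _ = _ := by field_simp; ring
  have h3 : s ^ 4 * (5 * m * n + 2 * n ^ 2) ≤ ε / 100 * (n ^ 2 * m) := by
    have h4 := mul_le_mul_of_nonneg_right hsn1 (by positivity : 0 ≤ m * n)
    have h5 := mul_le_mul_of_nonneg_right hsm (by positivity : 0 ≤ n ^ 2)
    have h6 : 0 ≤ ε * n ^ 2 * m := by positivity
    linarith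
  have h4 : (1 - ε / 100) * (n ^ 2 * m) ≤ m * (n - 2 * s ^ 4) ^ 2 := by
    have h5 := mul_le_mul_of_nonneg_right hsn1 (by positivity : 0 ≤ m * n)
    have h6 : 0 ≤ m * (2 * s ^ 4) ^ 2 := by positivity
    have h7 : 0 ≤ ε * n ^ 2 * m := by positivity
    linarith
  have h5 : (1 - ε) * s ^ 4 * T ≤ (1 - ε) * ((1 + ε / 4 + ε / 100) * (n ^ 2 * m)) := by
    rw [mul_assoc]
    refine mul_le_mul_of_nonneg_left ?_ (by linarith)
    linarith
  have h6 : (1 - ε / 100) * (n ^ 2 * m) ≤ ((1 - ε) * (1 + ε / 4 + ε / 100)) * (n ^ 2 * m) := by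
    rw [mul_assoc]; exact h4.trans (hlow.trans h5)
  have h7 := le_of_mul_le_mul_right h6 (by positivity)
  nlinarith

end RealInequalities
end Stmt1

namespace Stmt1

section Asymptotics

/-- A large set cannot have many pins with few distances. -/
theorem not_many_bad_pins {p : ℕ} [Fact p.Prime] {ε s : ℝ} (hε : 0 < ε) (hε1 : ε < 1)
    (hs : 1536 * (1000 / ε ^ 2) ^ 3 ≤ s) (hsp : s ^ 4 = p) {A B : Finset (ZMod p × ZMod p)}
    (hA : 4 * (1000 / ε ^ 2) * s ^ 5 ≤ A.card)
    (hB : ∀ e ∈ B, (pinnedCount A e : ℝ) ≤ (1 - ε) * p) : (B.card : ℝ) ≤ ε * A.card := by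
  classical
  by_contra! hlt
  set C : ℝ := 1000 / ε ^ 2 with hC
  have hC1 : 1000 ≤ C := by
    rw [hC, le_div_iff₀ (by positivity)]
    nlinarith
  have hCC : C ≤ C ^ 3 := le_self_pow₀ (by linarith) (by norm_num)
  have hs1 : 1536000 ≤ s := by linarith
  have hs0 : 0 < s := by linarith
  set M : ℕ := ⌈4 * C * s ^ 5⌉₊ with hM
  have hMA : M ≤ A.card := Nat.ceil_le.2 hA
  have hM1 : 4 * C * s ^ 5 ≤ M := Nat.le_ceil _
  have hs5 : 1 ≤ s ^ 5 := one_le_pow₀ (by linarith)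
  have hM2 : (M : ℝ) ≤ 8 * C * s ^ 5 := by
    have h1 : (M : ℝ) < 4 * C * s ^ 5 + 1 := Nat.ceil_lt_add_one (by positivity)
    nlinarith
  obtain ⟨A₁, hA₁A, hA₁⟩ := Finset.exists_subset_card_eq hMA
  set K₀ : ℕ := ⌈s ^ 3⌉₊ with hK₀
  have hK1 : s ^ 3 ≤ K₀ := Nat.le_ceil _
  have hK2 : (K₀ : ℝ) ≤ s ^ 3 + 1 := (Nat.ceil_lt_add_one (by positivity)).le
  have hKM : 4 * A₁.card ≤ K₀ ^ 2 := by
    have h1 : (4 * M : ℝ) ≤ (K₀ : ℝ) ^ 2 := by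
      calc (4 * M : ℝ) ≤ 32 * C * s ^ 5 := by linarith
        _ ≤ s * s ^ 5 := by gcongr; linarith
        _ = (s ^ 3) ^ 2 := by ring
        _ ≤ _ := by gcongr
    rw [hA₁]
    exact_mod_cast h1
  obtain ⟨i, hi⟩ := IsAlgClosed.exists_pow_nat_eq (-1 : AlgebraicClosure (ZMod p)) (n := 2)
    (by norm_num)
  have hp2 : (2 : ZMod p) ≠ 0 := by
    have h1 : (2 : ℝ) < p := by
      rw [← hsp]
      exact lt_of_lt_of_le (by linarith) (le_self_pow₀ (by linarith : 1 ≤ s) (by norm_num))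
    have h2 : 2 < p := by exact_mod_cast h1
    intro h0
    have h3 : ((2 : ℕ) : ZMod p) = 0 := by exact_mod_cast h0
    exact absurd (Nat.le_of_dvd (by norm_num) ((ZMod.natCast_eq_zero_iff 2 p).1 h3)) (by omega)
  have : CharP (AlgebraicClosure (ZMod p)) p :=
    charP_of_injective_algebraMap (algebraMap (ZMod p) (AlgebraicClosure (ZMod p))).injective p
  have : Infinite (AlgebraicClosure (ZMod p)) := IsAlgClosed.instInfinite
  have hinj := isoCoord_injective (F := ZMod p) hi hp2
  obtain ⟨A₀, hA₀A₁, hA₀, hthin⟩ := exists_isThin_subset hinj A₁ K₀ hKM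
  have hA₀M : A₀.card ≤ M := hA₁ ▸ Finset.card_le_card hA₀A₁
  have hKn : 4 * A₀.card ≤ K₀ ^ 2 := by rw [hA₁] at hKM; omega
  have hn : C * s ^ 5 ≤ A₀.card := by
    have h1 : (M : ℝ) ≤ 4 * A₀.card := by rw [hA₁] at hA₀; exact_mod_cast hA₀
    linarith
  have hn3 : 3 * A₀.card ^ 3 ≤ p ^ 4 := by
    have h1 : (3 * (A₀.card : ℝ) ^ 3) ≤ (p : ℝ) ^ 4 := by
      calc (3 * (A₀.card : ℝ) ^ 3) ≤ 3 * (8 * C * s ^ 5) ^ 3 := by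
            gcongr
            exact le_trans (by exact_mod_cast hA₀M) hM2
        _ = (1536 * C ^ 3) * s ^ 15 := by ring
        _ ≤ s * s ^ 15 := by gcongr
        _ = (p : ℝ) ^ 4 := by rw [← hsp]; ring
    exact_mod_cast h1
  have hQ := card_bisectorQuads_le p hinj hthin hn3
  have hT₀ := Nat.cast_le (α := ℝ).2 (card_apexTriples_le hinj A₀ A₀ K₀ hKn)
  have hT := Nat.cast_le (α := ℝ).2 (card_apexTriples_le hinj B A₀ K₀ hKn)
  have hL₀ := sum_goodPairs_le hi hp2 A₀ A₀ K₀
  have hL := sum_goodPairs_le hi hp2 B A₀ K₀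
  have hF : (Fintype.card (ZMod p) : ℝ) = s ^ 4 := by rw [ZMod.card, hsp]
  have hlow := card_apexTriples_ge hi (hA₀A₁.trans hA₁A) hB (by
    rw [hF]
    have h1 : s ^ 4 ≤ s ^ 5 := pow_le_pow_right₀ (by linarith) (by norm_num)
    nlinarith)
  rw [Nat.cast_add, Nat.cast_add, Nat.cast_mul, Nat.cast_mul, Nat.cast_mul, Nat.cast_add,
    Nat.cast_mul] at hT₀ hT
  rw [hF] at hL₀ hL hlow
  rw [← hsp] at hlow
  simp only [Nat.cast_ofNat] at hT₀ hT
  have hQ' : ((bisectorQuads (isoCoord i) (isoCoord (-i)) A₀ K₀).card : ℝ) ≤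
      13 * s ^ 3 * (A₀.card : ℝ) ^ 2 +
        20000 * (A₀.card * √(A₀.card * (apexTriples (isoCoord i) (isoCoord (-i)) A₀ A₀).card)) := by
    refine hQ.trans (add_le_add (mul_le_mul_of_nonneg_right ?_ (sq_nonneg _)) le_rfl)
    have h1 : s ≤ s ^ 3 := le_self_pow₀ (by linarith) (by norm_num)
    linarith
  refine apex_contradiction hε hε1 (by linarith) hn ?_ (apex_bootstrap (by linarith) hC1 hn
    (Nat.cast_nonneg _) hQ' ?_) ?_ hlow
  · refine lt_of_le_of_lt (mul_le_mul_of_nonneg_left ?_ hε.le) hlt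
    exact_mod_cast hA₀M.trans hMA
  · refine hT₀.trans ?_
    refine (add_le_add le_rfl hL₀).trans (le_of_eq ?_)
    ring_nf
  · refine hT.trans ?_
    refine (add_le_add le_rfl hL).trans (le_of_eq ?_)
    ring_nf

end Asymptotics

/-- For every `0 < ε < 1` and every increasing unbounded `ω : ℝ⁺ → ℝ⁺`, there is `p₀ = p₀(ε,ω)`
such that for every prime `p > p₀` and every `A ⊆ F_p²` with `|A| > ω(p)·p^(5/4)`, at least
`(1-ε)|A|` points `a ∈ A` satisfy `Δ(A;a) > (1-ε)p`. -/
theorem pinned_falconer_asymptotic :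
    ∀ ε : ℝ, 0 < ε → ε < 1 →
    ∀ ω : ℝ → ℝ,
      (∀ x : ℝ, 0 < x → 0 < ω x) →
      (∀ x y : ℝ, 0 < x → x < y → ω x < ω y) →
      (∀ M : ℝ, ∃ x : ℝ, 0 < x ∧ M < ω x) →
    ∃ p₀ : ℕ, ∀ p : ℕ, p.Prime → p₀ < p →
      ∀ A : Finset (ZMod p × ZMod p),
        ω p * (p : ℝ) ^ ((5 : ℝ) / 4) < (A.card : ℝ) →
        (1 - ε) * (A.card : ℝ) ≤
          (Set.ncard {a : ZMod p × ZMod p |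
            a ∈ A ∧ (1 - ε) * (p : ℝ) < (pinnedCount A a : ℝ)} : ℝ) := by
  intro ε hε hε1 ω _ hmono hunb
  obtain ⟨x, hx, hωx⟩ := hunb (4 * (1000 / ε ^ 2))
  refine ⟨⌈max x ((1536 * (1000 / ε ^ 2) ^ 3) ^ 4)⌉₊, fun p hp hlt A hA => ?_⟩
  classical
  have : Fact p.Prime := ⟨hp⟩
  have hp0 : (0 : ℝ) ≤ p := Nat.cast_nonneg p
  obtain ⟨hxp, hsp⟩ := max_lt_iff.1 (Nat.lt_of_ceil_lt hlt)
  set s : ℝ := (p : ℝ) ^ ((1 : ℝ) / 4) with hs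
  have hs0 : 0 ≤ s := Real.rpow_nonneg hp0 _
  have hs4 : s ^ 4 = p := by
    rw [hs, ← Real.rpow_natCast, ← Real.rpow_mul hp0]
    norm_num
  have hs5 : s ^ 5 = (p : ℝ) ^ ((5 : ℝ) / 4) := by
    rw [hs, ← Real.rpow_natCast, ← Real.rpow_mul hp0]
    norm_num
  have hs' : 1536 * (1000 / ε ^ 2) ^ 3 ≤ s := by
    refine le_of_lt (lt_of_pow_lt_pow_left₀ 4 hs0 ?_)
    rwa [hs4]
  have hA' : 4 * (1000 / ε ^ 2) * s ^ 5 ≤ A.card := by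
    rw [hs5]
    refine le_trans (mul_le_mul_of_nonneg_right ?_ (Real.rpow_nonneg hp0 _)) hA.le
    exact (hωx.trans (hmono x p hx hxp)).le
  have hbad := not_many_bad_pins hε hε1 hs' hs4 hA'
    (B := A.filter fun a => ¬ (1 - ε) * (p : ℝ) < (pinnedCount A a : ℝ))
    (fun e he => not_lt.1 (Finset.mem_filter.1 he).2)
  have hgood : Set.ncard {a : ZMod p × ZMod p |
      a ∈ A ∧ (1 - ε) * (p : ℝ) < (pinnedCount A a : ℝ)} =
      (A.filter fun a => (1 - ε) * (p : ℝ) < (pinnedCount A a : ℝ)).card := by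
    rw [← Set.ncard_coe_finset, Finset.coe_filter]
  have hsum := Finset.card_filter_add_card_filter_not (s := A)
    fun a => (1 - ε) * (p : ℝ) < (pinnedCount A a : ℝ)
  have hsum' := congrArg (Nat.cast (R := ℝ)) hsum
  rw [Nat.cast_add] at hsum'
  rw [hgood]
  linarith

end Stmt1
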